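/- arXiv:1804.00439 — 2 statements merged into one kernel-verified Lean document; each statement's English description precedes it below -/
import Mathlib

section
/- Assume the limits ω₋ and ω₊ of q at −∞ and +∞ exist in the extended reals, that there exists D > 0 such that q(u) > ω₋ for all u ≤ −D and q(u) > ω₊ for all u ≥ D, and that max{ω₋,ω₊} > −∞. Then there exists s₀ ∈ (ā·ω₋, +∞) such that: for s > s₀, equation (WE_s) has no T-periodic solutions; for s = s₀, it has at least one T-periodic solution; for ā·ω₋ < s < s₀, it has at least one T-periodic solution; and for ā·max{ω₋,ω₊} < s < s₀, it has at least two T-periodic solutions. -/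
open MeasureTheory Set Filter

noncomputable section

/-- The Lebesgue measure restricted to the interval `[0,T]`. -/
def muT (T : ℝ) : Measure ℝ := volume.restrict (Icc 0 T)

/-- `u` is a `C¹` function on `[0,T]` with derivative `u'` there, satisfying the
`T`-periodic boundary conditions `u 0 = u T` and `u' 0 = u' T`. -/
def IsC1Periodic (T : ℝ) (u u' : ℝ → ℝ) : Prop :=
  (∀ t ∈ Icc (0:ℝ) T, HasDerivWithinAt u (u' t) (Icc (0:ℝ) T) t) ∧
    ContinuousOn u' (Icc (0:ℝ) T) ∧ u 0 = u T ∧ u' 0 = u' T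

/-- `φ ∘ u'` is absolutely continuous on `[0,T]`, being the indefinite integral of the
integrable function `w` (which is then its a.e. derivative). -/
def IsACPhiDeriv (T : ℝ) (φ : ℝ → ℝ) (u' w : ℝ → ℝ) : Prop :=
  IntegrableOn w (Icc (0:ℝ) T) ∧
    ∀ t ∈ Icc (0:ℝ) T, φ (u' t) = φ (u' 0) + ∫ τ in (0:ℝ)..t, w τ

/-- `u` is a `T`-periodic solution of `(φ(u'))' + f(u)u' + a(t) q(u) = s + e(t)`. -/
def IsSolWE (T : ℝ) (φ f q a e : ℝ → ℝ) (s : ℝ) (u : ℝ → ℝ) : Prop :=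
  ∃ u' w : ℝ → ℝ, IsC1Periodic T u u' ∧ IsACPhiDeriv T φ u' w ∧
    ∀ᵐ t ∂(muT T), w t + f (u t) * u' t + a t * q (u t) = s + e t

/-- A finite set `σ` is dominant for the family of orders induced by `r` if no point is
strictly above the minimum of `σ` in every order. -/
def IsDominant {ι X L : Type*} [LinearOrder L] (r : ι → X → L) (σ : Finset X) : Prop :=
  ∀ y, ∃ i, ∀ x ∈ σ, r i y ≤ r i x

theorem IsDominant.mono {ι X L : Type*} [LinearOrder L] {r : ι → X → L} {σ τ : Finset X}
    (h : IsDominant r σ) (hτ : τ ⊆ σ) : IsDominant r τ := fun y =>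
  (h y).imp fun _ hi x hx => hi x (hτ hx)

/-- A nonempty dominant set with one element less than the number of orders, such that no order
index is exceptional, extends to a dominant set by one more point in exactly two ways. -/
theorem IsDominant.card_extensions {ι X L : Type*} [Fintype ι] [DecidableEq ι] [Fintype X]
    [DecidableEq X] [LinearOrder L] {r : ι → X → L} (hr : ∀ i, Function.Injective (r i))
    {τ : Finset X} (hτ : IsDominant r τ) (hne : τ.Nonempty)
    (hcard : τ.card + 1 = Fintype.card ι)
    (hM : ∀ i, ∃ y, ∀ j, j ≠ i → ∃ z ∈ τ, r j z < r j y)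
    (S : Finset X) (hS : ∀ x, x ∈ S ↔ x ∉ τ ∧ IsDominant r (insert x τ)) :
    S.card = 2 := by
  have hg : ∀ i, ∃ z ∈ τ, ∀ x ∈ τ, r i z ≤ r i x := fun i => τ.exists_min_image (r i) hne
  choose g hgτ hgmin using hg
  have huniq : ∀ i y, y ∈ τ → (∀ x ∈ τ, r i y ≤ r i x) → g i = y := fun i y hy h =>
    hr i (le_antisymm (hgmin i y hy) (h _ (hgτ i)))
  have hsurj : ∀ y ∈ τ, ∃ i, g i = y := fun y hy =>
    (hτ y).imp fun i hi => huniq i y hy hi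
  obtain ⟨a, -, b, -, hab, hgab⟩ : ∃ a ∈ (Finset.univ : Finset ι), ∃ b ∈ (Finset.univ : Finset ι),
      a ≠ b ∧ g a = g b :=
    Finset.exists_ne_map_eq_of_card_lt_of_maps_to (t := τ) (by rw [Finset.card_univ]; omega)
      (fun i _ => hgτ i)
  have himg : ∀ i, i = a ∨ i = b → ∀ y ∈ τ, ∃ j, j ≠ i ∧ g j = y := by
    rintro i hi y hy
    obtain ⟨j, hj⟩ := hsurj y hy
    by_cases hji : j = i
    · subst hji
      rcases hi with rfl | rfl
      · exact ⟨b, hab.symm, hgab ▸ hj⟩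
      · exact ⟨a, hab, hgab ▸ hj⟩
    · exact ⟨j, hji, hj⟩
  -- the unique order index in which a new point is minimal is `a` or `b`
  have hkey : ∀ x, x ∉ τ → IsDominant r (insert x τ) →
      ∃ i, (i = a ∨ i = b) ∧ ∀ j, j ≠ i → r j (g j) < r j x := by
    intro x hx hdom
    obtain ⟨i, hi⟩ := hdom x
    have hlt : ∀ y ∈ τ, ∃ j, j ≠ i ∧ g j = y ∧ r j y < r j x := by
      intro y hy
      obtain ⟨j, hj⟩ := hdom y
      have hne' : r j y ≠ r j x := fun h => hx (hr j h ▸ hy)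
      have hlt : r j y < r j x := lt_of_le_of_ne (hj x (Finset.mem_insert_self _ _)) hne'
      refine ⟨j, ?_, huniq j y hy fun z hz => hj z (Finset.mem_insert_of_mem hz), hlt⟩
      rintro rfl
      exact absurd (hi y (Finset.mem_insert_of_mem hy)) (not_le.2 hlt)
    have : Nonempty ι := ⟨i⟩
    choose! k hki hgk hkx using hlt
    have hsub : τ.image k ⊆ Finset.univ.erase i := by
      intro j hj
      obtain ⟨y, hy, rfl⟩ := Finset.mem_image.1 hj
      simpa using hki y hy
    have hinj : Set.InjOn k τ := by
      intro y hy z hz h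
      rw [← hgk y hy, h, hgk z hz]
    have heq : τ.image k = Finset.univ.erase i := by
      apply Finset.eq_of_subset_of_card_le hsub
      rw [Finset.card_image_of_injOn hinj, Finset.card_erase_of_mem (Finset.mem_univ _),
        Finset.card_univ]
      omega
    have hall : ∀ j, j ≠ i → ∃ y ∈ τ, k y = j := by
      intro j hj
      have : j ∈ τ.image k := by rw [heq]; simpa using hj
      simpa using this
    refine ⟨i, ?_, ?_⟩
    · by_contra hcon
      push Not at hcon
      obtain ⟨y, hy, hya⟩ := hall a hcon.1.symm
      obtain ⟨z, hz, hzb⟩ := hall b hcon.2.symm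
      have : y = z := by rw [← hgk y hy, ← hgk z hz, hya, hzb, hgab]
      exact hab (by rw [← hya, ← hzb, this])
    · intro j hj
      obtain ⟨y, hy, rfl⟩ := hall j hj
      rw [hgk y hy]
      exact hkx y hy
  have hmax : ∀ i, ∃ x, (∀ j, j ≠ i → r j (g j) < r j x) ∧
      ∀ y, (∀ j, j ≠ i → r j (g j) < r j y) → r i y ≤ r i x := by
    intro i
    classical
    obtain ⟨x, hx, hxm⟩ := (Finset.univ.filter
      (fun x => ∀ j, j ≠ i → r j (g j) < r j x)).exists_max_image (r i) (by
        obtain ⟨y, hy⟩ := hM i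
        refine ⟨y, by
          simp only [Finset.mem_filter, Finset.mem_univ, true_and]
          intro j hj
          obtain ⟨z, hz, hzy⟩ := hy j hj
          exact (hgmin j z hz).trans_lt hzy⟩)
    simp only [Finset.mem_filter, Finset.mem_univ, true_and] at hx hxm
    exact ⟨x, hx, hxm⟩
  choose p hp hpmax using hmax
  have hno : ∀ y, ¬ ∀ j, r j (g j) < r j y := by
    intro y hy
    obtain ⟨j, hj⟩ := hτ y
    exact absurd (hj _ (hgτ j)) (not_le.2 (hy j))
  have hpab : p a ≠ p b := by
    intro h
    refine hno (p a) fun j => ?_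
    by_cases hja : j = a
    · rw [h]; exact hp b j (hja ▸ hab)
    · exact hp a j hja
  have hSeq : S = {p a, p b} := by
    ext x
    rw [hS, Finset.mem_insert, Finset.mem_singleton]
    constructor
    · rintro ⟨hx, hdom⟩
      obtain ⟨i, hi, hlt⟩ := hkey x hx hdom
      have hxp : x = p i := by
        refine hr i (le_antisymm (hpmax i x hlt) ?_)
        obtain ⟨k, hk⟩ := hdom (p i)
        have hki : k = i := by
          by_contra hki
          exact absurd (hk _ (Finset.mem_insert_of_mem (hgτ k))) (not_le.2 (hp i k hki))
        exact hki ▸ hk x (Finset.mem_insert_self _ _)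
      rcases hi with rfl | rfl
      · exact Or.inl hxp
      · exact Or.inr hxp
    · intro h
      obtain ⟨i, hi, rfl⟩ : ∃ i, (i = a ∨ i = b) ∧ x = p i := by
        rcases h with h | h
        · exact ⟨a, Or.inl rfl, h⟩
        · exact ⟨b, Or.inr rfl, h⟩
      constructor
      · intro hmem
        obtain ⟨j, hj, hjx⟩ := himg i hi _ hmem
        exact absurd (hp i j hj) (by rw [hjx]; exact lt_irrefl _)
      · intro y
        by_cases hy : ∀ j, j ≠ i → r j (g j) < r j y
        · obtain ⟨k, hk⟩ := hτ y
          have hki : k = i := by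
            by_contra hki
            exact absurd (hk _ (hgτ k)) (not_le.2 (hy k hki))
          subst hki
          refine ⟨k, fun z hz => ?_⟩
          rcases Finset.mem_insert.1 hz with rfl | hz
          · exact hpmax k y hy
          · exact hk z hz
        · push Not at hy
          obtain ⟨j, hj, hle⟩ := hy
          refine ⟨j, fun z hz => ?_⟩
          rcases Finset.mem_insert.1 hz with rfl | hz
          · exact hle.trans (hp i j hj).le
          · exact hle.trans (hgmin j z hz)
  rw [hSeq, Finset.card_pair hpab]

/-- For a set `σ` with as many elements as colours, the number of elements whose removal leaves
exactly the colours different from `i₀` is even, unless all colours occur in `σ`. -/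
theorem even_card_removable {ι X : Type*} [Fintype ι] [DecidableEq ι] [DecidableEq X]
    (c : X → ι) (i₀ : ι) (σ : Finset X) (hcard : σ.card = Fintype.card ι)
    (hσ : σ.image c ≠ Finset.univ) :
    Even (σ.filter fun x => (σ.erase x).image c = Finset.univ.erase i₀).card := by
  by_cases hemp : (σ.filter fun x => (σ.erase x).image c = Finset.univ.erase i₀) = ∅
  · rw [hemp]; simp
  obtain ⟨x, hx⟩ := Finset.nonempty_iff_ne_empty.2 hemp
  obtain ⟨hxσ, hxc⟩ := Finset.mem_filter.1 hx
  have himage : ∀ x ∈ σ, (σ.erase x).image c = Finset.univ.erase i₀ → c x ≠ i₀ := by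
    intro x hxσ hxc h
    apply hσ
    rw [← Finset.insert_erase hxσ, Finset.image_insert, hxc, h,
      Finset.insert_erase (Finset.mem_univ _)]
  have hinj : ∀ x ∈ σ, (σ.erase x).image c = Finset.univ.erase i₀ →
      Set.InjOn c (σ.erase x) := by
    intro x hxσ hxc
    rw [← Finset.card_image_iff, hxc, Finset.card_erase_of_mem hxσ,
      Finset.card_erase_of_mem (Finset.mem_univ _), Finset.card_univ, hcard]
  obtain ⟨y, hy, hyx⟩ : ∃ y ∈ σ.erase x, c y = c x := by
    have : c x ∈ (σ.erase x).image c := by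
      rw [hxc]; simpa using himage x hxσ hxc
    simpa using this
  have hyne : y ≠ x := (Finset.mem_erase.1 hy).1
  have hyσ : y ∈ σ := (Finset.mem_erase.1 hy).2
  have hset : (σ.filter fun x => (σ.erase x).image c = Finset.univ.erase i₀) = {x, y} := by
    ext z
    rw [Finset.mem_filter, Finset.mem_insert, Finset.mem_singleton]
    constructor
    · rintro ⟨hz, hzc⟩
      by_contra hcon
      push Not at hcon
      exact hyne (hinj z hz hzc (by simp [hyσ, hcon.2.symm]) (by simp [hxσ, hcon.1.symm]) hyx)
    · rintro (rfl | rfl)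
      · exact ⟨hxσ, hxc⟩
      · refine ⟨hyσ, ?_⟩
        rw [← hxc]
        ext i
        simp only [Finset.mem_image, Finset.mem_erase]
        constructor
        · rintro ⟨w, ⟨hw, hwσ⟩, rfl⟩
          by_cases hwx : w = x
          · exact ⟨z, ⟨hyne, hyσ⟩, by rw [hyx, hwx]⟩
          · exact ⟨w, ⟨hwx, hwσ⟩, rfl⟩
        · rintro ⟨w, ⟨hw, hwσ⟩, rfl⟩
          by_cases hwz : w = z
          · exact ⟨x, ⟨hyne.symm, hxσ⟩, by rw [hwz, hyx]⟩
          · exact ⟨w, ⟨hwz, hwσ⟩, rfl⟩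
  rw [hset, Finset.card_pair hyne.symm]
  exact even_two

/-- **Scarf's lemma**, in the form with slack points `ε i`. -/
theorem exists_isDominant_image_eq_univ {ι X L : Type*} [Fintype ι] [DecidableEq ι] [Nonempty ι]
    [Fintype X] [DecidableEq X] [LinearOrder L] {r : ι → X → L}
    (hr : ∀ i, Function.Injective (r i)) (ε : ι → X)
    (hε : ∀ i y, y ≠ ε i → r i (ε i) < r i y)
    (hε' : ∀ i k y, k ≠ i → y ∉ Set.range ε → r i y < r i (ε k))
    (hX : ∃ y, y ∉ Set.range ε) (c : X → ι) (hc : ∀ i, c (ε i) = i) :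
    ∃ σ : Finset X, IsDominant r σ ∧ σ.image c = Finset.univ := by
  classical
  by_contra hcon
  push Not at hcon
  obtain ⟨i₀⟩ := ‹Nonempty ι›
  have hεinj : Function.Injective ε := fun i j h => by rw [← hc i, h, hc]
  set doors : Finset (Finset X) := Finset.univ.filter fun τ =>
    τ.card + 1 = Fintype.card ι ∧ IsDominant r τ ∧ τ.image c = Finset.univ.erase i₀ with hdoors
  set rooms : Finset (Finset X) := Finset.univ.filter fun σ =>
    σ.card = Fintype.card ι ∧ IsDominant r σ with hrooms
  set Inc : Finset X → Finset X → Prop := fun τ σ => τ ⊆ σ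
  have hcount := Finset.sum_card_bipartiteAbove_eq_sum_card_bipartiteBelow
    (s := doors) (t := rooms) Inc
  -- the rooms above a door correspond to the points that can be added
  have habove : ∀ τ ∈ doors, (rooms.bipartiteAbove Inc τ).card =
      (Finset.univ.filter fun x => x ∉ τ ∧ IsDominant r (insert x τ)).card := by
    intro τ hτ
    have hτ' := (Finset.mem_filter.1 hτ).2
    symm
    refine Finset.card_bij (fun x _ => insert x τ) ?_ ?_ ?_
    · intro x hx
      have hx' := (Finset.mem_filter.1 hx).2
      simp only [Finset.bipartiteAbove, Finset.mem_filter, hrooms, Finset.mem_univ, true_and]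
      exact ⟨⟨by rw [Finset.card_insert_of_notMem hx'.1, hτ'.1], hx'.2⟩, Finset.subset_insert _ _⟩
    · intro x hx y hy h
      have hx' := (Finset.mem_filter.1 hx).2
      have hxy : x ∈ insert y τ := by
        have h' : insert x τ = insert y τ := h
        rw [← h']; exact Finset.mem_insert_self _ _
      exact (Finset.mem_insert.1 hxy).resolve_right hx'.1
    · intro σ hσ
      simp only [Finset.bipartiteAbove, Finset.mem_filter, hrooms, Finset.mem_univ, true_and] at hσ
      obtain ⟨⟨hσc, hσd⟩, hsub⟩ := hσ
      have hsd : (σ \ τ).card = 1 := by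
        rw [Finset.card_sdiff_of_subset hsub]; omega
      obtain ⟨x, hx⟩ := Finset.card_eq_one.1 hsd
      have hxm : x ∈ σ \ τ := by rw [hx]; exact Finset.mem_singleton_self _
      have hins : insert x τ = σ := by
        rw [← Finset.sdiff_union_of_subset hsub, hx]; rfl
      refine ⟨x, ?_, hins⟩
      simp only [Finset.mem_filter, Finset.mem_univ, true_and]
      exact ⟨(Finset.mem_sdiff.1 hxm).2, hins ▸ hσd⟩
  have hbelow : ∀ σ ∈ rooms, Even (doors.bipartiteBelow Inc σ).card := by
    intro σ hσ
    obtain ⟨hσc, hσd⟩ := (Finset.mem_filter.1 hσ).2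
    have : (doors.bipartiteBelow Inc σ).card =
        (σ.filter fun x => (σ.erase x).image c = Finset.univ.erase i₀).card := by
      symm
      refine Finset.card_bij (fun x _ => σ.erase x) ?_ ?_ ?_
      · intro x hx
        obtain ⟨hxσ, hxc⟩ := Finset.mem_filter.1 hx
        simp only [Finset.bipartiteBelow, Finset.mem_filter, hdoors, Finset.mem_univ, true_and]
        exact ⟨⟨by rw [Finset.card_erase_add_one hxσ, hσc], hσd.mono (Finset.erase_subset _ _),
          hxc⟩, Finset.erase_subset _ _⟩
      · intro x hx y hy h
        exact Finset.erase_injOn σ (Finset.mem_filter.1 hx).1 (Finset.mem_filter.1 hy).1 h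
      · intro τ hτ
        simp only [Finset.bipartiteBelow, Finset.mem_filter, hdoors, Finset.mem_univ,
          true_and] at hτ
        obtain ⟨⟨hτc, hτd, hτi⟩, hsub⟩ := hτ
        have hsd : (σ \ τ).card = 1 := by
          rw [Finset.card_sdiff_of_subset hsub]; omega
        obtain ⟨x, hx⟩ := Finset.card_eq_one.1 hsd
        have hxm : x ∈ σ \ τ := by rw [hx]; exact Finset.mem_singleton_self _
        have hers : σ.erase x = τ := by
          rw [Finset.erase_eq, ← hx, Finset.sdiff_sdiff_eq_self hsub]
        exact ⟨x, Finset.mem_filter.2 ⟨(Finset.mem_sdiff.1 hxm).1, by rw [hers, hτi]⟩, hers⟩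
    rw [this]
    exact even_card_removable c i₀ σ hσc (hcon σ hσd)
  -- the door consisting of slack points only
  set τ₀ : Finset X := (Finset.univ.erase i₀).image ε with hτ₀
  have hτ₀range : ∀ x ∈ τ₀, ∃ k, k ≠ i₀ ∧ ε k = x := by
    intro x hx; simpa [hτ₀] using hx
  have hmem₀ : ∀ k, k ≠ i₀ → ε k ∈ τ₀ := fun k hk => by
    rw [hτ₀]; exact Finset.mem_image_of_mem _ (by simpa using hk)
  have hone : (Finset.univ.filter fun x => x ∉ τ₀ ∧ IsDominant r (insert x τ₀)).card = 1 := by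
    obtain ⟨y₀, hy₀⟩ := hX
    obtain ⟨p, hp, hpmax⟩ := (Finset.univ.filter fun x => x ∉ Set.range ε).exists_max_image (r i₀)
      ⟨y₀, by simpa using hy₀⟩
    simp only [Finset.mem_filter, Finset.mem_univ, true_and] at hp hpmax
    have hiff : ∀ y i, i ≠ i₀ → (∀ x ∈ τ₀, r i y ≤ r i x) → y = ε i := by
      intro y i hi h
      by_contra hy
      exact absurd (h _ (hmem₀ i hi)) (not_le.2 (hε i y hy))
    rw [Finset.card_eq_one]
    refine ⟨p, ?_⟩
    ext x
    simp only [Finset.mem_filter, Finset.mem_univ, true_and, Finset.mem_singleton]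
    constructor
    · rintro ⟨hx, hdom⟩
      have key : ∀ y, y ∉ Set.range ε → r i₀ y ≤ r i₀ x := by
        intro y hy
        obtain ⟨i, hi⟩ := hdom y
        have : i = i₀ := by
          by_contra hne
          exact hy ⟨i, (hiff y i hne fun z hz => hi z (Finset.mem_insert_of_mem hz)).symm⟩
        exact this ▸ hi x (Finset.mem_insert_self _ _)
      have hxr : x ∉ Set.range ε := by
        rintro ⟨k, rfl⟩
        have hk : k = i₀ := by
          by_contra hk
          exact hx (hmem₀ k hk)
        subst hk
        exact absurd (key p hp) (not_le.2 (hε k p fun h => hp ⟨k, h.symm⟩))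
      exact hr i₀ (le_antisymm (hpmax x hxr) (key p hp))
    · rintro rfl
      refine ⟨fun h => ?_, fun y => ?_⟩
      · obtain ⟨k, -, hk⟩ := hτ₀range _ h
        exact hp ⟨k, hk⟩
      · by_cases hy : y ∈ Set.range ε
        · obtain ⟨k, rfl⟩ := hy
          refine ⟨k, fun z _ => ?_⟩
          by_cases hz : z = ε k
          · rw [hz]
          · exact (hε k z hz).le
        · refine ⟨i₀, fun z hz => ?_⟩
          rcases Finset.mem_insert.1 hz with rfl | hz
          · exact hpmax y hy
          · obtain ⟨k, hk, rfl⟩ := hτ₀range z hz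
            exact (hε' i₀ k y hk hy).le
  have hτ₀door : τ₀ ∈ doors := by
    have hpos : 0 < Fintype.card ι := Fintype.card_pos_iff.2 ⟨i₀⟩
    simp only [hdoors, Finset.mem_filter, Finset.mem_univ, true_and]
    refine ⟨?_, ?_, ?_⟩
    · rw [hτ₀, Finset.card_image_of_injective _ hεinj,
        Finset.card_erase_of_mem (Finset.mem_univ _), Finset.card_univ]
      omega
    · obtain ⟨x, hx⟩ := Finset.card_pos.1 (hone ▸ Nat.one_pos)
      exact (Finset.mem_filter.1 hx).2.2.mono (Finset.subset_insert _ _)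
    · rw [hτ₀, Finset.image_image]
      have : c ∘ ε = id := funext hc
      rw [this, Finset.image_id]
  have htwo : ∀ τ ∈ doors, τ ≠ τ₀ → (rooms.bipartiteAbove Inc τ).card = 2 := by
    intro τ hτ hne
    rw [habove τ hτ]
    obtain ⟨hτc, hτd, hτi⟩ := (Finset.mem_filter.1 hτ).2
    obtain ⟨z, hz, hzr⟩ : ∃ z ∈ τ, z ∉ Set.range ε := by
      by_contra hall
      push Not at hall
      apply hne
      apply Finset.eq_of_subset_of_card_le
      · intro x hx
        obtain ⟨k, rfl⟩ := hall x hx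
        apply hmem₀
        have : c (ε k) ∈ τ.image c := Finset.mem_image_of_mem _ hx
        rw [hτi, hc] at this
        simpa using this
      · rw [hτ₀, Finset.card_image_of_injective _ hεinj,
          Finset.card_erase_of_mem (Finset.mem_univ _), Finset.card_univ]
        omega
    refine hτd.card_extensions hr ⟨z, hz⟩ hτc (fun i => ⟨ε i, fun j hj => ⟨z, hz, ?_⟩⟩) _ ?_
    · exact hε' j i z hj.symm hzr
    · intro x; simp
  have hodd : ¬ Even (∑ τ ∈ doors, (rooms.bipartiteAbove Inc τ).card) := by
    rw [← Finset.add_sum_erase _ _ hτ₀door, habove _ hτ₀door, hone, Nat.even_add]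
    have : Even (∑ τ ∈ doors.erase τ₀, (rooms.bipartiteAbove Inc τ).card) := by
      apply Finset.even_sum
      intro τ hτ
      obtain ⟨hne, hτ⟩ := Finset.mem_erase.1 hτ
      rw [htwo τ hτ hne]
      exact even_two
    simp [this]
  exact hodd (hcount ▸ Finset.even_sum _ hbelow)

/-- Approximate version of Brouwer's theorem on the standard simplex. -/
theorem exists_approx_fixedPoint_stdSimplex {ι : Type*} [Fintype ι] [Nonempty ι]
    (f : (ι → ℝ) → ι → ℝ) (hf : MapsTo f (stdSimplex ℝ ι) (stdSimplex ℝ ι))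
    (N : ℕ) (hN : 0 < N) :
    ∃ p ∈ stdSimplex ℝ ι, ∀ i, ∃ x ∈ stdSimplex ℝ ι, dist x p ≤ Fintype.card ι / N ∧
      p i - Fintype.card ι / N ≤ f x i := by
  classical
  set n := Fintype.card ι with hn
  have hNR : (0 : ℝ) < N := by exact_mod_cast hN
  let G := {x : ι → Fin (N + 1) // ∑ i, (x i : ℕ) = N}
  let X := G ⊕ ι
  let v : X → ι → ℤ := Sum.elim (fun x i => ((x.1 i : ℕ) : ℤ))
    (fun k i => if i = k then -1 else N + 1)
  let pt : G → ι → ℝ := fun x i => ((x.1 i : ℕ) : ℝ) / N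
  have hsumG : ∀ x : G, ∑ i, ((x.1 i : ℕ) : ℤ) = N := fun x => by exact_mod_cast x.2
  have hpt : ∀ x : G, pt x ∈ stdSimplex ℝ ι := by
    intro x
    refine ⟨fun i => by positivity, ?_⟩
    have : ∑ i, ((x.1 i : ℕ) : ℝ) = N := by exact_mod_cast x.2
    simp only [pt]
    rw [← Finset.sum_div, this, div_self hNR.ne']
  let eqv := Fintype.equivFin X
  let r : ι → X → ℤ ×ₗ Fin (Fintype.card X) := fun i x => toLex (v x i, eqv x)
  have hr : ∀ i, Function.Injective (r i) := by
    intro i x y h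
    have := congrArg (fun z => (ofLex z).2) h
    exact eqv.injective this
  have hrlt : ∀ i x y, v x i < v y i → r i x < r i y := fun i x y h => by
    rw [Prod.Lex.toLex_lt_toLex]; exact Or.inl h
  have hrle : ∀ i x y, r i x ≤ r i y → v x i ≤ v y i := fun i x y h => by
    by_contra hlt
    exact absurd h (not_le.2 (hrlt i y x (not_le.1 hlt)))
  have hvG : ∀ (x : G) i, 0 ≤ v (Sum.inl x) i ∧ v (Sum.inl x) i ≤ N := by
    intro x i
    have := (x.1 i).2
    simp only [v, Sum.elim_inl]
    omega
  have hcol : ∀ x : G, ∃ i, pt x i ≤ f (pt x) i := by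
    intro x
    by_contra hcon
    push Not at hcon
    have h := Finset.sum_lt_sum_of_nonempty Finset.univ_nonempty (fun i _ => hcon i)
    rw [(hf (hpt x)).2, (hpt x).2] at h
    exact lt_irrefl _ h
  choose col hcol using hcol
  let c : X → ι := Sum.elim col id
  obtain ⟨σ, hσ, hσc⟩ := exists_isDominant_image_eq_univ hr Sum.inr
    (by
      intro i y hy
      apply hrlt
      rcases y with x | k
      · have := (hvG x i).1
        simp only [v, Sum.elim_inr, if_true] at this ⊢
        omega
      · have hki : i ≠ k := fun h => hy (h ▸ rfl)
        simp only [v, Sum.elim_inr, if_true, if_neg hki]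
        omega)
    (by
      intro i k y hk hy
      apply hrlt
      rcases y with x | j
      · have := (hvG x i).2
        simp only [v, Sum.elim_inr, if_neg hk.symm] at this ⊢
        omega
      · exact absurd ⟨j, rfl⟩ hy)
    (by
      obtain ⟨i₀⟩ := ‹Nonempty ι›
      refine ⟨Sum.inl ⟨fun i => if i = i₀ then ⟨N, by omega⟩ else 0, ?_⟩, by simp⟩
      rw [Finset.sum_eq_single i₀] <;> simp +contextual)
    c (fun i => rfl)
  have hσne : σ.Nonempty := by
    rw [Finset.nonempty_iff_ne_empty]
    rintro rfl
    exact Finset.univ_nonempty.ne_empty (by simpa using hσc.symm)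
  have hmin : ∀ i, ∃ x ∈ σ, ∀ y ∈ σ, v x i ≤ v y i := fun i => σ.exists_min_image (v · i) hσne
  choose g hgσ hgmin using hmin
  let m : ι → ℤ := fun i => v (g i) i
  have hm : ∀ i, -1 ≤ m i := by
    intro i
    simp only [m]
    rcases g i with x | k
    · have := (hvG x i).1
      omega
    · simp only [v, Sum.elim_inr]
      split_ifs <;> omega
  -- the minima of a dominant set almost sum up to `N`
  have hsum : (N : ℤ) - n < ∑ i, m i := by
    by_contra hle
    push Not at hle
    have hcardsum : ∑ i, (m i + 1) = ∑ i, m i + n := by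
      rw [Finset.sum_add_distrib]; simp [hn]
    obtain ⟨i₀⟩ := ‹Nonempty ι›
    set z : ι → ℤ := fun i => m i + 1 + if i = i₀ then N - ∑ i, (m i + 1) else 0 with hz
    have hzsum : ∑ i, z i = N := by
      simp only [hz]
      rw [Finset.sum_add_distrib, Finset.sum_ite_eq' Finset.univ i₀]
      simp
    have hzm : ∀ i, m i + 1 ≤ z i := by
      intro i
      simp only [hz]
      split_ifs <;> omega
    have hz0 : ∀ i, 0 ≤ z i := fun i => by linarith [hm i, hzm i]
    have hzN : ∀ i, z i ≤ N := fun i => by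
      rw [← hzsum]; exact Finset.single_le_sum (fun j _ => hz0 j) (Finset.mem_univ i)
    let y : G := ⟨fun i => ⟨(z i).toNat, by have := hz0 i; have := hzN i; omega⟩, by
      have : ((∑ i, (z i).toNat : ℕ) : ℤ) = N := by
        rw [← hzsum]
        push_cast
        exact Finset.sum_congr rfl fun i _ => Int.toNat_of_nonneg (hz0 i)
      exact_mod_cast this⟩
    have hvy : ∀ i, v (Sum.inl y) i = z i := fun i => Int.toNat_of_nonneg (hz0 i)
    obtain ⟨i, hi⟩ := hσ (Sum.inl y)
    have h1 := hrle i _ _ (hi _ (hgσ i))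
    rw [hvy] at h1
    have h2 := hzm i
    simp only [m] at h2
    omega
  have hclose : ∀ x : G, Sum.inl x ∈ σ → ∀ i, m i ≤ ((x.1 i : ℕ) : ℤ) ∧
      ((x.1 i : ℕ) : ℤ) ≤ m i + n := by
    intro x hx
    have hle : ∀ i, m i ≤ ((x.1 i : ℕ) : ℤ) := fun i => hgmin i _ hx
    intro i
    refine ⟨hle i, ?_⟩
    have h1 : ((x.1 i : ℕ) : ℤ) - m i ≤ ∑ j, (((x.1 j : ℕ) : ℤ) - m j) :=
      Finset.single_le_sum (f := fun j => ((x.1 j : ℕ) : ℤ) - m j)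
        (fun j _ => by linarith [hle j]) (Finset.mem_univ i)
    rw [Finset.sum_sub_distrib, hsumG] at h1
    omega
  obtain ⟨x₀, hx₀⟩ : ∃ x : G, Sum.inl x ∈ σ := by
    by_contra hcon
    push Not at hcon
    have hm1 : ∀ i, m i = -1 := by
      intro i
      have : i ∈ σ.image c := by rw [hσc]; exact Finset.mem_univ _
      obtain ⟨x, hx, hxi⟩ := Finset.mem_image.1 this
      rcases x with x | k
      · exact absurd hx (hcon x)
      · have hk : k = i := hxi
        subst hk
        have h1 := hgmin k _ hx
        simp only [v, Sum.elim_inr, if_true] at h1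
        exact le_antisymm h1 (hm k)
    simp only [hm1] at hsum
    simp [← hn] at hsum
    omega
  refine ⟨pt x₀, hpt x₀, fun i => ?_⟩
  have : i ∈ σ.image c := by rw [hσc]; exact Finset.mem_univ _
  obtain ⟨x, hx, hxi⟩ := Finset.mem_image.1 this
  rcases x with x | k
  · have hd : ∀ j, |pt x j - pt x₀ j| ≤ n / N := by
      intro j
      simp only [pt]
      rw [← sub_div, abs_div, abs_of_pos hNR]
      gcongr
      have h1 := hclose x hx j
      have h2 := hclose x₀ hx₀ j
      have h3 : |((x.1 j : ℕ) : ℤ) - ((x₀.1 j : ℕ) : ℤ)| ≤ n := by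
        rw [abs_le]; omega
      exact_mod_cast h3
    refine ⟨pt x, hpt x, ?_, ?_⟩
    · rw [dist_pi_le_iff (by positivity)]
      exact fun j => hd j
    · have hxi' : col x = i := hxi
      have h1 := hcol x
      rw [hxi'] at h1
      linarith [(abs_le.1 (hd i)).1]
  · have hk : k = i := hxi
    subst hk
    refine ⟨pt x₀, hpt x₀, by rw [dist_self]; positivity, ?_⟩
    have h1 := hgmin k _ hx
    simp only [v, Sum.elim_inr, if_true] at h1
    have h2 := (hclose x₀ hx₀ k).2
    have h3 : ((x₀.1 k : ℕ) : ℤ) ≤ n := by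
      simp only [m, v] at h2
      omega
    have h4 : ((x₀.1 k : ℕ) : ℝ) ≤ n := by exact_mod_cast h3
    have h5 : pt x₀ k ≤ n / N := by simp only [pt]; gcongr
    linarith [(hf (hpt x₀)).1 k]

/-- **Brouwer's fixed point theorem** on the standard simplex. -/
theorem exists_fixedPoint_stdSimplex {ι : Type*} [Fintype ι] [Nonempty ι]
    (f : (ι → ℝ) → ι → ℝ) (hf : MapsTo f (stdSimplex ℝ ι) (stdSimplex ℝ ι))
    (hc : ContinuousOn f (stdSimplex ℝ ι)) : ∃ p ∈ stdSimplex ℝ ι, f p = p := by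
  have happ := fun N : ℕ => exists_approx_fixedPoint_stdSimplex f hf (N + 1) N.succ_pos
  choose p hp x hx hxp hfx using happ
  obtain ⟨q, hq, k, hk, hlim⟩ := (isCompact_stdSimplex ℝ ι).tendsto_subseq hp
  have h0 : Tendsto (fun N : ℕ => (Fintype.card ι : ℝ) / ((N + 1 : ℕ) : ℝ)) atTop (nhds 0) :=
    (tendsto_const_div_atTop_nhds_zero_nat _).comp (tendsto_add_atTop_nat 1)
  have h0k := h0.comp hk.tendsto_atTop
  refine ⟨q, hq, ?_⟩
  have hle : ∀ i, q i ≤ f q i := by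
    intro i
    have hxlim : Tendsto (fun j => x (k j) i) atTop (nhds q) := by
      refine (tendsto_iff_dist_tendsto_zero).2 ?_
      have hpl := (tendsto_iff_dist_tendsto_zero).1 hlim
      refine squeeze_zero (fun _ => dist_nonneg) (fun j => ?_)
        (by rw [← add_zero (0 : ℝ)]; exact h0k.add hpl)
      exact (dist_triangle _ (p (k j)) _).trans (add_le_add (hxp (k j) i) le_rfl)
    have hflim : Tendsto (fun j => f (x (k j) i) i) atTop (nhds (f q i)) := by
      have h1 := (hc q hq).tendsto.comp (tendsto_nhdsWithin_iff.2
        ⟨hxlim, Eventually.of_forall fun j => hx (k j) i⟩)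
      exact (tendsto_pi_nhds.1 h1) i
    have hplim : Tendsto (fun j => p (k j) i) atTop (nhds (q i)) := (tendsto_pi_nhds.1 hlim) i
    have := hplim.sub h0k
    rw [sub_zero] at this
    exact le_of_tendsto_of_tendsto' this hflim fun j => hfx (k j) i
  have hsum : ∑ i, q i = ∑ i, f q i := by rw [(hf hq).2, hq.2]
  funext i
  exact ((Finset.sum_eq_sum_iff_of_le fun i _ => hle i).1 hsum i (Finset.mem_univ i)).symm

/-- **Schauder's fixed point theorem** for a compact convex set. -/
theorem exists_fixedPoint_of_isCompact_convex {E : Type*} [NormedAddCommGroup E] [NormedSpace ℝ E]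
    {K : Set E} (hK : IsCompact K) (hconv : Convex ℝ K) (hne : K.Nonempty) (g : E → E)
    (hg : MapsTo g K K) (hc : ContinuousOn g K) : ∃ x ∈ K, g x = x := by
  have happ : ∀ ε : ℝ, 0 < ε → ∃ x ∈ K, dist (g x) x ≤ ε := by
    intro ε hε
    obtain ⟨t, htK, htfin, hcover⟩ := hK.finite_cover_balls hε
    have : Fintype t := htfin.fintype
    have hmem : ∀ y ∈ K, ∃ i : t, dist y i < ε := by
      intro y hy
      obtain ⟨i, hi, hyi⟩ := mem_iUnion₂.1 (hcover hy)
      exact ⟨⟨i, hi⟩, hyi⟩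
    have : Nonempty t := by
      obtain ⟨y, hy⟩ := hne
      exact (hmem y hy).nonempty
    let w : E → t → ℝ := fun y i => max 0 (ε - dist y i)
    have hw0 : ∀ y i, 0 ≤ w y i := fun y i => le_max_left _ _
    have hwpos : ∀ y ∈ K, 0 < ∑ i, w y i := by
      intro y hy
      obtain ⟨i, hi⟩ := hmem y hy
      exact Finset.sum_pos' (fun i _ => hw0 y i)
        ⟨i, Finset.mem_univ _, lt_max_of_lt_right (by linarith)⟩
    have hwc : ∀ i, Continuous fun y => w y i := fun i => by fun_prop
    let comb : (t → ℝ) → E := fun l => ∑ i, l i • (i : E)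
    have hcomb : MapsTo comb (stdSimplex ℝ t) K := fun l hl =>
      hconv.sum_mem (fun i _ => hl.1 i) hl.2 fun i _ => htK i.2
    have hcombc : Continuous comb := by fun_prop
    have hgc : ContinuousOn (fun l => g (comb l)) (stdSimplex ℝ t) :=
      hc.comp hcombc.continuousOn hcomb
    let Φ : (t → ℝ) → t → ℝ := fun l i => w (g (comb l)) i / ∑ j, w (g (comb l)) j
    obtain ⟨l, hl, hfix⟩ := exists_fixedPoint_stdSimplex Φ
      (fun l hl => by
        have hp := hwpos _ (hg (hcomb hl))
        refine ⟨fun i => div_nonneg (hw0 _ _) hp.le, ?_⟩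
        simp only [Φ]
        rw [← Finset.sum_div, div_self hp.ne'])
      (by
        refine continuousOn_pi.2 fun i => ContinuousOn.div ?_ ?_ ?_
        · exact (hwc i).comp_continuousOn hgc
        · exact continuousOn_finsetSum _ fun j _ => (hwc j).comp_continuousOn hgc
        · exact fun l hl => (hwpos _ (hg (hcomb hl))).ne')
    refine ⟨comb l, hcomb hl, ?_⟩
    -- the fixed weights only charge points of the net close to the image
    have hclose : ∀ i, l i ≠ 0 → dist (g (comb l)) i ≤ ε := by
      intro i hi
      by_contra hcon
      push Not at hcon
      apply hi
      rw [← hfix]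
      have : w (g (comb l)) i = 0 := max_eq_left (by linarith)
      simp only [Φ, this, zero_div]
    have hdiff : g (comb l) - comb l = ∑ i, l i • (g (comb l) - (i : E)) := by
      simp only [smul_sub]
      rw [Finset.sum_sub_distrib, ← Finset.sum_smul, hl.2, one_smul]
    rw [dist_eq_norm, hdiff]
    calc ‖∑ i, l i • (g (comb l) - (i : E))‖ ≤ ∑ i, ‖l i • (g (comb l) - (i : E))‖ :=
          norm_sum_le _ _
      _ ≤ ∑ i, l i * ε := by
          refine Finset.sum_le_sum fun i _ => ?_
          rw [norm_smul, Real.norm_of_nonneg (hl.1 i)]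
          by_cases hi : l i = 0
          · simp [hi]
          · exact mul_le_mul_of_nonneg_left (by rw [← dist_eq_norm]; exact hclose i hi) (hl.1 i)
      _ = ε := by rw [← Finset.sum_mul, hl.2, one_mul]
  choose! x hxK hx using happ
  have hpos : ∀ n : ℕ, (0 : ℝ) < 1 / (n + 1) := fun n => by positivity
  obtain ⟨q, hq, k, hk, hlim⟩ := hK.tendsto_subseq fun n : ℕ => hxK _ (hpos n)
  refine ⟨q, hq, ?_⟩
  have hglim := (hc q hq).tendsto.comp (tendsto_nhdsWithin_iff.2
    ⟨hlim, Eventually.of_forall fun j => hxK _ (hpos (k j))⟩)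
  have h0 := (tendsto_one_div_add_atTop_nhds_zero_nat (𝕜 := ℝ)).comp hk.tendsto_atTop
  have hd := hglim.dist hlim
  have : dist (g q) q ≤ 0 := le_of_tendsto_of_tendsto' hd h0 fun j => hx _ (hpos (k j))
  exact dist_le_zero.1 this

/-- The functions on a compact metric space bounded by `M` and Lipschitz with constant `L`. -/
def lipBall (X : Type*) [PseudoMetricSpace X] (M L : ℝ) : Set C(X, ℝ) :=
  {v | (∀ t, |v t| ≤ M) ∧ ∀ t t', |v t - v t'| ≤ L * dist t t'}

theorem isCompact_lipBall {X : Type*} [PseudoMetricSpace X] (M L : ℝ) :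
    IsCompact (lipBall X M L) := by
  apply ArzelaAscoli.isCompact_of_equicontinuous
  · have himg : ContinuousMap.toFun '' lipBall X M L =
        (Set.univ.pi fun _ => Icc (-M) M) ∩
          {g : X → ℝ | ∀ t t', |g t - g t'| ≤ L * dist t t'} := by
      ext g
      constructor
      · rintro ⟨v, hv, rfl⟩
        exact ⟨fun t _ => abs_le.1 (hv.1 t), hv.2⟩
      · rintro ⟨h1, h2⟩
        have hL : LipschitzWith L.toNNReal g := by
          refine LipschitzWith.of_dist_le_mul fun t t' => ?_
          rw [Real.dist_eq]
          exact (h2 t t').trans (mul_le_mul_of_nonneg_right (Real.le_coe_toNNReal L) dist_nonneg)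
        exact ⟨⟨g, hL.continuous⟩, ⟨fun t => abs_le.2 (h1 t (mem_univ t)), h2⟩, rfl⟩
    rw [himg]
    refine (isCompact_univ_pi fun _ => isCompact_Icc).inter_right ?_
    simp only [ofPred_forall]
    exact isClosed_iInter fun t => isClosed_iInter fun t' =>
      isClosed_le (by fun_prop) continuous_const
  · refine Metric.equicontinuous_of_continuity_modulus (fun x => L * x) ?_ _ ?_
    · have : Continuous fun x : ℝ => L * x := by fun_prop
      simpa using this.tendsto 0
    · intro x y v
      exact v.2.2 x y

theorem convex_lipBall (X : Type*) [PseudoMetricSpace X] (M L : ℝ) :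
    Convex ℝ (lipBall X M L) := by
  intro v hv w hw a b ha hb hab
  refine ⟨fun t => ?_, fun t t' => ?_⟩
  · calc |a * v t + b * w t| ≤ |a * v t| + |b * w t| := abs_add_le _ _
      _ = a * |v t| + b * |w t| := by rw [abs_mul, abs_mul, abs_of_nonneg ha, abs_of_nonneg hb]
      _ ≤ a * M + b * M := by gcongr <;> [exact hv.1 t; exact hw.1 t]
      _ = M := by rw [← add_mul, hab, one_mul]
  · calc |a * v t + b * w t - (a * v t' + b * w t')|
        = |a * (v t - v t') + b * (w t - w t')| := by ring_nf
      _ ≤ |a * (v t - v t')| + |b * (w t - w t')| := abs_add_le _ _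
      _ = a * |v t - v t'| + b * |w t - w t'| := by
          rw [abs_mul, abs_mul, abs_of_nonneg ha, abs_of_nonneg hb]
      _ ≤ a * (L * dist t t') + b * (L * dist t t') := by
          gcongr <;> [exact hv.2 t t'; exact hw.2 t t']
      _ = L * dist t t' := by rw [← add_mul, hab, one_mul]

/-- The primitive of `g * v` vanishing at `0`. -/
def primC {T : ℝ} (hT : 0 ≤ T) {g : ℝ → ℝ} (hg : IntervalIntegrable g volume 0 T)
    (v : C(Icc (0 : ℝ) T, ℝ)) : C(Icc (0 : ℝ) T, ℝ) where
  toFun t := ∫ τ in (0 : ℝ)..t, g τ * IccExtend hT v τ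
  continuous_toFun := by
    have h : IntervalIntegrable (fun τ => g τ * IccExtend hT v τ) volume 0 T :=
      hg.mul_continuousOn v.continuous.Icc_extend'.continuousOn
    have hc := intervalIntegral.continuousOn_primitive_interval' h left_mem_uIcc
    rw [uIcc_of_le hT] at hc
    exact continuousOn_iff_continuous_domRestrict.1 hc

theorem abs_IccExtend_le {T : ℝ} (hT : 0 ≤ T) (v : C(Icc (0 : ℝ) T, ℝ)) (τ : ℝ) :
    |IccExtend hT v τ| ≤ ‖v‖ := v.norm_coe_le_norm _

theorem intervalIntegrable_mul_IccExtend {T : ℝ} (hT : 0 ≤ T) {g : ℝ → ℝ}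
    (hg : IntervalIntegrable g volume 0 T) (v : C(Icc (0 : ℝ) T, ℝ)) {t : ℝ}
    (ht : t ∈ Icc (0 : ℝ) T) :
    IntervalIntegrable (fun τ => g τ * IccExtend hT v τ) volume 0 t := by
  refine (hg.mul_continuousOn v.continuous.Icc_extend'.continuousOn).mono_set ?_
  rw [uIcc_of_le ht.1, uIcc_of_le hT]
  exact Icc_subset_Icc_right ht.2

theorem norm_primC_le {T : ℝ} (hT : 0 ≤ T) {g : ℝ → ℝ} (hg : IntervalIntegrable g volume 0 T)
    (v : C(Icc (0 : ℝ) T, ℝ)) : ‖primC hT hg v‖ ≤ (∫ τ in (0 : ℝ)..T, |g τ|) * ‖v‖ := by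
  have hnn : 0 ≤ ∫ τ in (0 : ℝ)..T, |g τ| :=
    intervalIntegral.integral_nonneg hT fun _ _ => abs_nonneg _
  refine (ContinuousMap.norm_le _ (by positivity)).2 fun t => ?_
  have hi := (intervalIntegrable_mul_IccExtend hT hg v t.2).abs
  have hg' : IntervalIntegrable (fun τ => |g τ| * ‖v‖) volume 0 T := hg.abs.mul_const _
  have hg't : IntervalIntegrable (fun τ => |g τ| * ‖v‖) volume 0 t := by
    refine hg'.mono_set ?_
    rw [uIcc_of_le t.2.1, uIcc_of_le hT]
    exact Icc_subset_Icc_right t.2.2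
  calc ‖primC hT hg v t‖ ≤ ∫ τ in (0 : ℝ)..t, |g τ * IccExtend hT v τ| :=
        intervalIntegral.abs_integral_le_integral_abs t.2.1
    _ ≤ ∫ τ in (0 : ℝ)..t, |g τ| * ‖v‖ := by
        refine intervalIntegral.integral_mono_on t.2.1 hi hg't fun τ _ => ?_
        rw [abs_mul]
        exact mul_le_mul_of_nonneg_left (abs_IccExtend_le hT v τ) (abs_nonneg _)
    _ ≤ ∫ τ in (0 : ℝ)..T, |g τ| * ‖v‖ :=
        intervalIntegral.integral_mono_interval le_rfl t.2.1 t.2.2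
          (Eventually.of_forall fun τ => by positivity) hg'
    _ = _ := intervalIntegral.integral_mul_const _ _

theorem primC_sub {T : ℝ} (hT : 0 ≤ T) {g : ℝ → ℝ} (hg : IntervalIntegrable g volume 0 T)
    (v w : C(Icc (0 : ℝ) T, ℝ)) : primC hT hg v - primC hT hg w = primC hT hg (v - w) := by
  ext t
  change (∫ τ in (0 : ℝ)..t, g τ * IccExtend hT v τ) - (∫ τ in (0 : ℝ)..t, g τ * IccExtend hT w τ)
    = ∫ τ in (0 : ℝ)..t, g τ * IccExtend hT (v - w) τ
  rw [← intervalIntegral.integral_sub (intervalIntegrable_mul_IccExtend hT hg v t.2)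
    (intervalIntegrable_mul_IccExtend hT hg w t.2)]
  congr 1
  ext τ
  simp [IccExtend, mul_sub]

theorem continuous_primC {T : ℝ} (hT : 0 ≤ T) {g : ℝ → ℝ}
    (hg : IntervalIntegrable g volume 0 T) : Continuous (primC hT hg) := by
  have hnn : 0 ≤ ∫ τ in (0 : ℝ)..T, |g τ| :=
    intervalIntegral.integral_nonneg hT fun _ _ => abs_nonneg _
  have : LipschitzWith (∫ τ in (0 : ℝ)..T, |g τ|).toNNReal (primC hT hg) := by
    refine LipschitzWith.of_dist_le_mul fun v w => ?_
    rw [dist_eq_norm, dist_eq_norm, primC_sub, Real.coe_toNNReal _ hnn]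
    exact norm_primC_le hT hg _
  exact this.continuous

/-- The constant by which `k` has to be shifted for `ψ ∘ k` to have mean value zero. -/
theorem exists_shift {T : ℝ} (hT : 0 ≤ T) {ψ : ℝ → ℝ} (hψ : Continuous ψ) (hmono : StrictMono ψ)
    (hψ0 : ψ 0 = 0) (k : C(Icc (0 : ℝ) T, ℝ)) :
    ∃ d : ℝ, |d| ≤ ‖k‖ ∧ ∫ τ in (0 : ℝ)..T, ψ (d + IccExtend hT k τ) = 0 := by
  have hkc : Continuous (IccExtend hT k) := k.continuous.Icc_extend'
  have hcont : Continuous fun d : ℝ => ∫ τ in (0 : ℝ)..T, ψ (d + IccExtend hT k τ) := by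
    apply intervalIntegral.continuous_parametric_intervalIntegral_of_continuous'
    exact hψ.comp (continuous_fst.add (hkc.comp continuous_snd))
  have hle : ∫ τ in (0 : ℝ)..T, ψ (-‖k‖ + IccExtend hT k τ) ≤ 0 := by
    have h : 0 ≤ ∫ τ in (0 : ℝ)..T, -ψ (-‖k‖ + IccExtend hT k τ) := by
      refine intervalIntegral.integral_nonneg hT fun τ _ => ?_
      rw [Left.nonneg_neg_iff]
      refine (hmono.monotone ?_).trans_eq hψ0
      linarith [(abs_le.1 (abs_IccExtend_le hT k τ)).2]
    rw [intervalIntegral.integral_neg] at h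
    linarith
  have hge : 0 ≤ ∫ τ in (0 : ℝ)..T, ψ (‖k‖ + IccExtend hT k τ) := by
    refine intervalIntegral.integral_nonneg hT fun τ _ => ?_
    refine hψ0.symm.trans_le (hmono.monotone ?_)
    linarith [(abs_le.1 (abs_IccExtend_le hT k τ)).1]
  have hk0 := norm_nonneg k
  obtain ⟨d, hd, hd0⟩ := intermediate_value_Icc (by linarith : -‖k‖ ≤ ‖k‖) hcont.continuousOn
    ⟨hle, hge⟩
  exact ⟨d, abs_le.2 hd, hd0⟩

theorem shift_le {T : ℝ} (hT : 0 < T) {ψ : ℝ → ℝ} (hψ : Continuous ψ) (hmono : StrictMono ψ)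
    {k k' : ℝ → ℝ} (hk : ContinuousOn k (Icc 0 T)) (hk' : ContinuousOn k' (Icc 0 T))
    {d d' δ : ℝ} (hd : ∫ τ in (0 : ℝ)..T, ψ (d + k τ) = 0)
    (hd' : ∫ τ in (0 : ℝ)..T, ψ (d' + k' τ) = 0) (hkk : ∀ τ ∈ Icc (0 : ℝ) T, k' τ ≤ k τ + δ) :
    d ≤ d' + δ := by
  by_contra hlt
  push Not at hlt
  have : ∫ τ in (0 : ℝ)..T, ψ (d' + k' τ) < ∫ τ in (0 : ℝ)..T, ψ (d + k τ) := by
    have hlt' : ∀ τ ∈ Icc (0 : ℝ) T, ψ (d' + k' τ) < ψ (d + k τ) := fun τ hτ =>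
      hmono (by linarith [hkk τ hτ])
    refine intervalIntegral.integral_lt_integral_of_continuousOn_of_le_of_exists_lt hT ?_ ?_
      (fun τ hτ => (hlt' τ (Ioc_subset_Icc_self hτ)).le) ⟨0, left_mem_Icc.2 hT.le, hlt' 0
        (left_mem_Icc.2 hT.le)⟩
    · exact hψ.comp_continuousOn (continuousOn_const.add hk')
    · exact hψ.comp_continuousOn (continuousOn_const.add hk)
  rw [hd, hd'] at this
  exact lt_irrefl _ this

theorem continuous_of_shift {T : ℝ} (hT : 0 < T) {ψ : ℝ → ℝ} (hψ : Continuous ψ)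
    (hmono : StrictMono ψ) {d : C(Icc (0 : ℝ) T, ℝ) → ℝ}
    (hd : ∀ k : C(Icc (0 : ℝ) T, ℝ), ∫ τ in (0 : ℝ)..T, ψ (d k + IccExtend hT.le k τ) = 0) :
    Continuous d := by
  have hle : ∀ k k' : C(Icc (0 : ℝ) T, ℝ), d k ≤ d k' + dist k k' := by
    intro k k'
    refine shift_le hT hψ hmono (k := IccExtend hT.le k) (k' := IccExtend hT.le k')
      k.continuous.Icc_extend'.continuousOn
      k'.continuous.Icc_extend'.continuousOn (hd k) (hd k') fun τ _ => ?_
    have := ContinuousMap.dist_apply_le_dist (f := k) (g := k') (projIcc 0 T hT.le τ)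
    rw [Real.dist_eq] at this
    simp only [IccExtend, Function.comp_apply]
    linarith [(abs_le.1 this).1]
  have : LipschitzWith 1 d := by
    refine LipschitzWith.of_dist_le_mul fun k k' => ?_
    rw [Real.dist_eq, NNReal.coe_one, one_mul, abs_le]
    constructor
    · linarith [hle k' k, dist_comm k k']
    · linarith [hle k k']
  exact this.continuous

/-- The data of the equation: `ψ` is the inverse of `φ`, the weight `a` has mean value `abar`,
and `A` is an essential bound for `a` and `|e|`. -/
structure WEData (T : ℝ) (φ ψ a e : ℝ → ℝ) (abar A : ℝ) : Prop where
  pos : 0 < T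
  φ_mono : StrictMono φ
  φ_zero : φ 0 = 0
  ψ_mono : StrictMono ψ
  ψ_cont : Continuous ψ
  φ_ψ : ∀ x, φ (ψ x) = x
  ψ_φ : ∀ x, ψ (φ x) = x
  a_int : IntervalIntegrable a volume 0 T
  e_int : IntervalIntegrable e volume 0 T
  a_nonneg : ∀ᵐ t ∂(volume.restrict (Icc 0 T)), 0 ≤ a t
  a_le : ∀ᵐ t ∂(volume.restrict (Icc 0 T)), a t ≤ A
  e_le : ∀ᵐ t ∂(volume.restrict (Icc 0 T)), |e t| ≤ A
  A_nonneg : 0 ≤ A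
  a_mean : ∫ t in (0 : ℝ)..T, a t = T * abar
  abar_pos : 0 < abar
  e_mean : ∫ t in (0 : ℝ)..T, e t = 0

/-- `u` is a `T`-periodic solution of the equation in integrated form: with `F` a primitive of the
friction coefficient, `φ(u') + F(u)` is the primitive of `s + e - a Q(u)` with initial value `d`. -/
structure IsIntSol (T : ℝ) (ψ F Q a e : ℝ → ℝ) (s d : ℝ) (u : ℝ → ℝ) : Prop where
  deriv : ∀ t ∈ Icc (0 : ℝ) T, HasDerivWithinAt u
    (ψ (d + ((∫ τ in (0 : ℝ)..t, (s + e τ - a τ * Q (u τ))) - F (u t)))) (Icc 0 T) t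
  per : u 0 = u T
  mean : ∫ τ in (0 : ℝ)..T, (s + e τ - a τ * Q (u τ)) = 0

theorem WEData.ψ_zero {T : ℝ} {φ ψ a e : ℝ → ℝ} {abar A : ℝ} (h : WEData T φ ψ a e abar A) :
    ψ 0 = 0 := by
  rw [← h.φ_zero, h.ψ_φ, h.φ_zero]

theorem IsIntSol.continuousOn {T : ℝ} {ψ F Q a e : ℝ → ℝ} {s d : ℝ} {u : ℝ → ℝ}
    (hu : IsIntSol T ψ F Q a e s d u) : ContinuousOn u (Icc 0 T) := fun t ht =>
  (hu.deriv t ht).continuousWithinAt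

theorem WEData.intervalIntegrable_mul {T : ℝ} {φ ψ a e : ℝ → ℝ} {abar A : ℝ}
    (h : WEData T φ ψ a e abar A) {v : ℝ → ℝ} (hv : ContinuousOn v (Icc 0 T)) :
    IntervalIntegrable (fun τ => a τ * v τ) volume 0 T :=
  h.a_int.mul_continuousOn (by rwa [uIcc_of_le h.pos.le])

theorem WEData.intervalIntegrable_force {T : ℝ} {φ ψ a e : ℝ → ℝ} {abar A : ℝ}
    (h : WEData T φ ψ a e abar A) {Q u : ℝ → ℝ} (hQ : Continuous Q)
    (hu : ContinuousOn u (Icc 0 T)) (s : ℝ) :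
    IntervalIntegrable (fun τ => s + e τ - a τ * Q (u τ)) volume 0 T :=
  (intervalIntegrable_const.add h.e_int).sub
    (h.intervalIntegrable_mul (hQ.comp_continuousOn hu))

theorem intervalIntegrable_restrict {T : ℝ} {g : ℝ → ℝ}
    (hg : IntervalIntegrable g volume 0 T) {x y : ℝ} (hx : x ∈ Icc 0 T) (hy : y ∈ Icc 0 T) :
    IntervalIntegrable g volume x y := by
  refine hg.mono_set ?_
  rw [uIcc_of_le (hx.1.trans hx.2)]
  exact uIcc_subset_Icc hx hy

/-- The solvability condition obtained by integrating the equation over a period. -/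
theorem IsIntSol.integral_eq {T : ℝ} {φ ψ a e : ℝ → ℝ} {abar A : ℝ}
    (h : WEData T φ ψ a e abar A) {F Q u : ℝ → ℝ} {s d : ℝ} (hQ : Continuous Q)
    (hu : IsIntSol T ψ F Q a e s d u) : ∫ τ in (0 : ℝ)..T, a τ * Q (u τ) = T * s := by
  have hm := hu.mean
  have hi : IntervalIntegrable (fun τ => a τ * Q (u τ)) volume 0 T :=
    h.intervalIntegrable_mul (hQ.comp_continuousOn hu.continuousOn)
  rw [intervalIntegral.integral_sub (intervalIntegrable_const.add h.e_int) hi,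
    intervalIntegral.integral_add intervalIntegrable_const h.e_int, h.e_mean] at hm
  simp at hm
  linarith

theorem IsIntSol.congr {T : ℝ} {ψ F Q a e : ℝ → ℝ} {s d : ℝ} {u : ℝ → ℝ} (hT : 0 ≤ T)
    (hu : IsIntSol T ψ F Q a e s d u) {F' Q' v : ℝ → ℝ} (huv : ∀ t ∈ Icc 0 T, v t = u t)
    (hF : ∀ t ∈ Icc 0 T, F' (u t) = F (u t)) (hQ : ∀ t ∈ Icc 0 T, Q' (u t) = Q (u t)) :
    IsIntSol T ψ F' Q' a e s d v := by
  have h_int : ∀ t ∈ Icc 0 T, ∫ τ in (0 : ℝ)..t, (s + e τ - a τ * Q' (v τ)) =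
      ∫ τ in (0 : ℝ)..t, (s + e τ - a τ * Q (u τ)) := by
    intro t ht
    refine intervalIntegral.integral_congr fun τ hτ => ?_
    rw [uIcc_of_le ht.1] at hτ
    have hτ' : τ ∈ Icc 0 T := ⟨hτ.1, hτ.2.trans ht.2⟩
    simp only [huv τ hτ', hQ τ hτ']
  refine ⟨fun t ht => ?_, ?_, ?_⟩
  · rw [h_int t ht, huv t ht, hF t ht]
    exact (hu.deriv t ht).congr huv (huv t ht)
  · rw [huv 0 (left_mem_Icc.2 hT), huv T (right_mem_Icc.2 hT), hu.per]
  · rw [h_int T (right_mem_Icc.2 hT), hu.mean]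

/-- The fixed point operator: `S u` is the mean value of `a Q(u)` and `y u` the primitive, vanishing
at `0`, of the derivative prescribed by the integrated equation. -/
theorem WEData.exists_operator {T : ℝ} {φ ψ a e : ℝ → ℝ} {abar A : ℝ}
    (h : WEData T φ ψ a e abar A) {F Q : ℝ → ℝ} (hF : Continuous F) (hQ : Continuous Q)
    {B : ℝ} (hFB : ∀ x, |F x| ≤ B) (hQB : ∀ x, |Q x| ≤ B) :
    ∃ (S : C(Icc (0 : ℝ) T, ℝ) → ℝ) (y : C(Icc (0 : ℝ) T, ℝ) → C(Icc (0 : ℝ) T, ℝ)) (L : ℝ),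
      Continuous S ∧ Continuous y ∧ 0 ≤ L ∧
      (∀ u t t', |y u t - y u t'| ≤ L * dist t t') ∧
      (∀ u, y u ⟨0, left_mem_Icc.2 h.pos.le⟩ = 0) ∧
      (∀ (u : C(Icc (0 : ℝ) T, ℝ)) (c : ℝ), (∀ t, u t = c + y u t) →
        ∃ d, IsIntSol T ψ F Q a e (S u) d (IccExtend h.pos.le u)) ∧
      (∀ (u : C(Icc (0 : ℝ) T, ℝ)) (s d : ℝ), IsIntSol T ψ F Q a e s d (IccExtend h.pos.le u) →
        S u = s ∧ ∀ t, u t = u ⟨0, left_mem_Icc.2 h.pos.le⟩ + y u t) := by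
  have hT := h.pos.le
  have h1 : IntervalIntegrable (fun _ : ℝ => (1 : ℝ)) volume 0 T := intervalIntegrable_const
  let FC : C(ℝ, ℝ) := ⟨F, hF⟩
  let QC : C(ℝ, ℝ) := ⟨Q, hQ⟩
  let ψC : C(ℝ, ℝ) := ⟨ψ, h.ψ_cont⟩
  let tT : Icc (0 : ℝ) T := ⟨T, right_mem_Icc.2 hT⟩
  let S : C(Icc (0 : ℝ) T, ℝ) → ℝ := fun u => (1 / T) * primC hT h.a_int (QC.comp u) tT
  let k : C(Icc (0 : ℝ) T, ℝ) → C(Icc (0 : ℝ) T, ℝ) := fun u =>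
    primC hT h1 (ContinuousMap.const _ (S u)) + primC hT h.e_int (ContinuousMap.const _ 1) -
      primC hT h.a_int (QC.comp u) - FC.comp u
  choose δ hδle hδ using exists_shift hT h.ψ_cont h.ψ_mono h.ψ_zero
  let v : C(Icc (0 : ℝ) T, ℝ) → C(Icc (0 : ℝ) T, ℝ) := fun u =>
    ψC.comp (ContinuousMap.const _ (δ (k u)) + k u)
  let y : C(Icc (0 : ℝ) T, ℝ) → C(Icc (0 : ℝ) T, ℝ) := fun u => primC hT h1 (v u)
  have hconst : Continuous fun x : ℝ => (ContinuousMap.const (Icc (0 : ℝ) T) x) :=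
    ContinuousMap.continuous_const'
  have hQc : Continuous fun u : C(Icc (0 : ℝ) T, ℝ) => primC hT h.a_int (QC.comp u) :=
    (continuous_primC hT h.a_int).comp (ContinuousMap.continuous_postcomp QC)
  have hSc : Continuous S := continuous_const.mul
    ((continuous_eval_const tT).comp hQc)
  have hkc : Continuous k := (((((continuous_primC hT h1).comp (hconst.comp hSc)).add
    continuous_const).sub hQc).sub (ContinuousMap.continuous_postcomp FC))
  have hδc : Continuous δ := continuous_of_shift h.pos h.ψ_cont h.ψ_mono hδ
  have hvc : Continuous v := (ContinuousMap.continuous_postcomp ψC).comp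
    ((hconst.comp (hδc.comp hkc)).add hkc)
  have hyc : Continuous y := (continuous_primC hT h1).comp hvc
  have hB : 0 ≤ B := (abs_nonneg _).trans (hFB 0)
  have hnorm : ∀ (f : C(ℝ, ℝ)), (∀ x, |f x| ≤ B) → ∀ u : C(Icc (0 : ℝ) T, ℝ), ‖f.comp u‖ ≤ B :=
    fun f hf u => (ContinuousMap.norm_le _ hB).2 fun t => hf (u t)
  set Ia := ∫ τ in (0 : ℝ)..T, |a τ|
  have hIa0 : 0 ≤ Ia := intervalIntegral.integral_nonneg hT fun _ _ => abs_nonneg _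
  have hPa : ∀ u, ‖primC hT h.a_int (QC.comp u)‖ ≤ Ia * B := fun u =>
    (norm_primC_le hT h.a_int _).trans (mul_le_mul_of_nonneg_left (hnorm QC hQB u) hIa0)
  have hSb : ∀ u, |S u| ≤ 1 / T * (Ia * B) := fun u => by
    simp only [S]
    rw [abs_mul, abs_of_nonneg (by positivity : 0 ≤ 1 / T)]
    exact mul_le_mul_of_nonneg_left ((ContinuousMap.norm_coe_le_norm _ tT).trans (hPa u))
      (by positivity)
  obtain ⟨M, hM⟩ : ∃ M, ∀ u, ‖k u‖ ≤ M := by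
    refine ⟨(∫ τ in (0 : ℝ)..T, |(1 : ℝ)|) * (1 / T * (Ia * B)) +
      ‖primC hT h.e_int (ContinuousMap.const _ 1)‖ + Ia * B + B, fun u => ?_⟩
    refine (norm_sub_le _ _).trans (add_le_add ((norm_sub_le _ _).trans (add_le_add
      ((norm_add_le _ _).trans (add_le_add ?_ le_rfl)) (hPa u))) (hnorm FC hFB u))
    refine (norm_primC_le hT h1 _).trans (mul_le_mul_of_nonneg_left ?_
      (intervalIntegral.integral_nonneg hT fun _ _ => abs_nonneg _))
    exact (ContinuousMap.norm_le _ (by positivity)).2 fun t => hSb u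
  obtain ⟨L, hL⟩ : ∃ L, ∀ x ∈ Icc (-(2 * M)) (2 * M), |ψ x| ≤ L := by
    obtain ⟨L, hL⟩ := (isCompact_Icc (a := -(2 * M)) (b := 2 * M)).exists_bound_of_continuousOn
      h.ψ_cont.continuousOn
    exact ⟨L, hL⟩
  have hvL : ∀ u t, |v u t| ≤ L := by
    intro u t
    apply hL
    have h1 := abs_le.1 ((hδle (k u)).trans (hM u))
    have h2 := abs_le.1 (((k u).norm_coe_le_norm t).trans (hM u))
    simp only [ContinuousMap.add_apply, ContinuousMap.const_apply, mem_Icc]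
    constructor <;> linarith [h1.1, h1.2, h2.1, h2.2]
  have hvext : ∀ u, Continuous (IccExtend hT (v u)) := fun u => (v u).continuous.Icc_extend'
  have hyval : ∀ u t, y u t = ∫ τ in (0 : ℝ)..t, IccExtend hT (v u) τ := by
    intro u t
    simp only [y, primC, ContinuousMap.coe_mk, one_mul]
  have hkval : ∀ (u : C(Icc (0 : ℝ) T, ℝ)) t, k u t =
      (∫ τ in (0 : ℝ)..t, (S u + e τ - a τ * Q (IccExtend hT u τ))) - F (u t) := by
    intro u t
    have hi : IntervalIntegrable (fun τ => a τ * Q (IccExtend hT u τ)) volume 0 T :=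
      h.intervalIntegrable_mul (hQ.comp u.continuous.Icc_extend').continuousOn
    rw [intervalIntegral.integral_sub (intervalIntegrable_const.add
      (intervalIntegrable_restrict h.e_int (left_mem_Icc.2 hT) t.2))
      (intervalIntegrable_restrict hi (left_mem_Icc.2 hT) t.2),
      intervalIntegral.integral_add intervalIntegrable_const
        (intervalIntegrable_restrict h.e_int (left_mem_Icc.2 hT) t.2)]
    simp [k, primC, IccExtend, FC, QC]
  have hkext : ∀ (u : C(Icc (0 : ℝ) T, ℝ)) t, t ∈ Icc 0 T → IccExtend hT (k u) t =
      (∫ τ in (0 : ℝ)..t, (S u + e τ - a τ * Q (IccExtend hT u τ))) - F (IccExtend hT u t) := by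
    intro u t ht
    rw [IccExtend_of_mem _ _ ht, IccExtend_of_mem _ _ ht, hkval]
  refine ⟨S, y, L, hSc, hyc, (abs_nonneg _).trans (hvL 0 tT), ?_, ?_, ?_, ?_⟩
  · intro u t t'
    rw [hyval, hyval, intervalIntegral.integral_interval_sub_left
      ((hvext u).intervalIntegrable _ _) ((hvext u).intervalIntegrable _ _)]
    have := intervalIntegral.norm_integral_le_of_norm_le_const (a := (t' : ℝ)) (b := t)
      (f := IccExtend hT (v u)) (C := L) (fun τ _ => hvL u _)
    rwa [Real.norm_eq_abs, ← Real.dist_eq] at this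
  · intro u
    rw [hyval]
    simp
  · intro u c hu
    refine ⟨δ (k u), ?_, ?_, ?_⟩
    · intro t ht
      rw [← hkext u t ht]
      have hd : HasDerivAt (fun x => c + ∫ τ in (0 : ℝ)..x, IccExtend hT (v u) τ)
          (IccExtend hT (v u) t) t :=
        ((hvext u).integral_hasStrictDerivAt 0 t).hasDerivAt.const_add c
      refine hd.hasDerivWithinAt.congr (fun x hx => ?_) ?_
      · rw [IccExtend_of_mem _ _ hx, hu, hyval]
      · rw [IccExtend_of_mem _ _ ht, hu, hyval]
    · rw [IccExtend_of_mem _ _ (left_mem_Icc.2 hT), IccExtend_of_mem _ _ (right_mem_Icc.2 hT),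
        hu, hu, hyval, hyval]
      have : ∫ τ in (0 : ℝ)..T, IccExtend hT (v u) τ = 0 := hδ (k u)
      simp [this]
    · have hi : IntervalIntegrable (fun τ => a τ * Q (IccExtend hT u τ)) volume 0 T :=
        h.intervalIntegrable_mul (hQ.comp u.continuous.Icc_extend').continuousOn
      rw [intervalIntegral.integral_sub (intervalIntegrable_const.add h.e_int) hi,
        intervalIntegral.integral_add intervalIntegrable_const h.e_int, h.e_mean]
      have hTne := h.pos.ne'
      simp [S, primC, IccExtend, QC, tT]
      field_simp
      simp
  · intro u s d hu
    have hSs : S u = s := by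
      have h_int := hu.integral_eq h hQ
      have h2 : primC hT h.a_int (QC.comp u) tT = T * s := h_int
      simp only [S]
      rw [h2]
      have hTne := h.pos.ne'
      field_simp
    have hder : ∀ t ∈ Icc 0 T, HasDerivWithinAt (IccExtend hT u)
        (ψ (d + IccExtend hT (k u) t)) (Icc 0 T) t := by
      intro t ht
      rw [hkext u t ht, hSs]
      exact hu.deriv t ht
    have hgc : Continuous fun t => ψ (d + IccExtend hT (k u) t) :=
      h.ψ_cont.comp (continuous_const.add (k u).continuous.Icc_extend')
    have hftc : ∀ t ∈ Icc 0 T, ∫ τ in (0 : ℝ)..t, ψ (d + IccExtend hT (k u) τ) =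
        IccExtend hT u t - IccExtend hT u 0 := by
      intro t ht
      refine intervalIntegral.integral_eq_sub_of_hasDeriv_right_of_le ht.1
        u.continuous.Icc_extend'.continuousOn (fun x hx => ?_) (hgc.intervalIntegrable _ _)
      have hx' : x ∈ Ioo 0 T := ⟨hx.1, hx.2.trans_le ht.2⟩
      exact ((hder x (Ioo_subset_Icc_self hx')).hasDerivAt
        (Icc_mem_nhds hx'.1 hx'.2)).hasDerivWithinAt
    have hmean : ∫ τ in (0 : ℝ)..T, ψ (d + IccExtend hT (k u) τ) = 0 := by
      rw [hftc T (right_mem_Icc.2 hT), hu.per, sub_self]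
    have hdδ : d = δ (k u) := by
      have hc := (k u).continuous.Icc_extend' (h := hT) |>.continuousOn (s := Icc 0 T)
      apply le_antisymm
      · simpa using shift_le h.pos h.ψ_cont h.ψ_mono hc hc hmean (hδ (k u)) (δ := 0) (by simp)
      · simpa using shift_le h.pos h.ψ_cont h.ψ_mono hc hc (hδ (k u)) hmean (δ := 0) (by simp)
    refine ⟨hSs, fun t => ?_⟩
    have h3 := hftc t t.2
    rw [hdδ, IccExtend_of_mem _ _ t.2, IccExtend_of_mem _ _ (left_mem_Icc.2 hT)] at h3
    have h4 : y u t = ∫ τ in (0 : ℝ)..t, ψ (δ (k u) + IccExtend hT (k u) τ) := hyval u t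
    rw [h4, h3]
    ring

theorem abs_iInf_sub_iInf_le {X : Type*} [TopologicalSpace X] [CompactSpace X] [Nonempty X]
    (v w : C(X, ℝ)) : |(⨅ t, v t) - ⨅ t, w t| ≤ ‖v - w‖ := by
  have key : ∀ v w : C(X, ℝ), (⨅ t, v t) - ‖v - w‖ ≤ ⨅ t, w t := by
    intro v w
    refine le_ciInf fun t => ?_
    have h1 : (⨅ t, v t) ≤ v t := ciInf_le (isCompact_range v.continuous).bddBelow t
    have h2 := (abs_le.1 ((v - w).norm_coe_le_norm t)).2
    simp only [ContinuousMap.sub_apply] at h2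
    linarith
  have h1 := key v w
  have h2 := key w v
  rw [norm_sub_rev w v] at h2
  exact abs_le.2 ⟨by linarith, by linarith⟩

theorem continuous_iInf_continuousMap {X : Type*} [TopologicalSpace X] [CompactSpace X]
    [Nonempty X] : Continuous fun v : C(X, ℝ) => ⨅ t, v t := by
  refine (LipschitzWith.of_dist_le_mul (K := 1) fun v w => ?_).continuous
  rw [Real.dist_eq, NNReal.coe_one, one_mul, dist_eq_norm]
  exact abs_iInf_sub_iInf_le v w

/-- Solutions whose minimal distance `c` to `α` is coupled to the parameter through a clipped
balance law on `[c₁, c₂]`. -/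
theorem WEData.exists_isIntSol_of_level {T : ℝ} {φ ψ a e : ℝ → ℝ} {abar A : ℝ}
    (h : WEData T φ ψ a e abar A) {F Q : ℝ → ℝ} (hF : Continuous F) (hQ : Continuous Q)
    {B : ℝ} (hFB : ∀ x, |F x| ≤ B) (hQB : ∀ x, |Q x| ≤ B) {α : ℝ → ℝ}
    (hα : ContinuousOn α (Icc 0 T)) {c₁ c₂ : ℝ} (hc : c₁ ≤ c₂) (σ s : ℝ) :
    ∃ (u : ℝ → ℝ) (s' d c : ℝ), IsIntSol T ψ F Q a e s' d u ∧
      (∀ t ∈ Icc 0 T, α t + c ≤ u t) ∧ (∃ t ∈ Icc 0 T, u t = α t + c) ∧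
      c = max c₁ (min c₂ (c + σ * (s - s'))) := by
  obtain ⟨S, y, L, hS, hy, hL, hyL, hy0, hsol, -⟩ := h.exists_operator hF hQ hFB hQB
  have hT := h.pos.le
  let o : Icc (0 : ℝ) T := ⟨0, left_mem_Icc.2 hT⟩
  have : Nonempty (Icc (0 : ℝ) T) := ⟨o⟩
  let αC : C(Icc (0 : ℝ) T, ℝ) := ⟨fun t => α t, hα.domRestrict⟩
  let mn : C(Icc (0 : ℝ) T, ℝ) → ℝ := fun v => ⨅ t, v t
  have hmn : Continuous mn := continuous_iInf_continuousMap
  have hmn_le : ∀ v t, mn v ≤ v t := fun v t => ciInf_le (isCompact_range v.continuous).bddBelow t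
  have hmn_const : ∀ v x, mn (v + ContinuousMap.const _ x) = mn v + x := by
    intro v x
    apply le_antisymm
    · have : mn (v + ContinuousMap.const _ x) - x ≤ mn v := le_ciInf fun t => by
        have := hmn_le (v + ContinuousMap.const _ x) t
        simp only [ContinuousMap.add_apply, ContinuousMap.const_apply] at this
        linarith
      linarith
    · refine le_ciInf fun t => ?_
      simpa using hmn_le v t
  let m : C(Icc (0 : ℝ) T, ℝ) → ℝ := fun u =>
    max c₁ (min c₂ (mn (u - αC) + σ * (s - S u)))
  have hm : Continuous m := continuous_const.max (continuous_const.min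
    ((hmn.comp (continuous_id.sub continuous_const)).add
      (continuous_const.mul (continuous_const.sub hS))))
  have hm1 : ∀ u, c₁ ≤ m u := fun u => le_max_left _ _
  have hm2 : ∀ u, m u ≤ c₂ := fun u => max_le hc (min_le_left _ _)
  let k : C(Icc (0 : ℝ) T, ℝ) → ℝ := fun u => m u - mn (y u - αC)
  have hk : Continuous k := hm.sub (hmn.comp (hy.sub continuous_const))
  let G : C(Icc (0 : ℝ) T, ℝ) → C(Icc (0 : ℝ) T, ℝ) := fun u =>
    y u + ContinuousMap.const _ (k u)
  have hG : Continuous G := hy.add (ContinuousMap.continuous_const'.comp hk)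
  have hyb : ∀ u t, |y u t| ≤ L * T := by
    intro u t
    have h1 := hyL u t o
    rw [hy0 u, sub_zero] at h1
    refine h1.trans (mul_le_mul_of_nonneg_left ?_ hL)
    rw [Subtype.dist_eq, Real.dist_eq, sub_zero, abs_of_nonneg t.2.1]
    exact t.2.2
  have hkb : ∀ u, |k u| ≤ (|c₁| + |c₂|) + (L * T + ‖αC‖) := by
    intro u
    refine (abs_sub _ _).trans (add_le_add ?_ ?_)
    · rw [abs_le]
      constructor
      · linarith [hm1 u, neg_abs_le c₁, abs_nonneg c₂]
      · linarith [hm2 u, le_abs_self c₂, abs_nonneg c₁]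
    · have hb : ∀ t, |(y u - αC) t| ≤ L * T + ‖αC‖ := fun t =>
        (abs_sub _ _).trans (add_le_add (hyb u t) (αC.norm_coe_le_norm t))
      refine abs_le.2 ⟨le_ciInf fun t => (abs_le.1 (hb t)).1, ?_⟩
      exact (hmn_le _ o).trans (abs_le.1 (hb o)).2
  obtain ⟨u, -, hu⟩ := exists_fixedPoint_of_isCompact_convex
    (isCompact_lipBall (X := Icc (0 : ℝ) T) (L * T + ((|c₁| + |c₂|) + (L * T + ‖αC‖))) L)
    (convex_lipBall _ _ _)
    ⟨0, fun t => by simpa using by positivity, fun t t' => by simpa using by positivity⟩ G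
    (fun u _ => ⟨fun t => (abs_add_le _ _).trans (add_le_add (hyb u t) (hkb u)), fun t t' => by
      simpa [G] using hyL u t t'⟩) hG.continuousOn
  obtain ⟨d, hd⟩ := hsol u (k u) fun t => by
    conv_lhs => rw [← hu]
    simp [G, add_comm]
  have hlev : mn (u - αC) = m u := by
    have : u - αC = (y u - αC) + ContinuousMap.const _ (k u) := by
      conv_lhs => rw [← hu]
      simp only [G]
      abel
    rw [this, hmn_const]
    simp [k]
  obtain ⟨t₀, ht₀⟩ := (isCompact_range (u - αC).continuous).sInf_mem (range_nonempty _)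
  refine ⟨_, S u, d, m u, hd, fun t ht => ?_, ⟨t₀, t₀.2, ?_⟩, ?_⟩
  · rw [IccExtend_of_mem _ _ ht, ← hlev]
    have := hmn_le (u - αC) ⟨t, ht⟩
    simp only [ContinuousMap.sub_apply] at this
    have h2 : αC ⟨t, ht⟩ = α t := rfl
    linarith
  · rw [IccExtend_of_mem _ _ t₀.2, ← hlev]
    have h1 : u t₀ - α t₀ = mn (u - αC) := ht₀
    have h2 : u ⟨(t₀ : ℝ), t₀.2⟩ = u t₀ := rfl
    linarith
  · conv_rhs => rw [← hlev]

/-- The parameters of the solutions with values in `[-R, R]` have a greatest element. -/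
theorem WEData.exists_isGreatest {T : ℝ} {φ ψ a e : ℝ → ℝ} {abar A : ℝ}
    (h : WEData T φ ψ a e abar A) {F Q : ℝ → ℝ} (hF : Continuous F) (hQ : Continuous Q)
    {B : ℝ} (hFB : ∀ x, |F x| ≤ B) (hQB : ∀ x, |Q x| ≤ B) (R : ℝ)
    (hne : {s | ∃ d u, IsIntSol T ψ F Q a e s d u ∧ ∀ t ∈ Icc 0 T, |u t| ≤ R}.Nonempty) :
    ∃ s₀, IsGreatest {s | ∃ d u, IsIntSol T ψ F Q a e s d u ∧ ∀ t ∈ Icc 0 T, |u t| ≤ R} s₀ := by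
  obtain ⟨S, y, L, hS, hy, hL, hyL, hy0, hsol, hconv⟩ := h.exists_operator hF hQ hFB hQB
  have hT := h.pos.le
  let o : Icc (0 : ℝ) T := ⟨0, left_mem_Icc.2 hT⟩
  let K : Set C(Icc (0 : ℝ) T, ℝ) := lipBall _ R L ∩ {u | ∀ t, u t = u o + y u t}
  have hK : IsCompact K := by
    refine (isCompact_lipBall R L).inter_right ?_
    rw [ofPred_forall]
    refine isClosed_iInter fun t => isClosed_eq (continuous_eval_const t) ?_
    exact (continuous_eval_const o).add ((continuous_eval_const t).comp hy)
  have himg : {s | ∃ d u, IsIntSol T ψ F Q a e s d u ∧ ∀ t ∈ Icc 0 T, |u t| ≤ R} = S '' K := by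
    ext s
    constructor
    · rintro ⟨d, u, hu, hR⟩
      let uC : C(Icc (0 : ℝ) T, ℝ) := ⟨fun t => u t, hu.continuousOn.domRestrict⟩
      have hu' : IsIntSol T ψ F Q a e s d (IccExtend hT uC) := hu.congr hT
        (fun t ht => by rw [IccExtend_of_mem _ _ ht]; rfl) (fun _ _ => rfl) (fun _ _ => rfl)
      obtain ⟨h1, h2⟩ := hconv uC s d hu'
      refine ⟨uC, ⟨⟨fun t => hR t t.2, fun t t' => ?_⟩, h2⟩, h1⟩
      rw [h2 t, h2 t', add_sub_add_left_eq_sub]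
      exact hyL uC t t'
    · rintro ⟨u, ⟨hu1, hu2⟩, rfl⟩
      obtain ⟨d, hd⟩ := hsol u (u o) hu2
      exact ⟨d, _, hd, fun t ht => hu1.1 _⟩
  rw [himg] at hne ⊢
  exact (hK.image hS).exists_isGreatest hne

theorem IsIntSol.le_mul_of_forall_le {T : ℝ} {φ ψ a e : ℝ → ℝ} {abar A : ℝ}
    (h : WEData T φ ψ a e abar A) {F Q u : ℝ → ℝ} {s d η : ℝ} (hQ : Continuous Q)
    (hu : IsIntSol T ψ F Q a e s d u) (hle : ∀ t ∈ Icc 0 T, Q (u t) ≤ η) : s ≤ abar * η := by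
  have hi : IntervalIntegrable (fun τ => a τ * Q (u τ)) volume 0 T :=
    h.intervalIntegrable_mul (hQ.comp_continuousOn hu.continuousOn)
  have h1 : ∫ τ in (0 : ℝ)..T, a τ * Q (u τ) ≤ ∫ τ in (0 : ℝ)..T, a τ * η := by
    refine intervalIntegral.integral_mono_ae_restrict h.pos.le hi (h.a_int.mul_const η) ?_
    filter_upwards [h.a_nonneg, ae_restrict_mem measurableSet_Icc] with t hat ht
    exact mul_le_mul_of_nonneg_left (hle t ht) hat
  rw [hu.integral_eq h hQ, intervalIntegral.integral_mul_const, h.a_mean, mul_assoc] at h1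
  exact le_of_mul_le_mul_left h1 h.pos

theorem IsIntSol.mul_le_of_forall_le {T : ℝ} {φ ψ a e : ℝ → ℝ} {abar A : ℝ}
    (h : WEData T φ ψ a e abar A) {F Q u : ℝ → ℝ} {s d η : ℝ} (hQ : Continuous Q)
    (hu : IsIntSol T ψ F Q a e s d u) (hle : ∀ t ∈ Icc 0 T, η ≤ Q (u t)) : abar * η ≤ s := by
  have hi : IntervalIntegrable (fun τ => a τ * Q (u τ)) volume 0 T :=
    h.intervalIntegrable_mul (hQ.comp_continuousOn hu.continuousOn)
  have h1 : ∫ τ in (0 : ℝ)..T, a τ * η ≤ ∫ τ in (0 : ℝ)..T, a τ * Q (u τ) := by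
    refine intervalIntegral.integral_mono_ae_restrict h.pos.le (h.a_int.mul_const η) hi ?_
    filter_upwards [h.a_nonneg, ae_restrict_mem measurableSet_Icc] with t hat ht
    exact mul_le_mul_of_nonneg_left (hle t ht) hat
  rw [hu.integral_eq h hQ, intervalIntegral.integral_mul_const, h.a_mean, mul_assoc] at h1
  exact le_of_mul_le_mul_left h1 h.pos

/-- The primitive of a function of zero mean bounded below is bounded. -/
theorem abs_integral_le_of_neg_le {T K : ℝ} (hT : 0 ≤ T) (hK : 0 ≤ K) {g : ℝ → ℝ}
    (hg : IntervalIntegrable g volume 0 T)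
    (hle : ∀ᵐ t ∂(volume.restrict (Icc 0 T)), -K ≤ g t) (hmean : ∫ τ in (0 : ℝ)..T, g τ = 0)
    {t : ℝ} (ht : t ∈ Icc 0 T) : |∫ τ in (0 : ℝ)..t, g τ| ≤ K * T := by
  have h0 := left_mem_Icc.2 hT
  have h1 := right_mem_Icc.2 hT
  have key : ∀ x y, x ∈ Icc 0 T → y ∈ Icc 0 T → x ≤ y → -(K * T) ≤ ∫ τ in x..y, g τ := by
    intro x y hx hy hxy
    have : ∫ τ in x..y, (-K : ℝ) ≤ ∫ τ in x..y, g τ := by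
      refine intervalIntegral.integral_mono_ae_restrict hxy intervalIntegrable_const
        (intervalIntegrable_restrict hg hx hy) ?_
      exact ae_restrict_of_ae_restrict_of_subset (Icc_subset_Icc hx.1 hy.2) hle
    simp only [intervalIntegral.integral_const, smul_eq_mul] at this
    nlinarith [hx.1, hy.2]
  have h2 := key 0 t h0 ht ht.1
  have h3 := key t T ht h1 ht.2
  have h4 := intervalIntegral.integral_add_adjacent_intervals
    (intervalIntegrable_restrict hg h0 ht) (intervalIntegrable_restrict hg ht h1)
  rw [hmean] at h4
  exact abs_le.2 ⟨h2, by linarith⟩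

/-- The oscillation of the solutions is bounded uniformly in the friction term. -/
theorem WEData.exists_oscillation_bound {T : ℝ} {φ ψ a e : ℝ → ℝ} {abar A : ℝ}
    (h : WEData T φ ψ a e abar A) (s₁ Qm : ℝ) :
    ∃ C, 0 ≤ C ∧ ∀ F Q : ℝ → ℝ, Continuous F → Continuous Q → (∀ x, Q x ≤ Qm) →
      ∀ s d u, s₁ ≤ s → IsIntSol T ψ F Q a e s d u →
        ∀ t ∈ Icc 0 T, ∀ t' ∈ Icc 0 T, u t ≤ u t' + C := by
  have hA := h.A_nonneg
  set K₀ := |s₁| + A + A * |Qm| with hK₀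
  have hK₀0 : 0 ≤ K₀ := by positivity
  set K := K₀ * T with hK
  have hK0 : 0 ≤ K := mul_nonneg hK₀0 h.pos.le
  set X := max (ψ (K + 1)) (-ψ (-(K + 1))) with hX
  have hX0 : 0 ≤ X := by
    refine le_trans ?_ (le_max_left _ _)
    rw [← h.ψ_zero]
    exact h.ψ_mono.monotone (by linarith)
  have hφ : ∀ x : ℝ, (K + 1) * |x| ≤ (K + 1) * X + φ x * x := by
    intro x
    have hφψ : ∀ y, ψ y < x → y ≤ φ x := fun y hy => by
      rw [← h.φ_ψ y]; exact h.φ_mono.monotone hy.le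
    have hφψ' : ∀ y, x < ψ y → φ x ≤ y := fun y hy => by
      rw [← h.φ_ψ y]; exact h.φ_mono.monotone hy.le
    by_cases h1 : ψ (K + 1) < x
    · have hx0 : 0 ≤ x := by
        refine le_trans ?_ h1.le
        rw [← h.ψ_zero]
        exact h.ψ_mono.monotone (by linarith)
      rw [abs_of_nonneg hx0]
      nlinarith [hφψ _ h1]
    by_cases h2 : x < ψ (-(K + 1))
    · have hx0 : x ≤ 0 := by
        refine le_trans h2.le ?_
        rw [← h.ψ_zero]
        exact h.ψ_mono.monotone (by linarith)
      rw [abs_of_nonpos hx0]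
      nlinarith [hφψ' _ h2]
    · have hxX : |x| ≤ X := abs_le.2 ⟨by linarith [le_max_right (ψ (K + 1)) (-ψ (-(K + 1)))],
        by linarith [le_max_left (ψ (K + 1)) (-ψ (-(K + 1)))]⟩
      have hpos : 0 ≤ φ x * x := by
        rcases le_total 0 x with hx | hx
        · exact mul_nonneg (h.φ_zero ▸ h.φ_mono.monotone hx) hx
        · exact mul_nonneg_of_nonpos_of_nonpos (h.φ_zero ▸ h.φ_mono.monotone hx) hx
      nlinarith
  refine ⟨(K + 1) * X * T, by have := h.pos; positivity, ?_⟩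
  intro F Q hF hQ hQm s d u hs hu
  have hH : ∀ t ∈ Icc 0 T, |∫ τ in (0 : ℝ)..t, (s + e τ - a τ * Q (u τ))| ≤ K := by
    intro t ht
    refine abs_integral_le_of_neg_le h.pos.le hK₀0
      (h.intervalIntegrable_force hQ hu.continuousOn s) ?_ hu.mean ht
    filter_upwards [h.a_nonneg, h.a_le, h.e_le] with τ h1 h2 h3
    have h4 : a τ * Q (u τ) ≤ A * |Qm| := by
      refine (mul_le_mul_of_nonneg_left ((hQm _).trans (le_abs_self _)) h1).trans ?_
      exact mul_le_mul_of_nonneg_right h2 (abs_nonneg _)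
    linarith [neg_abs_le s₁, (abs_le.1 h3).1]
  set v : ℝ → ℝ := fun t => ψ (d + ((∫ τ in (0 : ℝ)..t, (s + e τ - a τ * Q (u τ))) - F (u t)))
    with hv
  have hvb : ∀ t ∈ Icc 0 T, |v t| ≤ (K + 1) * X + (d - F (u t)) * v t := by
    intro t ht
    have hφv : φ (v t) = d + ((∫ τ in (0 : ℝ)..t, (s + e τ - a τ * Q (u τ))) - F (u t)) :=
      h.φ_ψ _
    set I := ∫ τ in (0 : ℝ)..t, (s + e τ - a τ * Q (u τ)) with hI
    have h1 := hφ (v t)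
    have h2 : I * v t ≤ K * |v t| := by
      refine (le_abs_self _).trans ?_
      rw [abs_mul]
      exact mul_le_mul_of_nonneg_right (hH t ht) (abs_nonneg _)
    rw [hφv] at h1
    nlinarith
  have hGd : ∀ x, HasDerivAt (fun z => ∫ y in (0 : ℝ)..z, (d - F y)) (d - F x) x := fun x =>
    ((continuous_const.sub hF).integral_hasStrictDerivAt 0 x).hasDerivAt
  set G : ℝ → ℝ := fun z => ∫ y in (0 : ℝ)..z, (d - F y) with hG
  set P : ℝ → ℝ := fun t => (K + 1) * X * t + G (u t) with hP
  have hPd : ∀ t ∈ Icc 0 T, HasDerivWithinAt P ((K + 1) * X + (d - F (u t)) * v t) (Icc 0 T) t := by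
    intro t ht
    have h1 := (hasDerivWithinAt_id t (Icc 0 T)).const_mul ((K + 1) * X)
    have h2 := (hGd (u t)).comp_hasDerivWithinAt t (hu.deriv t ht)
    rw [mul_one] at h1
    exact h1.add h2
  have hmono : ∀ (σ : ℝ), |σ| ≤ 1 → MonotoneOn (fun t => P t - σ * u t) (Icc 0 T) := by
    intro σ hσ
    have hd : ∀ t ∈ Icc 0 T, HasDerivWithinAt (fun t => P t - σ * u t)
        ((K + 1) * X + (d - F (u t)) * v t - σ * v t) (Icc 0 T) t := fun t ht =>
      (hPd t ht).sub ((hu.deriv t ht).const_mul σ)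
    refine monotoneOn_of_hasDerivWithinAt_nonneg (convex_Icc _ _)
      (fun t ht => (hd t ht).continuousWithinAt)
      (fun t ht => (hd t (interior_subset ht)).mono interior_subset) fun t ht => ?_
    have h1 : σ * v t ≤ |v t| := by
      refine (le_abs_self _).trans ?_
      rw [abs_mul]
      exact mul_le_of_le_one_left (abs_nonneg _) hσ
    linarith [hvb t (interior_subset ht)]
  have h0 := left_mem_Icc.2 h.pos.le
  have hT := right_mem_Icc.2 h.pos.le
  have hPT : P T - P 0 = (K + 1) * X * T := by
    simp only [hP, hu.per]
    ring
  intro t ht t' ht'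
  have m0 := hmono 0 (by simp)
  have a1 := m0 h0 ht ht.1
  have a2 := m0 ht hT ht.2
  have a3 := m0 h0 ht' ht'.1
  have a4 := m0 ht' hT ht'.2
  simp only [zero_mul, sub_zero] at a1 a2 a3 a4
  rcases le_total t t' with htt | htt
  · have := hmono (-1) (by simp) ht ht' htt
    simp only [] at this
    linarith
  · have := hmono 1 (by simp) ht' ht htt
    simp only [] at this
    linarith

theorem nonneg_of_hasDerivWithinAt_of_min_left {T t₀ v' : ℝ} {v : ℝ → ℝ}
    (hv : HasDerivWithinAt v v' (Icc 0 T) t₀) (ht₀ : t₀ ∈ Ico 0 T)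
    (hmin : ∀ t ∈ Icc 0 T, v t₀ ≤ v t) : 0 ≤ v' := by
  have h1 : HasDerivWithinAt v v' (Ioo t₀ T) t₀ :=
    hv.mono fun t ht => ⟨ht₀.1.trans ht.1.le, ht.2.le⟩
  rw [hasDerivWithinAt_iff_tendsto_slope' (by simp)] at h1
  have : (nhdsWithin t₀ (Ioo t₀ T)).NeBot := by
    rw [nhdsWithin_Ioo_eq_nhdsGT ht₀.2]; infer_instance
  refine ge_of_tendsto h1 (eventually_nhdsWithin_of_forall fun t ht => ?_)
  rw [slope_def_field]
  exact div_nonneg (sub_nonneg.2 (hmin t ⟨ht₀.1.trans ht.1.le, ht.2.le⟩)) (sub_nonneg.2 ht.1.le)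

theorem nonpos_of_hasDerivWithinAt_of_min_right {T t₀ v' : ℝ} {v : ℝ → ℝ}
    (hv : HasDerivWithinAt v v' (Icc 0 T) t₀) (ht₀ : t₀ ∈ Ioc 0 T)
    (hmin : ∀ t ∈ Icc 0 T, v t₀ ≤ v t) : v' ≤ 0 := by
  have h1 : HasDerivWithinAt v v' (Ioo 0 t₀) t₀ :=
    hv.mono fun t ht => ⟨ht.1.le, ht.2.le.trans ht₀.2⟩
  rw [hasDerivWithinAt_iff_tendsto_slope' (by simp)] at h1
  have : (nhdsWithin t₀ (Ioo 0 t₀)).NeBot := by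
    rw [nhdsWithin_Ioo_eq_nhdsLT ht₀.1]; infer_instance
  refine le_of_tendsto h1 (eventually_nhdsWithin_of_forall fun t ht => ?_)
  rw [slope_def_field]
  exact div_nonpos_of_nonneg_of_nonpos (sub_nonneg.2 (hmin t ⟨ht.1.le, ht.2.le.trans ht₀.2⟩))
    (sub_nonpos.2 ht.2.le)

/-- A solution touching another one from above has a parameter at least as large. -/
theorem IsIntSol.le_of_touch {T : ℝ} {φ ψ a e : ℝ → ℝ} {abar A : ℝ}
    (h : WEData T φ ψ a e abar A) {F Q u α : ℝ → ℝ} {s d s' d' : ℝ} (hQ : Continuous Q)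
    (hF : ∀ t ∈ Icc 0 T, DifferentiableAt ℝ F (α t)) (hα : IsIntSol T ψ F Q a e s' d' α)
    (hu : IsIntSol T ψ F Q a e s d u) (hle : ∀ t ∈ Icc 0 T, α t ≤ u t)
    (htouch : ∃ t ∈ Icc 0 T, u t = α t) : s' ≤ s := by
  have hT := h.pos
  have h0 := left_mem_Icc.2 hT.le
  have h1 := right_mem_Icc.2 hT.le
  obtain ⟨t₀, ht₀, htt⟩ : ∃ t ∈ Ico 0 T, u t = α t := by
    obtain ⟨t, ht, hut⟩ := htouch
    rcases ht.2.lt_or_eq with hlt | rfl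
    · exact ⟨t, ⟨ht.1, hlt⟩, hut⟩
    · exact ⟨0, ⟨le_rfl, hT⟩, by rw [hu.per, hα.per, hut]⟩
  have ht₀' : t₀ ∈ Icc 0 T := Ico_subset_Icc_self ht₀
  have hiu := h.intervalIntegrable_force hQ hu.continuousOn s
  have hiα := h.intervalIntegrable_force hQ hα.continuousOn s'
  set Iu : ℝ → ℝ := fun t => ∫ τ in (0 : ℝ)..t, (s + e τ - a τ * Q (u τ)) with hIu
  set Iα : ℝ → ℝ := fun t => ∫ τ in (0 : ℝ)..t, (s' + e τ - a τ * Q (α τ)) with hIα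
  have hIu0 : Iu 0 = 0 := intervalIntegral.integral_same
  have hIα0 : Iα 0 = 0 := intervalIntegral.integral_same
  have hvd : ∀ t ∈ Icc 0 T, HasDerivWithinAt (fun t => u t - α t)
      (ψ (d + (Iu t - F (u t))) - ψ (d' + (Iα t - F (α t)))) (Icc 0 T) t := fun t ht =>
    (hu.deriv t ht).sub (hα.deriv t ht)
  have hmin : ∀ t₁, u t₁ = α t₁ → ∀ t ∈ Icc 0 T, u t₁ - α t₁ ≤ u t - α t := fun t₁ h1 t ht => by
    linarith [hle t ht]
  have hder : ψ (d + (Iu t₀ - F (u t₀))) - ψ (d' + (Iα t₀ - F (α t₀))) = 0 := by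
    refine le_antisymm ?_ (nonneg_of_hasDerivWithinAt_of_min_left (hvd t₀ ht₀') ht₀ (hmin t₀ htt))
    rcases ht₀.1.lt_or_eq with hlt | rfl
    · exact nonpos_of_hasDerivWithinAt_of_min_right (hvd t₀ ht₀') ⟨hlt, ht₀.2.le⟩ (hmin t₀ htt)
    · have := nonpos_of_hasDerivWithinAt_of_min_right (hvd T h1) ⟨hT, le_rfl⟩
        (hmin T (by rw [← hu.per, ← hα.per, htt]))
      have hIuT : Iu T = 0 := hu.mean
      have hIαT : Iα T = 0 := hα.mean
      rw [hIu0, hIα0]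
      rwa [hIuT, hIαT, ← hu.per, ← hα.per] at this
  have harg : d + (Iu t₀ - F (u t₀)) = d' + (Iα t₀ - F (α t₀)) :=
    h.ψ_mono.injective (sub_eq_zero.1 hder)
  by_contra hlt
  push Not at hlt
  have hA := h.A_nonneg
  set ε := (s' - s) / (2 * (A + 1)) with hε
  have hε0 : 0 < ε := div_pos (by linarith) (by linarith)
  have hεs : ε * (A + 1) < s' - s := by
    have : ε * (2 * (A + 1)) = s' - s := div_mul_cancel₀ _ (by linarith)
    nlinarith
  have hFd : HasDerivWithinAt (fun t => F (u t) - F (α t)) 0 (Icc 0 T) t₀ := by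
    have hFα := (hF t₀ ht₀').hasDerivAt
    have hFu : HasDerivAt F (_root_.deriv F (α t₀)) (u t₀) := htt ▸ hFα
    have h3 := (hFu.comp_hasDerivWithinAt t₀ (hu.deriv t₀ ht₀')).sub
      (hFα.comp_hasDerivWithinAt t₀ (hα.deriv t₀ ht₀'))
    have h4 : _root_.deriv F (α t₀) * ψ (d + (Iu t₀ - F (u t₀))) -
        _root_.deriv F (α t₀) * ψ (d' + (Iα t₀ - F (α t₀))) = 0 := by rw [← mul_sub, hder, mul_zero]
    rw [h4] at h3
    exact h3
  have hev1 : ∀ᶠ t in nhdsWithin t₀ (Icc 0 T), |F (u t) - F (α t)| ≤ ε * |t - t₀| := by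
    have := (hasDerivWithinAt_iff_isLittleO.1 hFd).def hε0
    filter_upwards [this] with t ht
    simpa [htt] using ht
  have hev2 : ∀ᶠ t in nhdsWithin t₀ (Icc 0 T), Q (α t) - ε ≤ Q (u t) := by
    have hc : ContinuousWithinAt (fun t => Q (u t) - Q (α t)) (Icc 0 T) t₀ :=
      ((hQ.comp_continuousOn hu.continuousOn).sub (hQ.comp_continuousOn hα.continuousOn)) t₀ ht₀'
    have hlt' : -ε < Q (u t₀) - Q (α t₀) := by rw [htt]; linarith
    filter_upwards [hc.eventually (lt_mem_nhds hlt')] with t ht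
    linarith
  obtain ⟨r, hr, hball⟩ := Metric.mem_nhdsWithin_iff.1 (hev1.and hev2)
  obtain ⟨t₁, ht₁, ht₁'⟩ := exists_between (lt_min ht₀.2 (by linarith : t₀ < t₀ + r))
  have hsub : ∀ t ∈ Icc t₀ t₁, t ∈ Icc 0 T ∧ |F (u t) - F (α t)| ≤ ε * |t - t₀| ∧
      Q (α t) - ε ≤ Q (u t) := by
    intro t ht
    have htT : t ∈ Icc 0 T := ⟨ht₀.1.trans ht.1, ht.2.trans (ht₁'.le.trans (min_le_left _ _))⟩
    refine ⟨htT, hball ⟨?_, htT⟩⟩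
    rw [Metric.mem_ball, Real.dist_eq, abs_of_nonneg (sub_nonneg.2 ht.1)]
    linarith [ht.2, ht₁'.trans_le (min_le_right _ _)]
  have hneg : ∀ t ∈ Ioc t₀ t₁, d + (Iu t - F (u t)) < d' + (Iα t - F (α t)) := by
    intro t ht
    have htI : t ∈ Icc t₀ t₁ := Ioc_subset_Icc_self ht
    obtain ⟨htT, hFt, -⟩ := hsub t htI
    have hi1 := intervalIntegrable_restrict hiu ht₀' htT
    have hi2 := intervalIntegrable_restrict hiα ht₀' htT
    have hu_split : Iu t = Iu t₀ + ∫ τ in t₀..t, (s + e τ - a τ * Q (u τ)) :=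
      (intervalIntegral.integral_add_adjacent_intervals
        (intervalIntegrable_restrict hiu h0 ht₀') hi1).symm
    have hα_split : Iα t = Iα t₀ + ∫ τ in t₀..t, (s' + e τ - a τ * Q (α τ)) :=
      (intervalIntegral.integral_add_adjacent_intervals
        (intervalIntegrable_restrict hiα h0 ht₀') hi2).symm
    have hcmp : ∫ τ in t₀..t, (s + e τ - a τ * Q (u τ)) ≤
        ∫ τ in t₀..t, (s' + e τ - a τ * Q (α τ) + (s - s' + A * ε)) := by
      refine intervalIntegral.integral_mono_ae_restrict ht.1.le hi1
        (hi2.add intervalIntegrable_const) ?_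
      have hmem : ∀ᵐ τ ∂(volume.restrict (Icc t₀ t)), τ ∈ Icc t₀ t :=
        ae_restrict_mem measurableSet_Icc
      have hss : Icc t₀ t ⊆ Icc 0 T := Icc_subset_Icc ht₀.1 htT.2
      filter_upwards [hmem, ae_restrict_of_ae_restrict_of_subset hss h.a_nonneg,
        ae_restrict_of_ae_restrict_of_subset hss h.a_le] with τ hτ ha0 haA
      have hq := (hsub τ ⟨hτ.1, hτ.2.trans ht.2⟩).2.2
      have h5 : a τ * (Q (α τ) - ε) ≤ a τ * Q (u τ) := mul_le_mul_of_nonneg_left hq ha0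
      have h6 : a τ * ε ≤ A * ε := mul_le_mul_of_nonneg_right haA hε0.le
      linarith
    rw [intervalIntegral.integral_add hi2 intervalIntegrable_const,
      intervalIntegral.integral_const, smul_eq_mul] at hcmp
    rw [abs_of_pos (sub_pos.2 ht.1)] at hFt
    have hF0 : F (u t₀) = F (α t₀) := by rw [htt]
    have h7 := (abs_le.1 hFt).1
    have h8 : 0 < (t - t₀) * (s' - s - ε * (A + 1)) :=
      mul_pos (sub_pos.2 ht.1) (by linarith)
    nlinarith
  have hanti : StrictAntiOn (fun t => u t - α t) (Icc t₀ t₁) := by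
    have hsub' : Icc t₀ t₁ ⊆ Icc 0 T := fun t ht => (hsub t ht).1
    refine strictAntiOn_of_hasDerivWithinAt_neg (convex_Icc _ _)
      (fun t ht => ((hvd t (hsub' ht)).mono hsub').continuousWithinAt)
      (fun t ht => (hvd t (hsub' (interior_subset ht))).mono (interior_subset.trans hsub'))
      fun t ht => ?_
    rw [interior_Icc] at ht
    exact sub_neg.2 (h.ψ_mono (hneg t ⟨ht.1, ht.2.le⟩))
  have hfin := hanti (left_mem_Icc.2 ht₁.le) (right_mem_Icc.2 ht₁.le) ht₁
  have := hle t₁ (hsub t₁ (right_mem_Icc.2 ht₁.le)).1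
  simp only [htt, sub_self] at hfin
  linarith

theorem IsSolWE.exists_isIntSol {T : ℝ} {φ ψ a e : ℝ → ℝ} {abar A : ℝ}
    (h : WEData T φ ψ a e abar A) {f F q u : ℝ → ℝ} {s : ℝ} (hf : Continuous f)
    (hF : ∀ x, HasDerivAt F (f x) x) (hq : Continuous q) (hu : IsSolWE T φ f q a e s u) :
    ∃ d, IsIntSol T ψ F q a e s d u := by
  obtain ⟨u', w, ⟨hd, hc, hper, hper'⟩, ⟨hw, hφ⟩, heq⟩ := hu
  have hT := h.pos.le
  have h0 := left_mem_Icc.2 hT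
  have h1 := right_mem_Icc.2 hT
  have huc : ContinuousOn u (Icc 0 T) := fun t ht => (hd t ht).continuousWithinAt
  have hforce := h.intervalIntegrable_force hq huc s
  have hfu : ContinuousOn (fun t => f (u t) * u' t) (Icc 0 T) :=
    (hf.comp_continuousOn huc).mul hc
  have hfi : IntervalIntegrable (fun t => f (u t) * u' t) volume 0 T :=
    ContinuousOn.intervalIntegrable (by rwa [uIcc_of_le hT])
  have hftc : ∀ t ∈ Icc 0 T, ∫ τ in (0 : ℝ)..t, f (u τ) * u' τ = F (u t) - F (u 0) := by
    intro t ht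
    refine intervalIntegral.integral_eq_sub_of_hasDeriv_right_of_le (f := fun t => F (u t)) ht.1
      (fun x hx => ?_) (fun x hx => ?_) (intervalIntegrable_restrict hfi h0 ht)
    · exact ((hF (u x)).continuousAt.comp_continuousWithinAt
        (huc x ⟨hx.1, hx.2.trans ht.2⟩)).mono (Icc_subset_Icc_right ht.2)
    · have hx' : x ∈ Ioo 0 T := ⟨hx.1, hx.2.trans_le ht.2⟩
      have h2 := (hd x (Ioo_subset_Icc_self hx')).hasDerivAt (Icc_mem_nhds hx'.1 hx'.2)
      exact ((hF (u x)).comp x h2).hasDerivWithinAt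
  have hwint : ∀ t ∈ Icc 0 T, ∫ τ in (0 : ℝ)..t, w τ =
      (∫ τ in (0 : ℝ)..t, (s + e τ - a τ * q (u τ))) - (F (u t) - F (u 0)) := by
    intro t ht
    rw [← hftc t ht, ← intervalIntegral.integral_sub (intervalIntegrable_restrict hforce h0 ht)
      (intervalIntegrable_restrict hfi h0 ht)]
    refine intervalIntegral.integral_congr_ae_restrict ?_
    rw [uIoc_of_le ht.1]
    have hss : Ioc 0 t ⊆ Icc 0 T := Ioc_subset_Icc_self.trans (Icc_subset_Icc_right ht.2)
    filter_upwards [ae_restrict_of_ae_restrict_of_subset hss heq] with τ hτ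
    linarith
  refine ⟨φ (u' 0) + F (u 0), fun t ht => ?_, hper, ?_⟩
  · convert hd t ht using 1
    rw [← h.ψ_φ (u' t), hφ t ht, hwint t ht]
    congr 1
    ring
  · have h2 := hφ T h1
    rw [hwint T h1, ← hper, ← hper'] at h2
    linarith

theorem IsIntSol.isSolWE {T : ℝ} {φ ψ a e : ℝ → ℝ} {abar A : ℝ}
    (h : WEData T φ ψ a e abar A) {f F q u : ℝ → ℝ} {s d : ℝ} (hf : Continuous f)
    (hF : ∀ x, HasDerivAt F (f x) x) (hq : Continuous q) (hu : IsIntSol T ψ F q a e s d u) :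
    IsSolWE T φ f q a e s u := by
  have hT := h.pos.le
  have h0 := left_mem_Icc.2 hT
  have huc := hu.continuousOn
  have hforce := h.intervalIntegrable_force hq huc s
  set I : ℝ → ℝ := fun t => ∫ τ in (0 : ℝ)..t, (s + e τ - a τ * q (u τ)) with hI
  set u' : ℝ → ℝ := fun t => ψ (d + (I t - F (u t))) with hu'
  have hFc : Continuous F := continuous_iff_continuousAt.2 fun x => (hF x).continuousAt
  have hIc : ContinuousOn I (Icc 0 T) := by
    have := intervalIntegral.continuousOn_primitive_interval' hforce left_mem_uIcc
    rwa [uIcc_of_le hT] at this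
  have hc : ContinuousOn u' (Icc 0 T) := h.ψ_cont.comp_continuousOn
    (continuousOn_const.add (hIc.sub (hFc.comp_continuousOn huc)))
  have hfu : ContinuousOn (fun t => f (u t) * u' t) (Icc 0 T) :=
    (hf.comp_continuousOn huc).mul hc
  have hfi : IntervalIntegrable (fun t => f (u t) * u' t) volume 0 T :=
    ContinuousOn.intervalIntegrable (by rwa [uIcc_of_le hT])
  have hftc : ∀ t ∈ Icc 0 T, ∫ τ in (0 : ℝ)..t, f (u τ) * u' τ = F (u t) - F (u 0) := by
    intro t ht
    refine intervalIntegral.integral_eq_sub_of_hasDeriv_right_of_le (f := fun t => F (u t)) ht.1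
      (hFc.comp_continuousOn (huc.mono (Icc_subset_Icc_right ht.2))) (fun x hx => ?_)
      (intervalIntegrable_restrict hfi h0 ht)
    have hx' : x ∈ Ioo 0 T := ⟨hx.1, hx.2.trans_le ht.2⟩
    have h2 := (hu.deriv x (Ioo_subset_Icc_self hx')).hasDerivAt (Icc_mem_nhds hx'.1 hx'.2)
    exact ((hF (u x)).comp x h2).hasDerivWithinAt
  have hI0 : I 0 = 0 := intervalIntegral.integral_same
  have hIT : I T = 0 := hu.mean
  refine ⟨u', fun t => s + e t - a t * q (u t) - f (u t) * u' t,
    ⟨hu.deriv, hc, hu.per, ?_⟩, ⟨?_, fun t ht => ?_⟩, ?_⟩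
  · simp only [hu', hI0, hIT, hu.per]
  · rw [integrableOn_Icc_iff_integrableOn_Ioc, ← intervalIntegrable_iff_integrableOn_Ioc_of_le hT]
    exact hforce.sub hfi
  · rw [intervalIntegral.integral_sub (intervalIntegrable_restrict hforce h0 ht)
      (intervalIntegrable_restrict hfi h0 ht), hftc t ht]
    simp only [hu', h.φ_ψ, hI0]
    simp only [hI]
    ring
  · filter_upwards with t
    ring

theorem exists_weData {T : ℝ} (hT : 0 < T) {φ a e : ℝ → ℝ}
    (hφmono : StrictMono φ)
    (hφsurj : Function.Surjective φ) (hφ0 : φ 0 = 0)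
    (ha_meas : Measurable a) (ha_bdd : ∃ C : ℝ, ∀ᵐ t ∂(muT T), |a t| ≤ C)
    (ha_nonneg : ∀ᵐ t ∂(muT T), 0 ≤ a t)
    {abar : ℝ} (habar_def : (1 / T) * ∫ t in Icc (0:ℝ) T, a t = abar)
    (habar_pos : 0 < abar)
    (he_meas : Measurable e) (he_bdd : ∃ C : ℝ, ∀ᵐ t ∂(muT T), |e t| ≤ C)
    (he_mean : (1 / T) * ∫ t in Icc (0:ℝ) T, e t = 0) :
    ∃ ψ A, WEData T φ ψ a e abar A := by
  obtain ⟨Ca, hCa⟩ := ha_bdd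
  obtain ⟨Ce, hCe⟩ := he_bdd
  let o := hφmono.orderIsoOfSurjective φ hφsurj
  have h_int : ∀ g : ℝ → ℝ, Measurable g → ∀ C, (∀ᵐ t ∂(muT T), |g t| ≤ C) →
      IntervalIntegrable g volume 0 T := by
    intro g hg C hC
    rw [intervalIntegrable_iff_integrableOn_Ioc_of_le hT.le,
      ← integrableOn_Icc_iff_integrableOn_Ioc]
    exact Measure.integrableOn_of_bounded (M := C) (by simp) hg.aestronglyMeasurable hC
  have hconv : ∀ g : ℝ → ℝ, ∫ t in (0 : ℝ)..T, g t = ∫ t in Icc (0 : ℝ) T, g t := fun g => by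
    rw [intervalIntegral.integral_of_le hT.le, integral_Icc_eq_integral_Ioc]
  refine ⟨o.symm, max 0 (max Ca Ce), hT, hφmono, hφ0, o.symm.strictMono, o.symm.continuous,
    o.apply_symm_apply, o.symm_apply_apply, h_int a ha_meas Ca hCa, h_int e he_meas Ce hCe,
    ha_nonneg, ?_, ?_, le_max_left _ _, ?_, habar_pos, ?_⟩
  · filter_upwards [hCa] with t ht
    exact (le_abs_self _).trans (ht.trans ((le_max_left _ _).trans (le_max_right _ _)))
  · filter_upwards [hCe] with t ht
    exact ht.trans ((le_max_right _ _).trans (le_max_right _ _))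
  · rw [hconv, ← habar_def]
    field_simp
  · rw [hconv]
    simpa [hT.ne'] using he_mean

/-- Bounded continuous modifications of `F` and `q` outside `[l, r]`. -/
theorem exists_truncation {F q : ℝ → ℝ} (hF : Continuous F) (hq : Continuous q) {l r : ℝ}
    (hlr : l ≤ r) :
    ∃ (F' Q' : ℝ → ℝ) (B : ℝ), Continuous F' ∧ Continuous Q' ∧ (∀ x, |F' x| ≤ B) ∧
      (∀ x, |Q' x| ≤ B) ∧ (∀ x ∈ Icc l r, F' x = F x) ∧ (∀ x ∈ Icc l r, Q' x = q x) ∧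
      ∀ x, ∃ z ∈ Icc l r, Q' x = q z := by
  obtain ⟨B₁, hB₁⟩ := (isCompact_Icc (a := l) (b := r)).exists_bound_of_continuousOn
    hF.continuousOn
  obtain ⟨B₂, hB₂⟩ := (isCompact_Icc (a := l) (b := r)).exists_bound_of_continuousOn
    hq.continuousOn
  have hc : Continuous fun x : ℝ => max l (min r x) := by fun_prop
  have hmem : ∀ x, max l (min r x) ∈ Icc l r := fun x =>
    ⟨le_max_left _ _, max_le hlr (min_le_left _ _)⟩
  have hid : ∀ x ∈ Icc l r, max l (min r x) = x := fun x hx => by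
    rw [min_eq_right hx.2, max_eq_right hx.1]
  refine ⟨fun x => F (max l (min r x)), fun x => q (max l (min r x)), max B₁ B₂,
    hF.comp hc, hq.comp hc, fun x => (hB₁ _ (hmem x)).trans (le_max_left _ _),
    fun x => (hB₂ _ (hmem x)).trans (le_max_right _ _), fun x hx => ?_, fun x hx => ?_,
    fun x => ⟨_, hmem x, rfl⟩⟩
  · simp only [hid x hx]
  · simp only [hid x hx]

theorem WEData.exists_isIntSol_gt {T : ℝ} {φ ψ a e : ℝ → ℝ} {abar A : ℝ}
    (h : WEData T φ ψ a e abar A) {F q : ℝ → ℝ} (hF : Continuous F) (hq : Continuous q)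
    {Qm w : ℝ} (hQm : ∀ x, q x ≤ Qm) (hw : ∀ C, 0 ≤ C → ∃ p, ∀ x ∈ Icc p (p + C), w < q x) :
    ∃ s d u, abar * w < s ∧ IsIntSol T ψ F q a e s d u := by
  obtain ⟨C, hC0, hC⟩ := h.exists_oscillation_bound (abar * w) Qm
  obtain ⟨p, hp⟩ := hw C hC0
  have hpC : p ≤ p + C := by linarith
  obtain ⟨F', Q', B, hF', hQ', hFB, hQB, hFeq, hQeq, hQz⟩ := exists_truncation hF hq hpC
  obtain ⟨x₀, hx₀, hmin⟩ := (isCompact_Icc (a := p) (b := p + C)).exists_isMinOn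
    (nonempty_Icc.2 hpC) hq.continuousOn
  obtain ⟨u, s, d, c, hu, hge, ⟨t₀, ht₀, htt⟩, hc⟩ := h.exists_isIntSol_of_level hF' hQ' hFB hQB
    (α := fun _ => 0) continuousOn_const (le_refl p) 0 0
  have hcp : c = p := by simpa using hc
  subst hcp
  have hs : abar * q x₀ ≤ s := hu.mul_le_of_forall_le h hQ' fun t _ => by
    obtain ⟨z, hz, hzq⟩ := hQz (u t)
    rw [hzq]
    exact hmin hz
  have hws : abar * w < s := lt_of_lt_of_le (mul_lt_mul_of_pos_left (hp x₀ hx₀) h.abar_pos) hs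
  have hosc := hC F' Q' hF' hQ' (fun x => by
    obtain ⟨z, -, hz⟩ := hQz x
    rw [hz]
    exact hQm z) s d u hws.le hu
  have hmem : ∀ t ∈ Icc 0 T, u t ∈ Icc c (c + C) := fun t ht => by
    have h1 := hge t ht
    have h2 := hosc t ht t₀ ht₀
    constructor <;> linarith
  exact ⟨s, d, u, hws, hu.congr h.pos.le (fun _ _ => rfl)
    (fun t ht => (hFeq _ (hmem t ht)).symm) (fun t ht => (hQeq _ (hmem t ht)).symm)⟩

/-- If a solution exists at some level above the values of `q` near infinity, then there is one with
the greatest parameter. -/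
theorem WEData.exists_maximal {T : ℝ} {φ ψ a e : ℝ → ℝ} {abar A : ℝ}
    (h : WEData T φ ψ a e abar A) {F q : ℝ → ℝ} (hF : Continuous F) (hq : Continuous q)
    {Qm η ρ s₁ : ℝ} (hQm : ∀ x, q x ≤ Qm) (hρ : ∀ x, ρ ≤ |x| → q x ≤ η) (hη : abar * η < s₁)
    (hex : ∃ d u, IsIntSol T ψ F q a e s₁ d u) :
    ∃ s₀ d₀ α, s₁ ≤ s₀ ∧ IsIntSol T ψ F q a e s₀ d₀ α ∧
      ∀ s d u, IsIntSol T ψ F q a e s d u → s ≤ s₀ := by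
  obtain ⟨C, hC0, hC⟩ := h.exists_oscillation_bound s₁ Qm
  set R := |ρ| + C with hR
  have hR0 : -R ≤ R := by
    have : 0 ≤ R := by positivity
    linarith
  have hbd : ∀ s d u, s₁ ≤ s → IsIntSol T ψ F q a e s d u → ∀ t ∈ Icc 0 T, |u t| ≤ R := by
    intro s d u hs hu t ht
    have hosc := hC F q hF hq hQm s d u hs hu
    obtain ⟨t₁, ht₁, hlt⟩ : ∃ t ∈ Icc 0 T, |u t| < ρ := by
      by_contra hcon
      push Not at hcon
      have := hu.le_mul_of_forall_le h hq fun t ht => hρ _ (hcon t ht)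
      linarith
    have h1 := hosc t ht t₁ ht₁
    have h2 := hosc t₁ ht₁ t ht
    have h3 := abs_lt.1 hlt
    rw [abs_le]
    constructor <;> linarith [le_abs_self ρ]
  obtain ⟨F', Q', B, hF', hQ', hFB, hQB, hFeq, hQeq, -⟩ := exists_truncation hF hq hR0
  have htrunc : ∀ s d u, IsIntSol T ψ F q a e s d u → (∀ t ∈ Icc 0 T, |u t| ≤ R) →
      IsIntSol T ψ F' Q' a e s d u := fun s d u hu hb => hu.congr h.pos.le (fun _ _ => rfl)
    (fun t ht => hFeq _ (abs_le.1 (hb t ht))) (fun t ht => hQeq _ (abs_le.1 (hb t ht)))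
  obtain ⟨d₁, u₁, hu₁⟩ := hex
  have hmem₁ : s₁ ∈ {s | ∃ d u, IsIntSol T ψ F' Q' a e s d u ∧ ∀ t ∈ Icc 0 T, |u t| ≤ R} :=
    ⟨d₁, u₁, htrunc _ _ _ hu₁ (hbd _ _ _ le_rfl hu₁), hbd _ _ _ le_rfl hu₁⟩
  obtain ⟨s₀, ⟨d₀, α, hα, hαR⟩, hub⟩ := h.exists_isGreatest hF' hQ' hFB hQB R ⟨_, hmem₁⟩
  refine ⟨s₀, d₀, α, hub hmem₁, hα.congr h.pos.le (fun _ _ => rfl)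
    (fun t ht => (hFeq _ (abs_le.1 (hαR t ht))).symm)
    (fun t ht => (hQeq _ (abs_le.1 (hαR t ht))).symm), fun s d u hu => ?_⟩
  by_contra hlt
  push Not at hlt
  have hs : s₁ ≤ s := (hub hmem₁).trans hlt.le
  exact absurd (hub ⟨d, u, htrunc _ _ _ hu (hbd _ _ _ hs hu), hbd _ _ _ hs hu⟩) (not_le.2 hlt)

/-- The clipped level problem relative to a solution `α`, with the truncation removed whenever the
parameter is at least `s`. -/
theorem WEData.exists_level_relative {T : ℝ} {φ ψ a e : ℝ → ℝ} {abar A : ℝ}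
    (h : WEData T φ ψ a e abar A) {F q : ℝ → ℝ} (hF : Differentiable ℝ F) (hq : Continuous q)
    {Qm : ℝ} (hQm : ∀ x, q x ≤ Qm) {s₀ d₀ : ℝ} {α : ℝ → ℝ}
    (hα : IsIntSol T ψ F q a e s₀ d₀ α) (s : ℝ) :
    ∃ C, 0 ≤ C ∧ ∀ c₁ c₂, c₁ ≤ c₂ → ∀ σ : ℝ, ∃ (u : ℝ → ℝ) (s' d c : ℝ),
      (∀ t ∈ Icc 0 T, α t + c ≤ u t) ∧ (∃ t ∈ Icc 0 T, u t = α t + c) ∧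
      c = max c₁ (min c₂ (c + σ * (s - s'))) ∧ (c = 0 → s₀ ≤ s') ∧
      (s ≤ s' → IsIntSol T ψ F q a e s' d u ∧
        ∀ t ∈ Icc 0 T, ∀ t' ∈ Icc 0 T, u t ≤ u t' + C) := by
  obtain ⟨C, hC0, hC⟩ := h.exists_oscillation_bound s Qm
  refine ⟨C, hC0, fun c₁ c₂ hc σ => ?_⟩
  obtain ⟨M, hM⟩ := (isCompact_Icc (a := (0 : ℝ)) (b := T)).exists_bound_of_continuousOn
    hα.continuousOn
  have hM0 : 0 ≤ M := (norm_nonneg _).trans (hM 0 (left_mem_Icc.2 h.pos.le))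
  set R := M + (|c₁| + |c₂|) + C + 1 with hR
  have hMR : M < R := by linarith [abs_nonneg c₁, abs_nonneg c₂]
  obtain ⟨F', Q', B, hF', hQ', hFB, hQB, hFeq, hQeq, hQz⟩ :=
    exists_truncation hF.continuous hq (by linarith : -R ≤ R)
  obtain ⟨u, s', d, c, hu, hge, ⟨t₀, ht₀, htt⟩, hceq⟩ := h.exists_isIntSol_of_level hF' hQ' hFB hQB
    hα.continuousOn hc σ s
  have hαR : ∀ t ∈ Icc 0 T, α t ∈ Ioo (-R) R := fun t ht => by
    have := abs_le.1 (hM t ht)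
    constructor <;> linarith [this.1, this.2]
  refine ⟨u, s', d, c, hge, ⟨t₀, ht₀, htt⟩, hceq, fun hc0 => ?_, fun hs => ?_⟩
  · subst hc0
    have hα' : IsIntSol T ψ F' Q' a e s₀ d₀ α := hα.congr h.pos.le (fun _ _ => rfl)
      (fun t ht => hFeq _ (Ioo_subset_Icc_self (hαR t ht)))
      (fun t ht => hQeq _ (Ioo_subset_Icc_self (hαR t ht)))
    refine hα'.le_of_touch h hQ' (fun t ht => ?_) hu (fun t ht => ?_) ⟨t₀, ht₀, ?_⟩
    · refine (hF (α t)).congr_of_eventuallyEq ?_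
      filter_upwards [Ioo_mem_nhds (hαR t ht).1 (hαR t ht).2] with x hx
      exact hFeq x (Ioo_subset_Icc_self hx)
    · simpa using hge t ht
    · simpa using htt
  · have hosc := hC F' Q' hF' hQ' (fun x => by
      obtain ⟨z, -, hz⟩ := hQz x
      rw [hz]
      exact hQm z) s' d u hs hu
    have hc1 : c₁ ≤ c := hceq ▸ le_max_left _ _
    have hc2 : c ≤ c₂ := by
      rw [hceq]
      exact max_le hc (min_le_left _ _)
    have hmem : ∀ t ∈ Icc 0 T, u t ∈ Icc (-R) R := fun t ht => by
      have h1 := hge t ht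
      have h2 := hosc t ht t₀ ht₀
      have h3 := abs_le.1 (hM t ht)
      have h4 := abs_le.1 (hM t₀ ht₀)
      constructor <;>
        linarith [h3.1, h4.2, neg_abs_le c₁, le_abs_self c₂, abs_nonneg c₁, abs_nonneg c₂]
    exact ⟨hu.congr h.pos.le (fun _ _ => rfl) (fun t ht => (hFeq _ (hmem t ht)).symm)
      (fun t ht => (hQeq _ (hmem t ht)).symm), hosc⟩

theorem WEData.exists_isIntSol_below {T : ℝ} {φ ψ a e : ℝ → ℝ} {abar A : ℝ}
    (h : WEData T φ ψ a e abar A) {F q : ℝ → ℝ} (hF : Differentiable ℝ F) (hq : Continuous q)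
    {Qm : ℝ} (hQm : ∀ x, q x ≤ Qm) {s₀ d₀ : ℝ} {α : ℝ → ℝ}
    (hα : IsIntSol T ψ F q a e s₀ d₀ α) {s ρ : ℝ} (hs : s < s₀)
    (hρ : ∀ x ≤ ρ, q x ≤ s / abar) :
    ∃ d u, IsIntSol T ψ F q a e s d u ∧ ∃ t ∈ Icc 0 T, u t < α t := by
  obtain ⟨C, hC0, hC⟩ := h.exists_level_relative hF hq hQm hα s
  obtain ⟨M, hM⟩ := (isCompact_Icc (a := (0 : ℝ)) (b := T)).exists_bound_of_continuousOn
    hα.continuousOn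
  have hM0 : 0 ≤ M := (norm_nonneg _).trans (hM 0 (left_mem_Icc.2 h.pos.le))
  have hN : 0 ≤ M + C + |ρ| := by positivity
  obtain ⟨u, s', d, c, hge, ⟨t₀, ht₀, htt⟩, hceq, hzero, hsol⟩ :=
    hC (-(M + C + |ρ|)) 0 (by linarith) 1
  set N := M + C + |ρ| with hNdef
  have hc0 : c ≤ 0 := by
    rw [hceq]
    exact max_le (by linarith) (min_le_left _ _)
  rcases lt_trichotomy s' s with hlt | heq | hgt
  · exfalso
    have hcz : c = 0 := by
      by_contra hne
      have hneg : c < 0 := lt_of_le_of_ne hc0 hne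
      have : c < min 0 (c + 1 * (s - s')) := lt_min hneg (by linarith)
      have h2 := le_max_right (-N) (min 0 (c + 1 * (s - s')))
      linarith
    linarith [hzero hcz]
  · subst heq
    refine ⟨d, u, (hsol le_rfl).1, t₀, ht₀, ?_⟩
    have hneg : c < 0 := lt_of_le_of_ne hc0 fun hcz => by linarith [hzero hcz]
    linarith
  · exfalso
    have hcN : c = -N := by
      rcases max_choice (-N) (min 0 (c + 1 * (s - s'))) with hm | hm
      · rw [hceq, hm]
      · have := min_le_right 0 (c + 1 * (s - s'))
        linarith
    obtain ⟨hu, hosc⟩ := hsol hgt.le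
    have hle := hu.le_mul_of_forall_le h hq (η := s / abar) fun t ht => hρ _ (by
      have h1 := hosc t ht t₀ ht₀
      have h2 := (abs_le.1 (hM t₀ ht₀)).2
      linarith [neg_abs_le ρ])
    rw [mul_div_cancel₀ _ h.abar_pos.ne'] at hle
    linarith

theorem WEData.exists_isIntSol_above {T : ℝ} {φ ψ a e : ℝ → ℝ} {abar A : ℝ}
    (h : WEData T φ ψ a e abar A) {F q : ℝ → ℝ} (hF : Differentiable ℝ F) (hq : Continuous q)
    {Qm : ℝ} (hQm : ∀ x, q x ≤ Qm) {s₀ d₀ : ℝ} {α : ℝ → ℝ}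
    (hα : IsIntSol T ψ F q a e s₀ d₀ α) {s ρ : ℝ} (hs : s < s₀)
    (hρ : ∀ x, ρ ≤ x → q x ≤ s / abar) :
    ∃ d u, IsIntSol T ψ F q a e s d u ∧ ∀ t ∈ Icc 0 T, α t < u t := by
  obtain ⟨C, hC0, hC⟩ := h.exists_level_relative hF hq hQm hα s
  obtain ⟨M, hM⟩ := (isCompact_Icc (a := (0 : ℝ)) (b := T)).exists_bound_of_continuousOn
    hα.continuousOn
  have hM0 : 0 ≤ M := (norm_nonneg _).trans (hM 0 (left_mem_Icc.2 h.pos.le))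
  have hN : 0 ≤ M + |ρ| := by positivity
  obtain ⟨u, s', d, c, hge, ⟨t₀, ht₀, htt⟩, hceq, hzero, hsol⟩ := hC 0 (M + |ρ|) hN (-1)
  set N := M + |ρ| with hNdef
  have hc0 : 0 ≤ c := hceq ▸ le_max_left _ _
  rcases lt_trichotomy s' s with hlt | heq | hgt
  · exfalso
    have hcz : c = 0 := by
      rcases max_choice 0 (min N (c + -1 * (s - s'))) with hm | hm
      · rw [hceq, hm]
      · have := min_le_right N (c + -1 * (s - s'))
        linarith
    linarith [hzero hcz]
  · subst heq
    refine ⟨d, u, (hsol le_rfl).1, fun t ht => ?_⟩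
    have hpos : 0 < c := lt_of_le_of_ne hc0 fun hcz => by linarith [hzero hcz.symm]
    linarith [hge t ht]
  · exfalso
    have hcN : N ≤ c := by
      by_contra hne
      push Not at hne
      have : c < min N (c + -1 * (s - s')) := lt_min hne (by linarith)
      have h2 := le_max_right 0 (min N (c + -1 * (s - s')))
      linarith
    obtain ⟨hu, -⟩ := hsol hgt.le
    have hle := hu.le_mul_of_forall_le h hq (η := s / abar) fun t ht => hρ _ (by
      have h1 := hge t ht
      have h2 := (abs_le.1 (hM t ht)).1
      linarith [le_abs_self ρ])
    rw [mul_div_cancel₀ _ h.abar_pos.ne'] at hle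
    linarith

theorem EReal.coe_mul_lt_coe_iff {b : ℝ} (hb : 0 < b) (ω : EReal) (s : ℝ) :
    (b : EReal) * ω < (s : EReal) ↔ ω < ((s / b : ℝ) : EReal) := by
  induction ω with
  | bot => simp [EReal.coe_mul_bot_of_pos hb]
  | top => simp [EReal.coe_mul_top_of_pos hb]
  | coe x => rw [← EReal.coe_mul, EReal.coe_lt_coe_iff, EReal.coe_lt_coe_iff, lt_div_iff₀' hb]

theorem exists_forall_le_of_tendsto_atBot {q : ℝ → ℝ} {ω : EReal} {η : ℝ}
    (h : Tendsto (fun u : ℝ => ((q u : ℝ) : EReal)) atBot (nhds ω)) (hω : ω < (η : EReal)) :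
    ∃ ρ, ∀ x ≤ ρ, q x ≤ η := by
  obtain ⟨ρ, hρ⟩ := eventually_atBot.1 (h.eventually (gt_mem_nhds hω))
  exact ⟨ρ, fun x hx => (EReal.coe_lt_coe_iff.1 (hρ x hx)).le⟩

theorem exists_forall_le_of_tendsto_atTop {q : ℝ → ℝ} {ω : EReal} {η : ℝ}
    (h : Tendsto (fun u : ℝ => ((q u : ℝ) : EReal)) atTop (nhds ω)) (hω : ω < (η : EReal)) :
    ∃ ρ, ∀ x, ρ ≤ x → q x ≤ η := by
  obtain ⟨ρ, hρ⟩ := eventually_atTop.1 (h.eventually (gt_mem_nhds hω))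
  exact ⟨ρ, fun x hx => (EReal.coe_lt_coe_iff.1 (hρ x hx)).le⟩

theorem exists_forall_le_of_tendsto {q : ℝ → ℝ} (hq : Continuous q) {ωm ωp : EReal} {η : ℝ}
    (hbot : Tendsto (fun u : ℝ => ((q u : ℝ) : EReal)) atBot (nhds ωm))
    (htop : Tendsto (fun u : ℝ => ((q u : ℝ) : EReal)) atTop (nhds ωp))
    (hη : max ωm ωp < (η : EReal)) :
    (∃ ρ, ∀ x, ρ ≤ |x| → q x ≤ η) ∧ ∃ Qm, ∀ x, q x ≤ Qm := by
  obtain ⟨ρ₁, h₁⟩ := exists_forall_le_of_tendsto_atBot hbot ((le_max_left _ _).trans_lt hη)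
  obtain ⟨ρ₂, h₂⟩ := exists_forall_le_of_tendsto_atTop htop ((le_max_right _ _).trans_lt hη)
  have hρ : ∀ x, max (-ρ₁) ρ₂ ≤ |x| → q x ≤ η := by
    intro x hx
    rcases le_total 0 x with h0 | h0
    · rw [abs_of_nonneg h0] at hx
      exact h₂ x ((le_max_right _ _).trans hx)
    · rw [abs_of_nonpos h0] at hx
      exact h₁ x (by linarith [(le_max_left (-ρ₁) ρ₂).trans hx])
  refine ⟨⟨_, hρ⟩, ?_⟩
  set ρ := max (-ρ₁) ρ₂
  obtain ⟨B, hB⟩ := (isCompact_Icc (a := -ρ) (b := ρ)).exists_bound_of_continuousOn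
    hq.continuousOn
  refine ⟨max η B, fun x => ?_⟩
  rcases le_total ρ |x| with hx | hx
  · exact (hρ x hx).trans (le_max_left _ _)
  · exact (le_abs_self _).trans ((hB x (abs_le.1 hx)).trans (le_max_right _ _))

/-- Theorem for type-II nonlinearities with limits `ω₋, ω₊` in the extended reals:
if `q(u) > ω₋` for `u ≤ −D`, `q(u) > ω₊` for `u ≥ D`, and `max{ω₋,ω₊} > −∞`, then
there is `s₀ > ā·ω₋` realizing the zero/one/two alternative described below. -/
theorem statement17
    (T : ℝ) (hT : 0 < T)
    (φ f q a e : ℝ → ℝ)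
    (hφmono : StrictMono φ) (hφcont : Continuous φ)
    (hφsurj : Function.Surjective φ) (hφ0 : φ 0 = 0)
    (hf : Continuous f) (hq : Continuous q)
    (ha_meas : Measurable a) (ha_bdd : ∃ C : ℝ, ∀ᵐ t ∂(muT T), |a t| ≤ C)
    (ha_nonneg : ∀ᵐ t ∂(muT T), 0 ≤ a t)
    (abar : ℝ) (habar_def : (1 / T) * ∫ t in Icc (0:ℝ) T, a t = abar)
    (habar_pos : 0 < abar)
    (he_meas : Measurable e) (he_bdd : ∃ C : ℝ, ∀ᵐ t ∂(muT T), |e t| ≤ C)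
    (he_mean : (1 / T) * ∫ t in Icc (0:ℝ) T, e t = 0)
    (ωm ωp : EReal)
    (hq_bot : Tendsto (fun u : ℝ => ((q u : ℝ) : EReal)) atBot (nhds ωm))
    (hq_top : Tendsto (fun u : ℝ => ((q u : ℝ) : EReal)) atTop (nhds ωp))
    (hD : ∃ D : ℝ, 0 < D ∧ (∀ u : ℝ, u ≤ -D → ωm < ((q u : ℝ) : EReal)) ∧
      ∀ u : ℝ, D ≤ u → ωp < ((q u : ℝ) : EReal))
    (hmax : ⊥ < max ωm ωp) :
    ∃ s₀ : ℝ, (abar : EReal) * ωm < ((s₀ : ℝ) : EReal) ∧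
      (∀ s : ℝ, s₀ < s → ¬∃ u : ℝ → ℝ, IsSolWE T φ f q a e s u) ∧
      (∃ u : ℝ → ℝ, IsSolWE T φ f q a e s₀ u) ∧
      (∀ s : ℝ, (abar : EReal) * ωm < ((s : ℝ) : EReal) → s < s₀ →
        ∃ u : ℝ → ℝ, IsSolWE T φ f q a e s u) ∧
      (∀ s : ℝ, (abar : EReal) * max ωm ωp < ((s : ℝ) : EReal) → s < s₀ →
        ∃ u₁ u₂ : ℝ → ℝ, IsSolWE T φ f q a e s u₁ ∧ IsSolWE T φ f q a e s u₂ ∧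
          ∃ t ∈ Icc (0:ℝ) T, u₁ t ≠ u₂ t) := by
  obtain ⟨ψ, A, h⟩ := exists_weData hT hφmono hφsurj hφ0 ha_meas ha_bdd ha_nonneg habar_def
    habar_pos he_meas he_bdd he_mean
  obtain ⟨D, -, hDm, hDp⟩ := hD
  let F : ℝ → ℝ := fun x => ∫ y in (0 : ℝ)..x, f y
  have hF : ∀ x, HasDerivAt F (f x) x := fun x => (hf.integral_hasStrictDerivAt 0 x).hasDerivAt
  have hFd : Differentiable ℝ F := fun x => (hF x).differentiableAt
  have hmax_top : max ωm ωp < ⊤ := max_lt ((hDm (-D) le_rfl).trans (EReal.coe_lt_top _))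
    ((hDp D le_rfl).trans (EReal.coe_lt_top _))
  obtain ⟨w, hw⟩ : ∃ w : ℝ, max ωm ωp = (w : EReal) :=
    ⟨_, (EReal.coe_toReal hmax_top.ne hmax.ne').symm⟩
  have hww : max ωm ωp < ((w + 1 : ℝ) : EReal) := by
    rw [hw, EReal.coe_lt_coe_iff]
    linarith
  obtain ⟨-, Qm, hQm⟩ := exists_forall_le_of_tendsto hq hq_bot hq_top hww
  have hplateau : ∀ C, 0 ≤ C → ∃ p, ∀ x ∈ Icc p (p + C), w < q x := by
    intro C hC
    rcases max_choice ωm ωp with hm | hm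
    · refine ⟨-D - C, fun x hx => ?_⟩
      rw [← EReal.coe_lt_coe_iff, ← hw, hm]
      exact hDm x (by linarith [hx.2])
    · refine ⟨D, fun x hx => ?_⟩
      rw [← EReal.coe_lt_coe_iff, ← hw, hm]
      exact hDp x hx.1
  obtain ⟨s₁, d₁, u₁, hs₁, hu₁⟩ := h.exists_isIntSol_gt hFd.continuous hq hQm hplateau
  obtain ⟨η, hwη, hηs⟩ := exists_between ((lt_div_iff₀' habar_pos).2 hs₁)
  have hη : max ωm ωp < (η : EReal) := by rwa [hw, EReal.coe_lt_coe_iff]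
  obtain ⟨⟨ρ, hρ⟩, -⟩ := exists_forall_le_of_tendsto hq hq_bot hq_top hη
  obtain ⟨s₀, d₀, α, hs₀, hα, hub⟩ := h.exists_maximal hFd.continuous hq hQm hρ
    ((lt_div_iff₀' habar_pos).1 hηs) ⟨d₁, u₁, hu₁⟩
  have hbelow : ∀ s : ℝ, (abar : EReal) * ωm < ((s : ℝ) : EReal) → s < s₀ →
      ∃ d u, IsIntSol T ψ F q a e s d u ∧ ∃ t ∈ Icc 0 T, u t < α t := by
    intro s hs hlt
    obtain ⟨ρ, hρ⟩ := exists_forall_le_of_tendsto_atBot hq_bot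
      ((EReal.coe_mul_lt_coe_iff habar_pos _ _).1 hs)
    exact h.exists_isIntSol_below hFd hq hQm hα hlt hρ
  refine ⟨s₀, ?_, ?_, ⟨α, hα.isSolWE h hf hF hq⟩, ?_, ?_⟩
  · rw [EReal.coe_mul_lt_coe_iff habar_pos]
    refine (le_max_left _ _).trans_lt (hη.trans ?_)
    rw [EReal.coe_lt_coe_iff]
    exact hηs.trans_le (div_le_div_of_nonneg_right hs₀ habar_pos.le)
  · rintro s hs ⟨u, hu⟩
    obtain ⟨d, hd⟩ := hu.exists_isIntSol h hf hF hq
    exact absurd (hub s d u hd) (not_le.2 hs)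
  · intro s hs hlt
    obtain ⟨d, u, hu, -⟩ := hbelow s hs hlt
    exact ⟨u, hu.isSolWE h hf hF hq⟩
  · intro s hs hlt
    rw [EReal.coe_mul_lt_coe_iff habar_pos] at hs
    obtain ⟨d, u, hu, t, ht, hut⟩ := hbelow s
      ((EReal.coe_mul_lt_coe_iff habar_pos _ _).2 ((le_max_left _ _).trans_lt hs)) hlt
    obtain ⟨ρ, hρ⟩ := exists_forall_le_of_tendsto_atTop hq_top ((le_max_right _ _).trans_lt hs)
    obtain ⟨d', v, hv, hαv⟩ := h.exists_isIntSol_above hFd hq hQm hα hlt hρ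
    exact ⟨u, v, hu.isSolWE h hf hF hq, hv.isSolWE h hf hF hq, t, ht,
      (hut.trans (hαv t ht)).ne⟩
end
end

section
/- Assume: (G₁) there exists C₀ > 0 such that G(r,u) ≥ −C₀ for all u ∈ ℝ and all r ∈ [R_i,R_e]; (G₂) there exist u₀, g₀ ∈ ℝ such that G(r,u₀) ≤ g₀ for all r ∈ [R_i,R_e]; (G₃) for each σ ∈ ℝ there exists d_σ > 0 such that ∫_{R_i}^{R_e} r^{N−1} G(r,v(r)) dr > σ·∫_{R_i}^{R_e} r^{N−1} dr for every v ∈ C⁰([R_i,R_e]) ∩ C¹((R_i,R_e)) with v(r) ≤ −d_σ for all r; (G₄) for each σ ∈ ℝ there exists d_σ > 0 such that the same integral inequality holds for every v ∈ C⁰([R_i,R_e]) ∩ C¹((R_i,R_e)) with v(r) ≥ d_σ for all r. Then there exists s₀ ∈ ℝ such that: for s < s₀ the problem has no radially symmetric solutions; for s = s₀ it has at least one radially symmetric solution; and for s > s₀ it has at least two radially symmetric solutions. -/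
open MeasureTheory Set Filter

noncomputable section

/-- `v : [R_i,R_e] → ℝ` is the radial profile of a radially symmetric solution
`u(x) = v(|x|)` of the Neumann problem `∇·(A(|∇u|)∇u) + G(|x|,u) = s` on the annulus,
with `∂u/∂ν = 0` on the boundary: `v` is `C¹` on `[R_i,R_e]`, `v'(R_i) = v'(R_e) = 0`,
`r ↦ r^(N−1) φ(v'(r))` is absolutely continuous (the indefinite integral of an integrable
`w`), and `(r^(N−1) φ(v'))' + r^(N−1) G(r,v) = r^(N−1) s` a.e. on `[R_i,R_e]`. -/
def IsRadialSol (N : ℕ) (Ri Re : ℝ) (φ : ℝ → ℝ) (G : ℝ → ℝ → ℝ) (s : ℝ)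
    (v : ℝ → ℝ) : Prop :=
  ∃ v' w : ℝ → ℝ,
    (∀ r ∈ Icc Ri Re, HasDerivWithinAt v (v' r) (Icc Ri Re) r) ∧
    ContinuousOn v' (Icc Ri Re) ∧ v' Ri = 0 ∧ v' Re = 0 ∧
    IntegrableOn w (Icc Ri Re) ∧
    (∀ r ∈ Icc Ri Re,
      r ^ (N - 1) * φ (v' r) = Ri ^ (N - 1) * φ (v' Ri) + ∫ τ in Ri..r, w τ) ∧
    ∀ᵐ r ∂(volume.restrict (Icc Ri Re)),
      w r + r ^ (N - 1) * G r (v r) = r ^ (N - 1) * s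

/-- The slope at `t` of the Neumann profile driven by the source `q`, for the weight `P` and the
inverse `ψ` of the nonlinearity. -/
def profileDeriv (P ψ : ℝ → ℝ) (a : ℝ) (q : ℝ → ℝ) (t : ℝ) : ℝ :=
  ψ ((P t)⁻¹ * ∫ τ in a..t, P τ * q τ)

/-- The solution of `(P · ψ⁻¹(v'))' = P q` with `v a = x` and `v' a = 0`. -/
def profile (P ψ : ℝ → ℝ) (a x : ℝ) (q : ℝ → ℝ) (r : ℝ) : ℝ :=
  x + ∫ t in a..r, profileDeriv P ψ a q t

section Profile

variable {P ψ : ℝ → ℝ} {a b : ℝ}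

lemma profileDeriv_congr {q q' : ℝ → ℝ} {t : ℝ} (hat : a ≤ t) (h : ∀ τ ∈ Icc a t, q τ = q' τ) :
    profileDeriv P ψ a q t = profileDeriv P ψ a q' t := by
  unfold profileDeriv
  congr 2
  refine intervalIntegral.integral_congr fun τ hτ => ?_
  rw [uIcc_of_le hat] at hτ
  simp only [h τ hτ]

lemma profile_congr {q q' : ℝ → ℝ} {x r : ℝ} (har : a ≤ r) (h : ∀ τ ∈ Icc a r, q τ = q' τ) :
    profile P ψ a x q r = profile P ψ a x q' r := by
  unfold profile
  congr 1
  refine intervalIntegral.integral_congr fun t ht => ?_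
  rw [uIcc_of_le har] at ht
  exact profileDeriv_congr ht.1 fun τ hτ => h τ ⟨hτ.1, hτ.2.trans ht.2⟩

@[simp] lemma profile_left (x : ℝ) (q : ℝ → ℝ) : profile P ψ a x q a = x := by
  simp [profile]

lemma continuous_profileDeriv_param {X : Type*} [TopologicalSpace X] (hP : Continuous P)
    (hP0 : ∀ t, 0 < P t) (hψ : Continuous ψ) {q : X → ℝ → ℝ}
    (hq : Continuous (Function.uncurry q)) :
    Continuous fun z : X × ℝ => profileDeriv P ψ a (q z.1) z.2 := by
  have h1 : Continuous fun z : X × ℝ => ∫ τ in a..z.2, P τ * q z.1 τ := by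
    refine intervalIntegral.continuous_parametric_intervalIntegral_of_continuous
      (f := fun (z : X × ℝ) τ => P τ * q z.1 τ) ?_ continuous_snd
    have : Continuous fun z : (X × ℝ) × ℝ => q z.1.1 z.2 :=
      hq.comp ((continuous_fst.comp continuous_fst).prodMk continuous_snd)
    exact (hP.comp continuous_snd).mul this
  exact hψ.comp (((hP.comp continuous_snd).inv₀ fun z => (hP0 _).ne').mul h1)

lemma continuous_profile_param {X : Type*} [TopologicalSpace X] (hP : Continuous P)
    (hP0 : ∀ t, 0 < P t) (hψ : Continuous ψ) {q : X → ℝ → ℝ}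
    (hq : Continuous (Function.uncurry q)) {x : X → ℝ} (hx : Continuous x) :
    Continuous fun z : X × ℝ => profile P ψ a (x z.1) (q z.1) z.2 := by
  refine (hx.comp continuous_fst).add ?_
  refine intervalIntegral.continuous_parametric_intervalIntegral_of_continuous
    (f := fun (z : X × ℝ) t => profileDeriv P ψ a (q z.1) t) ?_ continuous_snd
  exact (continuous_profileDeriv_param hP hP0 hψ hq).comp
    ((continuous_fst.comp continuous_fst).prodMk continuous_snd)

lemma continuous_profileDeriv (hP : Continuous P) (hP0 : ∀ t, 0 < P t) (hψ : Continuous ψ)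
    {q : ℝ → ℝ} (hq : Continuous q) : Continuous (profileDeriv P ψ a q) :=
  (continuous_profileDeriv_param (X := Unit) (q := fun _ => q) hP hP0 hψ
    (hq.comp continuous_snd)).comp (continuous_const (y := ()) |>.prodMk continuous_id)

/-- Iterates of the delayed integral equation. -/
def delayIter (P ψ : ℝ → ℝ) (a ε : ℝ) (h : ℝ → ℝ → ℝ) : ℕ → ℝ → ℝ → ℝ
  | 0, x => fun _ => x
  | k + 1, x => profile P ψ a x fun τ => h τ (delayIter P ψ a ε h k x (max a (τ - ε)))

lemma continuous_delayIter (hP : Continuous P) (hP0 : ∀ t, 0 < P t) (hψ : Continuous ψ)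
    {h : ℝ → ℝ → ℝ} (hh : Continuous (Function.uncurry h)) (ε : ℝ) (k : ℕ) :
    Continuous (Function.uncurry (delayIter P ψ a ε h k)) := by
  induction k with
  | zero => exact continuous_fst
  | succ k ih =>
    refine continuous_profile_param hP hP0 hψ
      (q := fun x τ => h τ (delayIter P ψ a ε h k x (max a (τ - ε)))) ?_ continuous_id
    have h2 : Continuous fun z : ℝ × ℝ => delayIter P ψ a ε h k z.1 (max a (z.2 - ε)) :=
      ih.comp (f := fun z : ℝ × ℝ => (z.1, max a (z.2 - ε))) (by fun_prop)
    exact hh.comp (continuous_snd.prodMk h2)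

lemma delayIter_succ_eq {h : ℝ → ℝ → ℝ} {ε : ℝ} (hε : 0 < ε) (x : ℝ) (k : ℕ) :
    ∀ r ∈ Icc a (a + k * ε), delayIter P ψ a ε h (k + 1) x r = delayIter P ψ a ε h k x r := by
  induction k with
  | zero =>
    intro r hr
    obtain rfl : r = a := le_antisymm (by simpa using hr.2) hr.1
    simp [delayIter]
  | succ k ih =>
    intro r hr
    refine profile_congr hr.1 fun τ hτ => ?_
    rw [ih]
    have := hr.2
    push_cast at this
    refine ⟨le_max_left _ _, max_le (by nlinarith [k.cast_nonneg (α := ℝ)]) ?_⟩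
    linarith [hτ.2]

/-- Global solvability of the delayed initial value problem, continuously in the initial value. -/
lemma exists_delay_solution (hP : Continuous P) (hP0 : ∀ t, 0 < P t) (hψ : Continuous ψ)
    {h : ℝ → ℝ → ℝ} (hh : Continuous (Function.uncurry h)) {ε : ℝ} (hε : 0 < ε) (b : ℝ) :
    ∃ V : ℝ → ℝ → ℝ, Continuous (Function.uncurry V) ∧ ∀ x, ∀ r ∈ Icc a b,
      V x r = profile P ψ a x (fun τ => h τ (V x (max a (τ - ε)))) r := by
  obtain ⟨n, hn⟩ := exists_nat_ge ((b - a) / ε)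
  rw [div_le_iff₀ hε] at hn
  refine ⟨delayIter P ψ a ε h n, continuous_delayIter hP hP0 hψ hh ε n, fun x r hr => ?_⟩
  exact (delayIter_succ_eq hε x n r ⟨hr.1, by linarith [hr.2]⟩).symm

lemma delay_solution_unique {h h' : ℝ → ℝ → ℝ} {ε : ℝ} (hε : 0 < ε) {x : ℝ} {v w : ℝ → ℝ}
    (hv : ∀ r ∈ Icc a b, v r = profile P ψ a x (fun τ => h τ (v (max a (τ - ε)))) r)
    (hw : ∀ r ∈ Icc a b, w r = profile P ψ a x (fun τ => h' τ (w (max a (τ - ε)))) r)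
    (hhh : ∀ τ ∈ Icc a b, h τ (w (max a (τ - ε))) = h' τ (w (max a (τ - ε)))) :
    ∀ r ∈ Icc a b, v r = w r := by
  have key : ∀ k : ℕ, ∀ r ∈ Icc a b, r ≤ a + k * ε → v r = w r := by
    intro k
    induction k with
    | zero =>
      intro r hr hk
      obtain rfl : r = a := le_antisymm (by simpa using hk) hr.1
      rw [hv _ hr, hw _ hr]; simp
    | succ k ih =>
      intro r hr hk
      rw [hv r hr, hw r hr]
      refine profile_congr hr.1 fun τ hτ => ?_
      push_cast at hk
      rw [← hhh τ ⟨hτ.1, hτ.2.trans hr.2⟩, ih]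
      · exact ⟨le_max_left _ _, max_le (hr.1.trans hr.2) (by linarith [hτ.2, hr.2])⟩
      · exact max_le (by nlinarith [k.cast_nonneg (α := ℝ)]) (by linarith [hτ.2])
  intro r hr
  obtain ⟨n, hn⟩ := exists_nat_ge ((b - a) / ε)
  rw [div_le_iff₀ hε] at hn
  exact key n r hr (by linarith [hr.2])

lemma exists_profileDeriv_bound (hP : Continuous P) (hP0 : ∀ t, 0 < P t) (hψ : Continuous ψ)
    (a b K : ℝ) : ∃ L, 0 ≤ L ∧ ∀ q : ℝ → ℝ, (∀ t ∈ Icc a b, |∫ τ in a..t, P τ * q τ| ≤ K) →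
      ∀ t ∈ Icc a b, |profileDeriv P ψ a q t| ≤ L := by
  have hc : Continuous fun z : ℝ × ℝ => ψ ((P z.1)⁻¹ * z.2) :=
    hψ.comp (((hP.comp continuous_fst).inv₀ fun z => (hP0 _).ne').mul continuous_snd)
  obtain ⟨L, hL⟩ := ((isCompact_Icc (a := a) (b := b)).prod
    (isCompact_Icc (a := -K) (b := K))).exists_bound_of_continuousOn hc.continuousOn
  refine ⟨max L 0, le_max_right _ _, fun q hq t ht => le_max_of_le_left ?_⟩
  exact hL (t, ∫ τ in a..t, P τ * q τ) ⟨ht, abs_le.1 (hq t ht)⟩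

lemma exists_profileDeriv_bound_of_source (hP : Continuous P) (hP0 : ∀ t, 0 < P t)
    (hψ : Continuous ψ) (a b H : ℝ) : ∃ L, 0 ≤ L ∧ ∀ q : ℝ → ℝ,
      (∀ t ∈ Icc a b, |q t| ≤ H) → ∀ t ∈ Icc a b, |profileDeriv P ψ a q t| ≤ L := by
  obtain ⟨C, hC⟩ := (isCompact_Icc (a := a) (b := b)).exists_bound_of_continuousOn
    hP.continuousOn
  obtain ⟨L, hL0, hL⟩ := exists_profileDeriv_bound hP hP0 hψ a b (C * H * (b - a))
  refine ⟨L, hL0, fun q hq => hL q fun t ht => ?_⟩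
  have hCH : ∀ τ ∈ Icc a b, ‖P τ * q τ‖ ≤ C * H := fun τ hτ => by
    rw [norm_mul]
    exact mul_le_mul (hC τ hτ) (hq τ hτ) (norm_nonneg _) ((norm_nonneg _).trans (hC τ hτ))
  have h1 := intervalIntegral.norm_integral_le_of_norm_le_const (a := a) (b := t)
    (f := fun τ => P τ * q τ) (C := C * H) fun τ hτ => by
      rw [uIoc_of_le ht.1] at hτ
      exact hCH τ ⟨hτ.1.le, hτ.2.trans ht.2⟩
  rw [abs_of_nonneg (sub_nonneg.2 ht.1)] at h1
  refine h1.trans (mul_le_mul_of_nonneg_left (by linarith [ht.2]) ?_)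
  exact (norm_nonneg _).trans (hCH t ht)

lemma profile_sub_profile (hP : Continuous P) (hP0 : ∀ t, 0 < P t) (hψ : Continuous ψ)
    {q : ℝ → ℝ} (hq : Continuous q) (x r r' : ℝ) :
    profile P ψ a x q r' - profile P ψ a x q r = ∫ t in r..r', profileDeriv P ψ a q t := by
  have hs := continuous_profileDeriv (a := a) hP hP0 hψ hq
  unfold profile
  rw [add_sub_add_left_eq_sub, intervalIntegral.integral_interval_sub_left
    (hs.intervalIntegrable _ _) (hs.intervalIntegrable _ _)]

lemma abs_profile_sub_le (hP : Continuous P) (hP0 : ∀ t, 0 < P t) (hψ : Continuous ψ)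
    {q : ℝ → ℝ} (hq : Continuous q) {L : ℝ} (hL : ∀ t ∈ Icc a b, |profileDeriv P ψ a q t| ≤ L) (x : ℝ)
    {r r' : ℝ} (hr : r ∈ Icc a b) (hr' : r' ∈ Icc a b) :
    |profile P ψ a x q r' - profile P ψ a x q r| ≤ L * |r' - r| := by
  rw [profile_sub_profile hP hP0 hψ hq]
  refine intervalIntegral.norm_integral_le_of_norm_le_const (f := profileDeriv P ψ a q)
    fun t ht => hL t ?_
  have := uIoc_subset_uIcc ht
  exact (Set.uIcc_subset_Icc hr hr') this

end Profile

section Neumann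

variable {P ψ : ℝ → ℝ} {a b : ℝ}

/-- `v` solves `(P · ψ⁻¹(v'))' = P q` on `[a, b]` with `v' a = v' b = 0`. -/
structure IsNeumannProfile (P ψ : ℝ → ℝ) (a b : ℝ) (q v : ℝ → ℝ) : Prop where
  eq_profile : ∀ r ∈ Icc a b, v r = profile P ψ a (v a) q r
  integral_eq_zero : ∫ τ in a..b, P τ * q τ = 0

/-- Two profiles cannot touch where the source of the upper one is strictly smaller. -/
lemma IsNeumannProfile.lt_of_source_lt (hP : Continuous P) (hP0 : ∀ t, 0 < P t)
    (hψ : Continuous ψ) (hψm : StrictMono ψ) (hab : a < b) {p q u v : ℝ → ℝ}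
    (hp : Continuous p) (hq : Continuous q) (hu : Continuous u) (hv : Continuous v)
    (hpu : IsNeumannProfile P ψ a b p u) (hqv : IsNeumannProfile P ψ a b q v)
    (hlt : ∀ r ∈ Icc a b, u r ≤ v r → p r < q r) : ∀ r ∈ Icc a b, v r < u r := by
  by_contra! hcon
  obtain ⟨r₁, hr₁, hle₁⟩ := hcon
  obtain ⟨r₀, hr₀, hmax⟩ := isCompact_Icc.exists_isMaxOn ⟨r₁, hr₁⟩
    (hv.sub hu).continuousOn
  have hmax' : ∀ r ∈ Icc a b, v r - u r ≤ v r₀ - u r₀ := fun r hr => hmax hr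
  have hpq : p r₀ < q r₀ := hlt r₀ hr₀ (by linarith [hmax' r₁ hr₁])
  obtain ⟨δ, hδ, hball⟩ := Metric.eventually_nhds_iff.1
    ((hp.tendsto r₀).eventually_lt (hq.tendsto r₀) hpq)
  set D : ℝ → ℝ := fun t => ∫ τ in a..t, P τ * (q τ - p τ) with hD
  have hPq : Continuous fun τ => P τ * (q τ - p τ) := hP.mul (hq.sub hp)
  have hDsub : ∀ t t', D t' - D t = ∫ τ in t..t', P τ * (q τ - p τ) := fun t t' =>
    intervalIntegral.integral_interval_sub_left (hPq.intervalIntegrable _ _)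
      (hPq.intervalIntegrable _ _)
  have hDeq : ∀ t, D t = (∫ τ in a..t, P τ * q τ) - ∫ τ in a..t, P τ * p τ := fun t => by
    simp only [hD, mul_sub]
    exact intervalIntegral.integral_sub ((hP.mul hq).intervalIntegrable _ _)
      ((hP.mul hp).intervalIntegrable _ _)
  have hDa : D a = 0 := by simp [hD]
  have hDb : D b = 0 := by rw [hDeq, hqv.integral_eq_zero, hpu.integral_eq_zero, sub_zero]
  have hsub : ∀ t ∈ Icc a b, ∀ t' ∈ Icc a b, (v t' - u t') - (v t - u t) =
      ∫ τ in t..t', (profileDeriv P ψ a q τ - profileDeriv P ψ a p τ) := by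
    intro t ht t' ht'
    rw [intervalIntegral.integral_sub
      ((continuous_profileDeriv hP hP0 hψ hq).intervalIntegrable _ _)
      ((continuous_profileDeriv hP hP0 hψ hp).intervalIntegrable _ _),
      ← profile_sub_profile hP hP0 hψ hq (v a), ← profile_sub_profile hP hP0 hψ hp (u a),
      ← hqv.eq_profile t ht, ← hqv.eq_profile t' ht', ← hpu.eq_profile t ht,
      ← hpu.eq_profile t' ht']
    ring
  have hcont : Continuous fun τ => profileDeriv P ψ a q τ - profileDeriv P ψ a p τ :=
    (continuous_profileDeriv hP hP0 hψ hq).sub (continuous_profileDeriv hP hP0 hψ hp)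
  have hright : r₀ < b → 0 ≤ D r₀ → False := by
    intro hb h0
    set r₂ := min b (r₀ + δ / 2) with hr₂
    have h02 : r₀ < r₂ := lt_min hb (by linarith)
    have h2b : r₂ ≤ b := min_le_left _ _
    have h2δ : r₂ ≤ r₀ + δ / 2 := min_le_right _ _
    have hpos : ∀ t ∈ Ioo r₀ r₂, 0 < profileDeriv P ψ a q t - profileDeriv P ψ a p t := by
      intro t ht
      have h3 : 0 < D t - D r₀ := by
        rw [hDsub]
        refine intervalIntegral.intervalIntegral_pos_of_pos_on (hPq.intervalIntegrable _ _)
          (fun τ hτ => mul_pos (hP0 τ) (sub_pos.2 (hball ?_))) ht.1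
        rw [Real.dist_eq, abs_lt]
        constructor <;> linarith [hτ.1, hτ.2, ht.2]
      rw [hDeq t] at h3
      refine sub_pos.2 (hψm ?_)
      exact mul_lt_mul_of_pos_left (by linarith) (inv_pos.2 (hP0 t))
    have h4 := intervalIntegral.intervalIntegral_pos_of_pos_on
      (hcont.intervalIntegrable _ _) hpos h02
    have hr₂m : r₂ ∈ Icc a b := ⟨hr₀.1.trans h02.le, h2b⟩
    rw [← hsub r₀ hr₀ r₂ hr₂m] at h4
    linarith [hmax' r₂ hr₂m]
  have hleft : a < r₀ → D r₀ ≤ 0 → False := by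
    intro ha h0
    set r₂ := max a (r₀ - δ / 2) with hr₂
    have h02 : r₂ < r₀ := max_lt ha (by linarith)
    have h2a : a ≤ r₂ := le_max_left _ _
    have h2δ : r₀ - δ / 2 ≤ r₂ := le_max_right _ _
    have hpos : ∀ t ∈ Ioo r₂ r₀, 0 < -(profileDeriv P ψ a q t - profileDeriv P ψ a p t) := by
      intro t ht
      have h3 : 0 < D r₀ - D t := by
        rw [hDsub]
        refine intervalIntegral.intervalIntegral_pos_of_pos_on (hPq.intervalIntegrable _ _)
          (fun τ hτ => mul_pos (hP0 τ) (sub_pos.2 (hball ?_))) ht.2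
        rw [Real.dist_eq, abs_lt]
        constructor <;> linarith [hτ.1, hτ.2, ht.1]
      rw [hDeq t] at h3
      rw [neg_sub]
      refine sub_pos.2 (hψm ?_)
      exact mul_lt_mul_of_pos_left (by linarith) (inv_pos.2 (hP0 t))
    have h4 := intervalIntegral.intervalIntegral_pos_of_pos_on
      (hcont.fun_neg.intervalIntegrable _ _) hpos h02
    have hr₂m : r₂ ∈ Icc a b := ⟨h2a, h02.le.trans hr₀.2⟩
    rw [intervalIntegral.integral_neg, ← hsub r₂ hr₂m r₀ hr₀] at h4
    linarith [hmax' r₂ hr₂m]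
  rcases eq_or_lt_of_le hr₀.1 with h | h
  · subst h
    exact hright hab hDa.ge
  rcases eq_or_lt_of_le hr₀.2 with h' | h'
  · subst h'
    exact hleft h hDb.le
  rcases le_total 0 (D r₀) with h0 | h0
  · exact hright h' h0
  · exact hleft h h0

lemma tendsto_integral_weight_mul (hP : Continuous P) {q : ℕ → ℝ → ℝ} {q' : ℝ → ℝ} {H t : ℝ}
    (hq : ∀ n, Continuous (q n)) (ht : a ≤ t) (hH : ∀ n, ∀ τ ∈ Icc a t, |q n τ| ≤ H)
    (hlim : ∀ τ ∈ Icc a t, Tendsto (fun n => q n τ) atTop (nhds (q' τ))) :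
    Tendsto (fun n => ∫ τ in a..t, P τ * q n τ) atTop (nhds (∫ τ in a..t, P τ * q' τ)) := by
  have hmem : ∀ τ ∈ uIoc a t, τ ∈ Icc a t := fun τ hτ => by
    rw [uIoc_of_le ht] at hτ; exact Ioc_subset_Icc_self hτ
  refine intervalIntegral.tendsto_integral_filter_of_dominated_convergence
    (fun τ => |P τ| * H) ?_ ?_ ?_ ?_
  · exact .of_forall fun n => (hP.mul (hq n)).aestronglyMeasurable
  · refine .of_forall fun n => .of_forall fun τ hτ => ?_
    rw [norm_mul, Real.norm_eq_abs, Real.norm_eq_abs]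
    exact mul_le_mul_of_nonneg_left (hH n τ (hmem τ hτ)) (abs_nonneg _)
  · exact (hP.abs.mul continuous_const).intervalIntegrable _ _
  · exact .of_forall fun τ hτ => (hlim τ (hmem τ hτ)).const_mul _

lemma tendsto_profile (hP : Continuous P) (hP0 : ∀ t, 0 < P t) (hψ : Continuous ψ)
    {q : ℕ → ℝ → ℝ} {q' : ℝ → ℝ} {x : ℕ → ℝ} {x' H r : ℝ}
    (hq : ∀ n, Continuous (q n)) (hr : r ∈ Icc a b) (hH : ∀ n, ∀ τ ∈ Icc a b, |q n τ| ≤ H)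
    (hlim : ∀ τ ∈ Icc a b, Tendsto (fun n => q n τ) atTop (nhds (q' τ)))
    (hx : Tendsto x atTop (nhds x')) :
    Tendsto (fun n => profile P ψ a (x n) (q n) r) atTop (nhds (profile P ψ a x' q' r)) := by
  obtain ⟨L, -, hL⟩ := exists_profileDeriv_bound_of_source hP hP0 hψ a b H
  have hmem : ∀ τ ∈ uIoc a r, τ ∈ Icc a b := fun τ hτ => by
    rw [uIoc_of_le hr.1] at hτ; exact ⟨hτ.1.le, hτ.2.trans hr.2⟩
  refine hx.add (intervalIntegral.tendsto_integral_filter_of_dominated_convergence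
    (fun _ => L) ?_ ?_ ?_ ?_)
  · exact .of_forall fun n => (continuous_profileDeriv hP hP0 hψ (hq n)).aestronglyMeasurable
  · exact .of_forall fun n => .of_forall fun τ hτ => hL (q n) (hH n) τ (hmem τ hτ)
  · exact continuous_const.intervalIntegrable _ _
  · refine .of_forall fun t ht => ?_
    have htm := hmem t ht
    have hsub : ∀ τ ∈ Icc a t, τ ∈ Icc a b := fun τ hτ => ⟨hτ.1, hτ.2.trans htm.2⟩
    exact (hψ.tendsto _).comp ((tendsto_integral_weight_mul hP hq htm.1
      (fun n τ hτ => hH n τ (hsub τ hτ)) (fun τ hτ => hlim τ (hsub τ hτ))).const_mul _)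

/-- Subsequential uniform convergence of equi-Lipschitz functions. -/
lemma exists_subseq_tendsto_of_lipschitz (hab : a ≤ b) {L B : ℝ} {v : ℕ → ℝ → ℝ}
    (hL0 : 0 ≤ L)
    (hv : ∀ n, Continuous (v n)) (hB : ∀ n, |v n a| ≤ B)
    (hL : ∀ n, ∀ r ∈ Icc a b, ∀ r' ∈ Icc a b, |v n r' - v n r| ≤ L * |r' - r|) :
    ∃ (w : ℝ → ℝ) (k : ℕ → ℕ), Continuous w ∧ StrictMono k ∧
      TendstoUniformlyOn (fun n => v (k n)) w atTop (Icc a b) := by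
  let f : ℕ → BoundedContinuousFunction (Icc a b) ℝ := fun n =>
    BoundedContinuousFunction.mkOfCompact ⟨fun r => v n r, (hv n).comp continuous_subtype_val⟩
  have hcomp : IsCompact (closure (range f)) := by
    refine BoundedContinuousFunction.arzela_ascoli (Icc (-(B + L * (b - a))) (B + L * (b - a)))
      isCompact_Icc _ ?_ ?_
    · rintro _ r ⟨n, rfl⟩
      change v n r ∈ _
      have h1 := hL n a ⟨le_rfl, hab⟩ r r.2
      have h2 := hB n
      have h3 : L * |(r : ℝ) - a| ≤ L * (b - a) := by
        rw [abs_of_nonneg (sub_nonneg.2 r.2.1)]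
        exact mul_le_mul_of_nonneg_left (by linarith [r.2.2]) hL0
      rw [abs_le] at h1 h2
      constructor <;> linarith [h1.1, h1.2, h2.1, h2.2]
    · refine Metric.equicontinuous_of_continuity_modulus (fun t => L * t) ?_ _ ?_
      · exact (continuous_const.mul continuous_id).tendsto' 0 0 (by simp)
      · rintro r r' ⟨_, n, rfl⟩
        change dist (v n r) (v n r') ≤ L * dist r r'
        rw [Real.dist_eq, Subtype.dist_eq, Real.dist_eq]
        exact hL n r' r'.2 r r.2
  obtain ⟨g, -, k, hk, hlim⟩ := hcomp.tendsto_subseq (x := f)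
    fun n => subset_closure (mem_range_self n)
  refine ⟨IccExtend hab g, k, g.continuous.Icc_extend', hk, ?_⟩
  rw [BoundedContinuousFunction.tendsto_iff_tendstoUniformly] at hlim
  rw [Metric.tendstoUniformly_iff] at hlim
  rw [Metric.tendstoUniformlyOn_iff]
  intro ε hε
  filter_upwards [hlim ε hε] with n hn r hr
  rw [IccExtend_of_mem hab g hr]
  exact hn ⟨r, hr⟩

/-- Limits of (delayed) Neumann profiles are Neumann profiles. -/
lemma exists_limit_profile (hP : Continuous P) (hP0 : ∀ t, 0 < P t) (hψ : Continuous ψ)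
    (hab : a ≤ b) {h : ℝ → ℝ → ℝ} (hh : Continuous (Function.uncurry h)) {v : ℕ → ℝ → ℝ}
    {ε s : ℕ → ℝ} {B H : ℝ} (hε0 : ∀ n, 0 ≤ ε n) (hε : Tendsto ε atTop (nhds 0))
    (hs : Tendsto s atTop (nhds 0)) (hv : ∀ n, Continuous (v n)) (hB : ∀ n, |v n a| ≤ B)
    (hH : ∀ n, ∀ τ ∈ Icc a b, |h τ (v n (max a (τ - ε n))) + s n| ≤ H)
    (hprof : ∀ n, IsNeumannProfile P ψ a b (fun τ => h τ (v n (max a (τ - ε n))) + s n) (v n))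
    {u : ℝ → ℝ} (hu : Continuous u)
    (huv : ∀ n, ∃ τ ∈ Icc a b, u τ ≤ v n (max a (τ - ε n))) :
    ∃ w, Continuous w ∧ IsNeumannProfile P ψ a b (fun τ => h τ (w τ)) w ∧
      ∃ τ ∈ Icc a b, u τ ≤ w τ := by
  obtain ⟨L, hL0, hL⟩ := exists_profileDeriv_bound_of_source hP hP0 hψ a b H
  have hqc : ∀ n, Continuous fun τ => h τ (v n (max a (τ - ε n))) + s n := fun n =>
    (hh.comp (continuous_id.prodMk ((hv n).comp
      (continuous_const.max (continuous_id.sub continuous_const))))).add continuous_const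
  have hlip : ∀ n, ∀ r ∈ Icc a b, ∀ r' ∈ Icc a b, |v n r' - v n r| ≤ L * |r' - r| := by
    intro n r hr r' hr'
    rw [(hprof n).eq_profile r hr, (hprof n).eq_profile r' hr']
    exact abs_profile_sub_le hP hP0 hψ (hqc n) (hL _ (hH n)) _ hr hr'
  obtain ⟨w, k, hw, hk, hunif⟩ := exists_subseq_tendsto_of_lipschitz hab hL0 hv hB hlip
  choose τ hτ huτ using huv
  obtain ⟨τ₀, hτ₀, m, hm, hτlim⟩ := (isCompact_Icc (a := a) (b := b)).tendsto_subseq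
    (x := fun n => τ (k n)) fun n => hτ (k n)
  have hkt := hk.tendsto_atTop
  have hmem : ∀ n, ∀ t ∈ Icc a b, max a (t - ε n) ∈ Icc a b := fun n t ht =>
    ⟨le_max_left _ _, max_le (ht.1.trans ht.2) (by linarith [hε0 n, ht.2])⟩
  have hconv : ∀ (j : ℕ → ℕ), Tendsto j atTop atTop → ∀ (σ : ℕ → ℝ) (σ₀ : ℝ),
      (∀ n, σ n ∈ Icc a b) → σ₀ ∈ Icc a b → Tendsto σ atTop (nhds σ₀) →
      Tendsto (fun n => v (k (j n)) (max a (σ n - ε (k (j n))))) atTop (nhds (w σ₀)) := by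
    intro j hj σ σ₀ hσ hσ₀ hlim
    have hj' : TendstoUniformlyOn (fun n => v (k (j n))) w atTop (Icc a b) := fun U hU =>
      hj.eventually (hunif U hU)
    have h1 : Tendsto (fun n => max a (σ n - ε (k (j n)))) atTop (nhds (max a (σ₀ - 0))) :=
      tendsto_const_nhds.max (hlim.sub (hε.comp (hkt.comp hj)))
    rw [sub_zero, max_eq_right hσ₀.1] at h1
    exact hj'.tendsto_comp hw.continuousWithinAt
      (tendsto_nhdsWithin_iff.2 ⟨h1, .of_forall fun n => hmem _ _ (hσ n)⟩)
  have hqlim : ∀ t ∈ Icc a b, Tendsto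
      (fun n => h t (v (k n) (max a (t - ε (k n)))) + s (k n)) atTop (nhds (h t (w t))) := by
    intro t ht
    have h1 := hconv id tendsto_id (fun _ => t) t (fun _ => ht) ht tendsto_const_nhds
    have h2 := ((hh.tendsto (t, w t)).comp (tendsto_const_nhds.prodMk_nhds h1)).add
      (hs.comp hkt)
    simpa using h2
  have ha : a ∈ Icc a b := ⟨le_rfl, hab⟩
  refine ⟨w, hw, ⟨fun r hr => ?_, ?_⟩, τ₀, hτ₀, ?_⟩
  · refine tendsto_nhds_unique (hunif.tendsto_at hr) ?_
    have := tendsto_profile hP hP0 hψ (fun n => hqc (k n)) hr (fun n => hH (k n)) hqlim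
      (hunif.tendsto_at ha)
    exact this.congr fun n => ((hprof (k n)).eq_profile r hr).symm
  · refine tendsto_nhds_unique (tendsto_integral_weight_mul hP (fun n => hqc (k n)) hab
      (fun n => hH (k n)) hqlim) ?_
    exact tendsto_const_nhds.congr fun n => ((hprof (k n)).integral_eq_zero).symm
  · refine le_of_tendsto_of_tendsto' ((hu.tendsto τ₀).comp hτlim)
      (hconv m hm.tendsto_atTop (fun n => τ (k (m n))) τ₀ (fun n => hτ _) hτ₀ hτlim) ?_
    exact fun n => huτ _

end Neumann

section Multiplicity

variable {P ψ : ℝ → ℝ} {a b : ℝ}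

lemma IsNeumannProfile.congr (hab : a ≤ b) {q q' v : ℝ → ℝ}
    (h : IsNeumannProfile P ψ a b q v) (hqq : ∀ τ ∈ Icc a b, q τ = q' τ) :
    IsNeumannProfile P ψ a b q' v where
  eq_profile r hr := by
    rw [← profile_congr hr.1 fun τ hτ => hqq τ ⟨hτ.1, hτ.2.trans hr.2⟩]
    exact h.eq_profile r hr
  integral_eq_zero := by
    rw [← h.integral_eq_zero]
    refine intervalIntegral.integral_congr fun τ hτ => ?_
    rw [uIcc_of_le hab] at hτ
    simp only [hqq τ hτ]

/-- A bounded problem whose total source is negative for very small and for very large functions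
has, for each strict upper solution `β`, a solution below `β` and one which is not. -/
lemma exists_two_profiles (hP : Continuous P) (hP0 : ∀ t, 0 < P t) (hψ : Continuous ψ)
    (hψm : StrictMono ψ) (hab : a < b) {h : ℝ → ℝ → ℝ} (hh : Continuous (Function.uncurry h))
    {H d : ℝ} (hH : ∀ τ ∈ Icc a b, ∀ u, |h τ u| ≤ H)
    (hlow : ∀ v : ℝ → ℝ, Continuous v → (∀ r ∈ Icc a b, v r ≤ -d) →
      ∫ τ in a..b, P τ * h τ (v τ) < 0)
    (hhigh : ∀ v : ℝ → ℝ, Continuous v → (∀ r ∈ Icc a b, d ≤ v r) →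
      ∫ τ in a..b, P τ * h τ (v τ) < 0)
    {β p : ℝ → ℝ} (hβ : Continuous β) (hp : Continuous p)
    (hpβ : IsNeumannProfile P ψ a b p β) (hlt : ∀ r ∈ Icc a b, p r < h r (β r)) :
    ∃ v₁ v₂ : ℝ → ℝ, (Continuous v₁ ∧ IsNeumannProfile P ψ a b (fun τ => h τ (v₁ τ)) v₁) ∧
      (Continuous v₂ ∧ IsNeumannProfile P ψ a b (fun τ => h τ (v₂ τ)) v₂) ∧
      (∀ r ∈ Icc a b, v₁ r < β r) ∧ ∃ r ∈ Icc a b, β r ≤ v₂ r := by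
  have ha : a ∈ Icc a b := ⟨le_rfl, hab.le⟩
  obtain ⟨L, hL0, hL⟩ := exists_profileDeriv_bound_of_source hP hP0 hψ a b H
  obtain ⟨Bβ, hBβ⟩ := (isCompact_Icc (a := a) (b := b)).exists_bound_of_continuousOn
    hβ.continuousOn
  have hBβ0 : 0 ≤ Bβ := (norm_nonneg _).trans (hBβ a ha)
  set B : ℝ := |d| + Bβ + L * (b - a) + 1 with hB
  have hLab : 0 ≤ L * (b - a) := mul_nonneg hL0 (by linarith)
  have hB0 : 0 < B := by positivity
  set h' : ℝ → ℝ → ℝ := fun τ u => h τ (min u (β τ)) with hh'def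
  have hh' : Continuous (Function.uncurry h') :=
    hh.comp (continuous_fst.prodMk (continuous_snd.min (hβ.comp continuous_fst)))
  have hH' : ∀ τ ∈ Icc a b, ∀ u, |h' τ u| ≤ H := fun τ hτ u => hH τ hτ _
  set ε : ℕ → ℝ := fun n => 1 / ((n : ℝ) + 1) with hεdef
  have hε : ∀ n, 0 < ε n := fun n => by positivity
  have hεlim : Tendsto ε atTop (nhds 0) := tendsto_one_div_add_atTop_nhds_zero_nat
  choose V hVc hV using fun n : ℕ => exists_delay_solution (a := a) hP hP0 hψ hh (hε n) b
  choose W hWc hW using fun n : ℕ => exists_delay_solution (a := a) hP hP0 hψ hh' (hε n) b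
  have hδc : ∀ n, Continuous fun τ => max a (τ - ε n) := fun n => by fun_prop
  have hδ : ∀ n, ∀ t ∈ Icc a b, max a (t - ε n) ∈ Icc a b := fun n t ht =>
    ⟨le_max_left _ _, max_le hab.le (by linarith [(hε n).le, ht.2])⟩
  have hcomp : ∀ U : ℕ → ℝ → ℝ → ℝ, (∀ n, Continuous (Function.uncurry (U n))) → ∀ n x,
      Continuous fun τ => U n x (max a (τ - ε n)) := fun U hU n x =>
    (hU n).comp (continuous_const.prodMk (hδc n))
  have hnear : ∀ k : ℝ → ℝ → ℝ, Continuous (Function.uncurry k) →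
      (∀ τ ∈ Icc a b, ∀ u, |k τ u| ≤ H) → ∀ U : ℕ → ℝ → ℝ → ℝ,
      (∀ n, Continuous (Function.uncurry (U n))) →
      (∀ n x, ∀ r ∈ Icc a b,
        U n x r = profile P ψ a x (fun τ => k τ (U n x (max a (τ - ε n)))) r) →
      ∀ n x, ∀ τ ∈ Icc a b, |U n x (max a (τ - ε n)) - x| ≤ L * (b - a) := by
    intro k hk hkH U hUc hU n x τ hτ
    have hq : Continuous fun τ => k τ (U n x (max a (τ - ε n))) :=
      hk.comp (continuous_id.prodMk (hcomp U hUc n x))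
    have h1 := abs_profile_sub_le hP hP0 hψ hq (hL _ fun t ht => hkH t ht _) x ha (hδ n τ hτ)
    rw [profile_left, ← hU n x _ (hδ n τ hτ)] at h1
    refine h1.trans (mul_le_mul_of_nonneg_left ?_ hL0)
    have := hδ n τ hτ
    rw [abs_of_nonneg (by linarith [this.1])]
    linarith [this.2]
  have hVnear := hnear h hh hH V hVc hV
  have hWnear := hnear h' hh' hH' W hWc hW
  set F : ℕ → ℝ → ℝ := fun n x => ∫ τ in a..b, P τ * h τ (V n x (max a (τ - ε n))) with hF
  set Φ : ℕ → ℝ → ℝ := fun n x => ∫ τ in a..b, P τ * h' τ (W n x (max a (τ - ε n))) with hΦ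
  have hintc : ∀ k : ℝ → ℝ → ℝ, Continuous (Function.uncurry k) → ∀ U : ℕ → ℝ → ℝ → ℝ,
      (∀ n, Continuous (Function.uncurry (U n))) → ∀ n,
      Continuous fun x => ∫ τ in a..b, P τ * k τ (U n x (max a (τ - ε n))) := by
    intro k hk U hU n
    refine intervalIntegral.continuous_parametric_intervalIntegral_of_continuous'
      (f := fun x τ => P τ * k τ (U n x (max a (τ - ε n)))) ?_ a b
    have h1 : Continuous fun z : ℝ × ℝ => U n z.1 (max a (z.2 - ε n)) :=
      (hU n).comp (continuous_fst.prodMk ((hδc n).comp continuous_snd))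
    exact (hP.comp continuous_snd).mul (hk.comp (continuous_snd.prodMk h1))
  have hFc : ∀ n, Continuous (F n) := hintc h hh V hVc
  have hΦc : ∀ n, Continuous (Φ n) := hintc h' hh' W hWc
  have hWa : ∀ n x, W n x a = x := fun n x => by rw [hW n x a ha, profile_left]
  have hVa : ∀ n x, V n x a = x := fun n x => by rw [hV n x a ha, profile_left]
  have hF_neg : ∀ n x, B ≤ x → F n x < 0 := by
    intro n x hx
    refine hhigh _ (hcomp V hVc n x) fun r hr => ?_
    linarith [(abs_le.1 (hVnear n x r hr)).1, le_abs_self d]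
  have hΦ_neg : ∀ n x, x ≤ -B → Φ n x < 0 := by
    intro n x hx
    refine hlow _ ((hcomp W hWc n x).min hβ) fun r hr => (min_le_left _ _).trans ?_
    linarith [(abs_le.1 (hWnear n x r hr)).2, le_abs_self d]
  have hΦ_pos : ∀ n x, B ≤ x → 0 < Φ n x := by
    intro n x hx
    have hq : Continuous fun τ => h' τ (W n x (max a (τ - ε n))) :=
      hh'.comp (continuous_id.prodMk (hcomp W hWc n x))
    have h1 : 0 < ∫ τ in a..b, (P τ * h' τ (W n x (max a (τ - ε n))) - P τ * p τ) := by
      refine intervalIntegral.intervalIntegral_pos_of_pos_on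
        (((hP.mul hq).sub (hP.mul hp)).intervalIntegrable _ _) (fun τ hτ => ?_) hab
      have hτ' := Ioo_subset_Icc_self hτ
      rw [← mul_sub]
      refine mul_pos (hP0 τ) (sub_pos.2 ?_)
      have h2 : β τ ≤ W n x (max a (τ - ε n)) := by
        linarith [(abs_le.1 (hWnear n x τ hτ')).1, abs_nonneg d, (abs_le.1 (hBβ τ hτ')).2]
      simp only [hh'def, min_eq_right h2]
      exact hlt τ hτ'
    rw [intervalIntegral.integral_sub ((hP.fun_mul hq).intervalIntegrable _ _)
      ((hP.fun_mul hp).intervalIntegrable _ _), hpβ.integral_eq_zero, sub_zero] at h1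
    exact h1
  have hΦ_zero : ∀ n x, Φ n x = 0 → x ∈ Ioo (-B) B := by
    intro n x hx
    by_contra hcon
    rw [mem_Ioo, not_and_or, not_lt, not_lt] at hcon
    rcases hcon with hcon | hcon
    · exact (hΦ_neg n x hcon).ne hx
    · exact (hΦ_pos n x hcon).ne' hx
  have hWprof : ∀ n x, Φ n x = 0 → IsNeumannProfile P ψ a b
      (fun τ => h' τ (W n x (max a (τ - ε n))) + 0) (W n x) := by
    intro n x hx
    simp only [add_zero]
    exact ⟨fun r hr => by rw [hWa]; exact hW n x r hr, hx⟩
  have hVprof : ∀ n x, F n x = 0 → IsNeumannProfile P ψ a b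
      (fun τ => h τ (V n x (max a (τ - ε n))) + 0) (V n x) := by
    intro n x hx
    simp only [add_zero]
    exact ⟨fun r hr => by rw [hVa]; exact hV n x r hr, hx⟩
  have hslice : ∀ U : ℝ → ℝ → ℝ, Continuous (Function.uncurry U) → ∀ x, Continuous (U x) :=
    fun U hU x => hU.comp (continuous_const.prodMk continuous_id)
  have hbelow : ∀ w : ℝ → ℝ, Continuous w → IsNeumannProfile P ψ a b (fun τ => h' τ (w τ)) w →
      ∀ r ∈ Icc a b, w r < β r := by
    intro w hw hwp
    refine IsNeumannProfile.lt_of_source_lt hP hP0 hψ hψm hab hp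
      (hh'.comp (continuous_id.prodMk hw)) hβ hw hpβ hwp fun r hr hle => ?_
    simp only [Function.comp, Function.uncurry, hh'def, id, min_eq_right hle]
    exact hlt r hr
  have hΦ_exists : ∀ n, ∃ x, Φ n x = 0 := fun n => by
    obtain ⟨x, -, hx⟩ := intermediate_value_Icc (by linarith : -B ≤ B) (hΦc n).continuousOn
      ⟨(hΦ_neg n _ le_rfl).le, (hΦ_pos n _ le_rfl).le⟩
    exact ⟨x, hx⟩
  -- the solution below `β`
  choose x hx using hΦ_exists
  obtain ⟨v₁, hv₁c, hv₁, -⟩ := exists_limit_profile hP hP0 hψ hab.le hh' (v := fun n => W n (x n))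
    (s := fun _ => 0) (B := B) (H := H) (fun n => (hε n).le) hεlim tendsto_const_nhds
    (fun n => hslice _ (hWc n) _)
    (fun n => by
      rw [hWa]; exact abs_le.2 ⟨(hΦ_zero n _ (hx n)).1.le, (hΦ_zero n _ (hx n)).2.le⟩)
    (fun n τ hτ => by rw [add_zero]; exact hH' τ hτ _) (fun n => hWprof n _ (hx n))
    (u := fun _ => -B) continuous_const
    (fun n => ⟨a, ha, by
      rw [max_eq_left (by linarith [hε n]), hWa]; exact (hΦ_zero n _ (hx n)).1.le⟩)
  have hv₁β := hbelow v₁ hv₁c hv₁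
  -- eventually, every delayed solution of the truncated problem stays below `β`
  have hev : ∃ n₀, ∀ n, n₀ ≤ n → ∀ x, Φ n x = 0 →
      ∀ τ ∈ Icc a b, W n x (max a (τ - ε n)) < β τ := by
    by_contra! hcon
    choose m hm y hy hτ using hcon
    have hmt : Tendsto m atTop atTop := tendsto_atTop_mono hm tendsto_id
    obtain ⟨w, hwc, hw, τ, hτm, hle⟩ := exists_limit_profile hP hP0 hψ hab.le hh'
      (v := fun n => W (m n) (y n)) (ε := fun n => ε (m n))
      (s := fun _ => 0) (B := B) (H := H) (fun n => (hε _).le) (hεlim.comp hmt)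
      tendsto_const_nhds (fun n => hslice _ (hWc _) _)
      (fun n => by
        rw [hWa]; exact abs_le.2 ⟨(hΦ_zero _ _ (hy n)).1.le, (hΦ_zero _ _ (hy n)).2.le⟩)
      (fun n τ hτ => by rw [add_zero]; exact hH' τ hτ _) (fun n => hWprof _ _ (hy n)) hβ hτ
    exact (hbelow w hwc hw τ hτm).not_ge hle
  obtain ⟨n₀, hn₀⟩ := hev
  have hsecond : ∀ n, n₀ ≤ n → ∃ y, F n y = 0 ∧ |y| ≤ B ∧
      ∃ τ ∈ Icc a b, β τ ≤ V n y (max a (τ - ε n)) := by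
    intro n hn
    have hZc : IsCompact (Icc (-B) B ∩ Φ n ⁻¹' {0}) :=
      isCompact_Icc.inter_right (isClosed_singleton.preimage (hΦc n))
    obtain ⟨z, ⟨-, hz0⟩, hzmax⟩ := hZc.exists_isGreatest
      ⟨x n, Ioo_subset_Icc_self (hΦ_zero n _ (hx n)), hx n⟩
    have hzmax' : ∀ y, Φ n y = 0 → y ≤ z := fun y hy =>
      hzmax ⟨Ioo_subset_Icc_self (hΦ_zero n _ hy), hy⟩
    have hzB := hΦ_zero n z hz0
    have hnhds : ∀ᶠ y in nhds z, ∀ τ ∈ Icc a b, W n y (max a (τ - ε n)) < β τ := by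
      refine isCompact_Icc.eventually_forall_of_forall_eventually fun τ hτ => ?_
      have hc : Continuous fun q : ℝ × ℝ => W n q.1 (max a (q.2 - ε n)) :=
        (hWc n).comp (continuous_fst.prodMk ((hδc n).comp continuous_snd))
      exact (hc.tendsto (z, τ)).eventually_lt ((hβ.comp continuous_snd).tendsto (z, τ))
        (hn₀ n hn z hz0 τ hτ)
    obtain ⟨y, hyβ, hzy, hyB⟩ : ∃ y, (∀ τ ∈ Icc a b, W n y (max a (τ - ε n)) < β τ) ∧
        z < y ∧ y < B := by
      have h1 : ∀ᶠ y in nhdsWithin z (Ioi z), y ∈ Ioo z B := Ioo_mem_nhdsGT hzB.2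
      obtain ⟨y, hy1, hy2⟩ := ((hnhds.filter_mono nhdsWithin_le_nhds).and h1).exists
      exact ⟨y, hy1, hy2.1, hy2.2⟩
    have hΦy : 0 < Φ n y := by
      by_contra! hle
      obtain ⟨y', hy', hy'0⟩ := intermediate_value_Icc hyB.le (hΦc n).continuousOn
        ⟨hle, (hΦ_pos n B le_rfl).le⟩
      linarith [hzmax' y' hy'0, hy'.1]
    have hagree : ∀ τ ∈ Icc a b, h τ (W n y (max a (τ - ε n))) =
        h' τ (W n y (max a (τ - ε n))) := fun τ hτ => by
      simp only [hh'def, min_eq_left (hyβ τ hτ).le]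
    have hVW := delay_solution_unique (hε n) (hV n y) (hW n y) hagree
    have hFy : F n y = Φ n y := by
      refine intervalIntegral.integral_congr fun τ hτ => ?_
      rw [uIcc_of_le hab.le] at hτ
      simp only [hVW _ (hδ n τ hτ), hagree τ hτ]
    obtain ⟨y', hy', hy'0⟩ := intermediate_value_Icc' hyB.le (hFc n).continuousOn
      ⟨(hF_neg n B le_rfl).le, hFy ▸ hΦy.le⟩
    refine ⟨y', hy'0, abs_le.2 ⟨by linarith [hzB.1, hy'.1], hy'.2⟩, ?_⟩
    by_contra! hcon
    have hagree' : ∀ τ ∈ Icc a b, h' τ (V n y' (max a (τ - ε n))) =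
        h τ (V n y' (max a (τ - ε n))) := fun τ hτ => by
      simp only [hh'def, min_eq_left (hcon τ hτ).le]
    have hWV := delay_solution_unique (hε n) (hW n y') (hV n y') hagree'
    have : Φ n y' = F n y' := by
      refine intervalIntegral.integral_congr fun τ hτ => ?_
      rw [uIcc_of_le hab.le] at hτ
      simp only [hWV _ (hδ n τ hτ), hagree' τ hτ]
    linarith [hzmax' y' (this.trans hy'0), hy'.1]
  choose y hy0 hyB hyβ using fun n : ℕ => hsecond (n₀ + n) (Nat.le_add_right _ _)
  obtain ⟨v₂, hv₂c, hv₂, hv₂β⟩ := exists_limit_profile hP hP0 hψ hab.le hh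
    (v := fun n => V (n₀ + n) (y n)) (ε := fun n => ε (n₀ + n))
    (s := fun _ => 0) (B := B) (H := H) (fun n => (hε _).le)
    (hεlim.comp (tendsto_atTop_mono (fun n => Nat.le_add_left n n₀) tendsto_id))
    tendsto_const_nhds (fun n => hslice _ (hVc _) _) (fun n => by rw [hVa]; exact hyB n)
    (fun n τ hτ => by rw [add_zero]; exact hH τ hτ _) (fun n => hVprof _ _ (hy0 n)) hβ hyβ
  refine ⟨v₁, v₂, ⟨hv₁c, hv₁.congr hab.le fun τ hτ => ?_⟩, ⟨hv₂c, hv₂⟩, hv₁β, hv₂β⟩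
  simp only [hh'def, min_eq_left (hv₁β τ hτ).le]

end Multiplicity

section Threshold

variable {P ψ : ℝ → ℝ} {a b : ℝ}

/-- `v` is a solution of the Neumann problem `(P · ψ⁻¹(v'))' + P G(·, v) = P s` on `[a, b]`. -/
def IsNeumannSol (P ψ : ℝ → ℝ) (a b : ℝ) (G : ℝ → ℝ → ℝ) (s : ℝ) (v : ℝ → ℝ) : Prop :=
  Continuous v ∧ IsNeumannProfile P ψ a b (fun τ => s - G τ (v τ)) v

/-- The total source `∫ P (σ - G(·, v))` is negative as soon as `v ≤ -d` or `d ≤ v`. -/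
def NegativeBeyond (P : ℝ → ℝ) (a b : ℝ) (G : ℝ → ℝ → ℝ) (σ d : ℝ) : Prop :=
  ∀ v : ℝ → ℝ, Continuous v → (∀ r ∈ Icc a b, v r ≤ -d) ∨ (∀ r ∈ Icc a b, d ≤ v r) →
    ∫ τ in a..b, P τ * (σ - G τ (v τ)) < 0

lemma exists_profile_oscillation_bound (hP : Continuous P) (hP0 : ∀ t, 0 < P t)
    (hψ : Continuous ψ) (hab : a ≤ b) (K : ℝ) : ∃ M, 0 ≤ M ∧ ∀ q v : ℝ → ℝ, Continuous q →
      (∀ τ ∈ Icc a b, q τ ≤ K) → IsNeumannProfile P ψ a b q v →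
      ∀ r ∈ Icc a b, ∀ r' ∈ Icc a b, v r' - v r ≤ M := by
  set K' := max K 0
  have hK' : 0 ≤ K' := le_max_right _ _
  obtain ⟨L, hL0, hL⟩ := exists_profileDeriv_bound hP hP0 hψ a b (∫ τ in a..b, P τ * K')
  refine ⟨L * (b - a), mul_nonneg hL0 (by linarith), fun q v hq hqK hqv r hr r' hr' => ?_⟩
  have hPq : Continuous fun τ => P τ * q τ := hP.fun_mul hq
  have hPK : Continuous fun τ => P τ * K' := hP.fun_mul continuous_const
  have hPK0 : ∀ τ, 0 ≤ P τ * K' := fun τ => mul_nonneg (hP0 τ).le hK'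
  have hle : ∀ t ∈ Icc a b, ∀ t' ∈ Icc a b, t ≤ t' →
      ∫ τ in t..t', P τ * q τ ≤ ∫ τ in a..b, P τ * K' := by
    intro t ht t' ht' htt
    calc ∫ τ in t..t', P τ * q τ ≤ ∫ τ in t..t', P τ * K' :=
          intervalIntegral.integral_mono_on htt (hPq.intervalIntegrable _ _)
            (hPK.intervalIntegrable _ _) fun τ hτ => mul_le_mul_of_nonneg_left
              (le_max_of_le_left (hqK τ ⟨ht.1.trans hτ.1, hτ.2.trans ht'.2⟩)) (hP0 τ).le
      _ ≤ ∫ τ in a..b, P τ * K' :=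
          intervalIntegral.integral_mono_interval ht.1 htt ht'.2
            (.of_forall hPK0) (hPK.intervalIntegrable _ _)
  have hslope := hL q fun t ht => by
    have h1 := hle a ⟨le_rfl, hab⟩ t ht ht.1
    have h2 := hle t ht b ⟨hab, le_rfl⟩ ht.2
    have h3 := intervalIntegral.integral_add_adjacent_intervals
      (hPq.intervalIntegrable (μ := volume) a t) (hPq.intervalIntegrable t b)
    rw [hqv.integral_eq_zero] at h3
    exact abs_le.2 ⟨by linarith, h1⟩
  have h4 := abs_profile_sub_le hP hP0 hψ hq hslope (v a) hr hr'
  rw [← hqv.eq_profile r hr, ← hqv.eq_profile r' hr'] at h4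
  refine (le_abs_self _).trans (h4.trans (mul_le_mul_of_nonneg_left ?_ hL0))
  exact abs_le.2 ⟨by linarith [hr.2, hr'.1], by linarith [hr.1, hr'.2]⟩

lemma continuous_source {G : ℝ → ℝ → ℝ} (hG : Continuous (Function.uncurry G)) {v : ℝ → ℝ}
    (hv : Continuous v) (s : ℝ) : Continuous fun τ => s - G τ (v τ) :=
  continuous_const.sub (hG.comp (continuous_id.prodMk hv))

/-- A priori bound for solutions whose parameter does not exceed `σ`. -/
lemma exists_neumannSol_bound (hP : Continuous P) (hP0 : ∀ t, 0 < P t) (hψ : Continuous ψ)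
    (hab : a ≤ b) (C₀ σ d : ℝ) : ∃ D, d ≤ D ∧ ∀ G : ℝ → ℝ → ℝ,
      Continuous (Function.uncurry G) →
      (∀ r ∈ Icc a b, ∀ u, -C₀ ≤ G r u) → NegativeBeyond P a b G σ d →
      ∀ s ≤ σ, ∀ v, IsNeumannSol P ψ a b G s v → ∀ r ∈ Icc a b, |v r| ≤ D := by
  obtain ⟨M, hM0, hM⟩ := exists_profile_oscillation_bound hP hP0 hψ hab (σ + C₀)
  refine ⟨d + M, by linarith, fun G hG hC hneg s hs v hv r hr => ?_⟩
  have hqc := continuous_source hG hv.1 s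
  have hosc := hM _ v hqc (fun τ hτ => by linarith [hC τ hτ (v τ)]) hv.2
  have hge : 0 ≤ ∫ τ in a..b, P τ * (σ - G τ (v τ)) := by
    rw [← hv.2.integral_eq_zero]
    exact intervalIntegral.integral_mono_on hab ((hP.fun_mul hqc).intervalIntegrable _ _)
      ((hP.fun_mul (continuous_source hG hv.1 σ)).intervalIntegrable _ _)
      fun τ hτ => mul_le_mul_of_nonneg_left (by linarith) (hP0 τ).le
  have hnot := mt (hneg v hv.1) hge.not_gt
  push Not at hnot
  obtain ⟨⟨r₁, hr₁, h₁⟩, r₂, hr₂, h₂⟩ := hnot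
  exact abs_le.2 ⟨by linarith [hosc r hr r₁ hr₁], by linarith [hosc r₂ hr₂ r hr]⟩

lemma exists_bound_on_strip {G : ℝ → ℝ → ℝ} (hG : Continuous (Function.uncurry G))
    (a b D : ℝ) : ∃ H, ∀ r ∈ Icc a b, ∀ u, |u| ≤ D → |G r u| ≤ H := by
  obtain ⟨H, hH⟩ := ((isCompact_Icc (a := a) (b := b)).prod
    (isCompact_Icc (a := -D) (b := D))).exists_bound_of_continuousOn hG.continuousOn
  exact ⟨H, fun r hr u hu => hH (r, u) ⟨hr, abs_le.1 hu⟩⟩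

/-- A strict upper solution yields two solutions, separated by it. -/
lemma exists_two_neumannSols (hP : Continuous P) (hP0 : ∀ t, 0 < P t) (hψ : Continuous ψ)
    (hψm : StrictMono ψ) (hab : a < b) {G : ℝ → ℝ → ℝ} (hG : Continuous (Function.uncurry G))
    {C₀ s d : ℝ} (hC : ∀ r ∈ Icc a b, ∀ u, -C₀ ≤ G r u) (hd : 0 < d)
    (hneg : NegativeBeyond P a b G s d)
    {β p : ℝ → ℝ} (hβ : Continuous β) (hp : Continuous p)
    (hpβ : IsNeumannProfile P ψ a b p β) (hlt : ∀ r ∈ Icc a b, p r < s - G r (β r)) :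
    ∃ v₁ v₂ : ℝ → ℝ, IsNeumannSol P ψ a b G s v₁ ∧ IsNeumannSol P ψ a b G s v₂ ∧
      ∃ r ∈ Icc a b, v₁ r ≠ v₂ r := by
  obtain ⟨D₀, hdD₀, hD₀⟩ := exists_neumannSol_bound hP hP0 hψ hab.le C₀ s d
  obtain ⟨Bβ, hBβ⟩ := (isCompact_Icc (a := a) (b := b)).exists_bound_of_continuousOn
    hβ.continuousOn
  set D := max D₀ Bβ with hD
  have hdD : d ≤ D := hdD₀.trans (le_max_left _ _)
  obtain ⟨H, hH⟩ := exists_bound_on_strip hG a b D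
  set clamp : ℝ → ℝ := fun u => max (-D) (min D u) with hclamp
  have hclampc : Continuous clamp := by fun_prop
  have hclamp_abs : ∀ u, |clamp u| ≤ D := fun u =>
    abs_le.2 ⟨le_max_left _ _, max_le (by linarith) (min_le_left _ _)⟩
  have hclamp_eq : ∀ u, |u| ≤ D → clamp u = u := fun u hu => by
    rw [abs_le] at hu
    simp only [hclamp, min_eq_right hu.2, max_eq_right hu.1]
  set g : ℝ → ℝ → ℝ := fun τ u => G τ (clamp u) with hg
  have hgc : Continuous (Function.uncurry g) :=
    hG.comp (continuous_fst.prodMk (hclampc.comp continuous_snd))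
  have hgneg : NegativeBeyond P a b g s d := by
    intro v hv hvd
    refine hneg (fun τ => clamp (v τ)) (hclampc.comp hv) (hvd.imp ?_ ?_)
    · exact fun h r hr => max_le (by linarith) ((min_le_right _ _).trans (h r hr))
    · exact fun h r hr => le_max_of_le_right (le_min hdD (h r hr))
  have hback : ∀ v, IsNeumannSol P ψ a b g s v → IsNeumannSol P ψ a b G s v := by
    intro v hv
    refine ⟨hv.1, hv.2.congr hab.le fun τ hτ => ?_⟩
    have := hD₀ g hgc (fun r hr u => hC r hr _) hgneg s le_rfl v hv τ hτ
    simp only [hg, hclamp_eq _ (this.trans (le_max_left _ _))]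
  obtain ⟨v₁, v₂, hv₁, hv₂, hlt₁, r, hr, hle₂⟩ := exists_two_profiles hP hP0 hψ hψm hab
    (h := fun τ u => s - g τ u) (H := |s| + H) (d := d) (continuous_const.sub hgc)
    (fun τ hτ u => (abs_sub _ _).trans
      (add_le_add le_rfl (hH τ hτ _ (hclamp_abs u))))
    (fun v hv h => hgneg v hv (.inl h)) (fun v hv h => hgneg v hv (.inr h)) hβ hp hpβ
    (fun r hr => by
      simp only [hg, hclamp_eq _ ((hBβ r hr).trans (le_max_right _ _))]
      exact hlt r hr)
  exact ⟨v₁, v₂, hback v₁ hv₁, hback v₂ hv₂, r, hr, ((hlt₁ r hr).trans_le hle₂).ne⟩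

/-- Ambrosetti–Prodi alternative for the one-dimensional weighted Neumann problem. -/
theorem exists_neumannSol_threshold (hP : Continuous P) (hP0 : ∀ t, 0 < P t)
    (hψ : Continuous ψ) (hψm : StrictMono ψ) (hψ0 : ψ 0 = 0) (hab : a < b) {G : ℝ → ℝ → ℝ}
    (hG : Continuous (Function.uncurry G)) {C₀ u₀ g₀ : ℝ}
    (hC : ∀ r ∈ Icc a b, ∀ u, -C₀ ≤ G r u) (hu₀ : ∀ r ∈ Icc a b, G r u₀ ≤ g₀)
    (hneg : ∀ σ, ∃ d, 0 < d ∧ NegativeBeyond P a b G σ d) :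
    ∃ s₀ : ℝ, (∀ s < s₀, ¬∃ v, IsNeumannSol P ψ a b G s v) ∧
      (∃ v, IsNeumannSol P ψ a b G s₀ v) ∧
      ∀ s, s₀ < s → ∃ v₁ v₂, IsNeumannSol P ψ a b G s v₁ ∧ IsNeumannSol P ψ a b G s v₂ ∧
        ∃ r ∈ Icc a b, v₁ r ≠ v₂ r := by
  set S : Set ℝ := {s | ∃ v, IsNeumannSol P ψ a b G s v} with hS
  have hne : S.Nonempty := by
    obtain ⟨d, hd, hnegd⟩ := hneg (g₀ + 1)
    obtain ⟨v, -, hv, -⟩ := exists_two_neumannSols hP hP0 hψ hψm hab hG hC hd hnegd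
      (β := fun _ => u₀) (p := fun _ => 0) continuous_const continuous_const
      ⟨fun r _ => by simp [profile, profileDeriv, hψ0], by simp⟩
      (fun r hr => by linarith [hu₀ r hr])
    exact ⟨_, v, hv⟩
  have hbdd : BddBelow S := by
    refine ⟨-C₀, ?_⟩
    rintro s ⟨v, hvc, hv⟩
    by_contra! hlt
    have hpos : 0 < ∫ τ in a..b, -(P τ * (s - G τ (v τ))) := by
      refine intervalIntegral.intervalIntegral_pos_of_pos_on
        ((hP.fun_mul (continuous_source hG hvc s)).fun_neg.intervalIntegrable _ _)
        (fun τ hτ => ?_) hab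
      rw [← mul_neg]
      exact mul_pos (hP0 τ) (by linarith [hC τ (Ioo_subset_Icc_self hτ) (v τ)])
    rw [intervalIntegral.integral_neg, hv.integral_eq_zero] at hpos
    simp at hpos
  refine ⟨sInf S, fun s hs hex => (csInf_le hbdd hex).not_gt hs, ?_, fun s hs => ?_⟩
  · obtain ⟨σ, hσa, hσlim, hσS⟩ := exists_seq_tendsto_sInf hne hbdd
    choose v hv using hσS
    obtain ⟨d, hd, hnegd⟩ := hneg (σ 0)
    obtain ⟨D, -, hD⟩ := exists_neumannSol_bound hP hP0 hψ hab.le C₀ (σ 0) d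
    have hvD : ∀ n, ∀ r ∈ Icc a b, |v n r| ≤ D := fun n =>
      hD G hG hC hnegd (σ n) (hσa (Nat.zero_le n)) (v n) (hv n)
    obtain ⟨H, hH⟩ := exists_bound_on_strip hG a b D
    have hσbd : ∀ n, |σ n| ≤ |sInf S| + |σ 0| := fun n => by
      have h1 := csInf_le hbdd ⟨v n, hv n⟩
      have h2 := hσa (Nat.zero_le n)
      rw [abs_le]
      constructor <;> linarith [neg_abs_le (sInf S), le_abs_self (σ 0), abs_nonneg (sInf S),
        abs_nonneg (σ 0)]
    have hmax : ∀ τ ∈ Icc a b, max a (τ - 0) = τ := fun τ hτ => by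
      rw [sub_zero, max_eq_right hτ.1]
    have ha : a ∈ Icc a b := ⟨le_rfl, hab.le⟩
    obtain ⟨w, hwc, hw, -⟩ := exists_limit_profile hP hP0 hψ hab.le
      (h := fun τ u => sInf S - G τ u) (continuous_const.sub hG) (v := v) (ε := fun _ => 0)
      (s := fun n => σ n - sInf S) (B := D) (H := |sInf S| + |σ 0| + H) (fun _ => le_rfl)
      tendsto_const_nhds (by simpa using hσlim.sub_const (sInf S)) (fun n => (hv n).1)
      (fun n => hvD n a ha)
      (fun n τ hτ => by
        rw [hmax τ hτ, show sInf S - G τ (v n τ) + (σ n - sInf S) = σ n - G τ (v n τ) by ring]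
        exact (abs_sub _ _).trans (add_le_add (hσbd n) (hH τ hτ _ (hvD n τ hτ))))
      (fun n => (hv n).2.congr hab.le fun τ hτ => by rw [hmax τ hτ]; ring)
      (u := fun _ => -D) continuous_const
      (fun n => ⟨a, ha, by rw [hmax a ha]; exact (abs_le.1 (hvD n a ha)).1⟩)
    exact ⟨w, hwc, hw⟩
  · obtain ⟨s₁, ⟨β, hβc, hβ⟩, hs₁⟩ := exists_lt_of_csInf_lt hne hs
    obtain ⟨d, hd, hnegd⟩ := hneg s
    exact exists_two_neumannSols hP hP0 hψ hψm hab hG hC hd hnegd hβc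
      (continuous_source hG hβc s₁) hβ fun r _ => by linarith

end Threshold

section Radial

/-- The radial weight, frozen to the left of the annulus so that it is positive everywhere. -/
def radialWeight (N : ℕ) (Ri t : ℝ) : ℝ := max Ri t ^ (N - 1)

variable {N : ℕ} {Ri Re : ℝ}

lemma continuous_radialWeight : Continuous (radialWeight N Ri) :=
  (continuous_const.max continuous_id).pow _

lemma radialWeight_pos (hRi : 0 < Ri) (t : ℝ) : 0 < radialWeight N Ri t :=
  pow_pos (lt_max_of_lt_left hRi) _

lemma radialWeight_of_le {t : ℝ} (ht : Ri ≤ t) : radialWeight N Ri t = t ^ (N - 1) := by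
  rw [radialWeight, max_eq_right ht]

lemma integral_radialWeight_mul {r : ℝ} (hr : Ri ≤ r) (q : ℝ → ℝ) :
    ∫ τ in Ri..r, radialWeight N Ri τ * q τ = ∫ τ in Ri..r, τ ^ (N - 1) * q τ := by
  refine intervalIntegral.integral_congr fun τ hτ => ?_
  rw [uIcc_of_le hr] at hτ
  simp only [radialWeight_of_le hτ.1]

variable {φ ψ : ℝ → ℝ} {G : ℝ → ℝ → ℝ}

lemma IsNeumannSol.isRadialSol (hRi : 0 < Ri) (hφ0 : φ 0 = 0)
    (hψ : Continuous ψ) (hψ0 : ψ 0 = 0) (hφψ : ∀ y, φ (ψ y) = y)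
    (hG : Continuous (Function.uncurry G)) {s : ℝ} {v : ℝ → ℝ}
    (hv : IsNeumannSol (radialWeight N Ri) ψ Ri Re G s v) : IsRadialSol N Ri Re φ G s v := by
  obtain ⟨hvc, hv⟩ := hv
  have hq := continuous_source hG hvc s
  have hder := continuous_profileDeriv (a := Ri) (continuous_radialWeight (N := N) (Ri := Ri))
    (radialWeight_pos hRi) hψ hq
  have hw : Continuous fun r => r ^ (N - 1) * (s - G r (v r)) :=
    (continuous_id.pow (N - 1)).mul hq
  have hleft : profileDeriv (radialWeight N Ri) ψ Ri (fun τ => s - G τ (v τ)) Ri = 0 := by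
    simp [profileDeriv, hψ0]
  refine ⟨profileDeriv (radialWeight N Ri) ψ Ri fun τ => s - G τ (v τ),
    fun r => r ^ (N - 1) * (s - G r (v r)), fun r hr => ?_, hder.continuousOn, hleft, ?_,
    hw.continuousOn.integrableOn_Icc, fun r hr => ?_, .of_forall fun r => by ring⟩
  · have h1 := ((hder.integral_hasStrictDerivAt Ri r).hasDerivAt.const_add (v Ri))
    exact h1.hasDerivWithinAt.congr hv.eq_profile (hv.eq_profile r hr)
  · simp [profileDeriv, hv.integral_eq_zero, hψ0]
  · rw [hleft, hφ0, mul_zero, zero_add, profileDeriv, hφψ, ← radialWeight_of_le hr.1,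
      mul_inv_cancel_left₀ (radialWeight_pos hRi r).ne', integral_radialWeight_mul hr.1]

lemma IsRadialSol.exists_isNeumannSol (hRi : 0 < Ri) (hRe : Ri < Re) (hφ0 : φ 0 = 0)
    (hψφ : ∀ x, ψ (φ x) = x) {s : ℝ}
    {v : ℝ → ℝ} (hv : IsRadialSol N Ri Re φ G s v) :
    ∃ u, IsNeumannSol (radialWeight N Ri) ψ Ri Re G s u := by
  obtain ⟨v', w, hder, hv'c, hv'l, hv'r, -, hflux, hae⟩ := hv
  have hvc : ContinuousOn v (Icc Ri Re) := fun r hr => (hder r hr).continuousWithinAt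
  set u : ℝ → ℝ := IccExtend hRe.le (fun r : Icc Ri Re => v r) with hu
  have huv : ∀ r ∈ Icc Ri Re, u r = v r := fun r hr => IccExtend_of_mem hRe.le _ hr
  have huc : Continuous u := (continuousOn_iff_continuous_domRestrict.1 hvc).Icc_extend'
  have hmem : ∀ r ∈ Icc Ri Re, ∀ τ ∈ Icc Ri r, τ ∈ Icc Ri Re := fun r hr τ hτ =>
    ⟨hτ.1, hτ.2.trans hr.2⟩
  have hint : ∀ r ∈ Icc Ri Re, ∫ τ in Ri..r, radialWeight N Ri τ * (s - G τ (u τ)) =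
      r ^ (N - 1) * φ (v' r) := by
    intro r hr
    rw [hflux r hr, hv'l, hφ0, mul_zero, zero_add]
    refine intervalIntegral.integral_congr_ae ?_
    rw [ae_restrict_iff' measurableSet_Icc] at hae
    filter_upwards [hae] with τ hτ hτm
    rw [uIoc_of_le hr.1] at hτm
    have hτ' := hmem r hr τ (Ioc_subset_Icc_self hτm)
    rw [radialWeight_of_le hτ'.1, huv τ hτ']
    linarith [hτ hτ']
  have hslope : ∀ r ∈ Icc Ri Re,
      profileDeriv (radialWeight N Ri) ψ Ri (fun τ => s - G τ (u τ)) r = v' r := by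
    intro r hr
    rw [profileDeriv, hint r hr, ← radialWeight_of_le hr.1,
      inv_mul_cancel_left₀ (radialWeight_pos hRi r).ne', hψφ]
  refine ⟨u, huc, fun r hr => ?_, ?_⟩
  · have h1 : ∫ t in Ri..r, v' t = v r - v Ri := by
      refine intervalIntegral.integral_eq_sub_of_hasDerivAt_of_le hr.1
        (hvc.mono fun τ hτ => hmem r hr τ hτ) (fun t ht => ?_) ?_
      · exact (hder t (hmem r hr t (Ioo_subset_Icc_self ht))).hasDerivAt
          (Icc_mem_nhds ht.1 (ht.2.trans_le hr.2))
      · refine ContinuousOn.intervalIntegrable ?_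
        rw [uIcc_of_le hr.1]
        exact hv'c.mono fun τ hτ => hmem r hr τ hτ
    have h2 : ∫ t in Ri..r, profileDeriv (radialWeight N Ri) ψ Ri (fun τ => s - G τ (u τ)) t =
        ∫ t in Ri..r, v' t := by
      refine intervalIntegral.integral_congr fun t ht => ?_
      rw [uIcc_of_le hr.1] at ht
      exact hslope t (hmem r hr t ht)
    rw [profile, h2, h1, huv r hr, huv Ri ⟨le_rfl, hRe.le⟩]
    ring
  · rw [hint Re ⟨hRe.le, le_rfl⟩, hv'r, hφ0, mul_zero]

/-- Coercivity in the mean along differentiable functions extends to continuous functions. -/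
lemma exists_negative_beyond (hRi : 0 < Ri) (hRe : Ri < Re)
    (hG : Continuous (Function.uncurry G)) {κ : ℝ} (hκ : |κ| = 1)
    (hcoer : ∀ σ : ℝ, ∃ d : ℝ, 0 < d ∧ ∀ v : ℝ → ℝ, ContinuousOn v (Icc Ri Re) →
      (∀ r ∈ Ioo Ri Re, DifferentiableAt ℝ v r) → (∀ r ∈ Icc Ri Re, d ≤ κ * v r) →
      σ * (∫ r in Icc Ri Re, r ^ (N - 1)) < ∫ r in Icc Ri Re, r ^ (N - 1) * G r (v r)) (σ : ℝ) :
    ∃ d : ℝ, 0 < d ∧ ∀ v : ℝ → ℝ, Continuous v → (∀ r ∈ Icc Ri Re, d ≤ κ * v r) →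
      ∫ τ in Ri..Re, radialWeight N Ri τ * (σ - G τ (v τ)) < 0 := by
  obtain ⟨d, hd, hcoer⟩ := hcoer (σ + 1)
  refine ⟨d + 1, by linarith, fun v hv hvd => ?_⟩
  have hP := continuous_radialWeight (N := N) (Ri := Ri)
  have hIcc : ∀ f : ℝ → ℝ, ∫ r in Icc Ri Re, r ^ (N - 1) * f r =
      ∫ r in Ri..Re, radialWeight N Ri r * f r := fun f => by
    rw [integral_radialWeight_mul hRe.le, intervalIntegral.integral_of_le hRe.le,
      integral_Icc_eq_integral_Ioc]
  choose p hp using fun n : ℕ => exists_polynomial_near_of_continuousOn Ri Re v hv.continuousOn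
    (1 / ((n : ℝ) + 1)) (by positivity)
  have hp1 : ∀ n, ∀ r ∈ Icc Ri Re, |(p n).eval r - v r| ≤ 1 := fun n r hr =>
    (hp n r hr).le.trans ((div_le_one (by positivity)).2 (by linarith [n.cast_nonneg (α := ℝ)]))
  have hpd : ∀ n, ∀ r ∈ Icc Ri Re, d ≤ κ * (p n).eval r := by
    intro n r hr
    have h1 : |κ * ((p n).eval r - v r)| ≤ 1 := by
      rw [abs_mul, hκ, one_mul]; exact hp1 n r hr
    rw [mul_sub] at h1
    linarith [(abs_le.1 h1).1, hvd r hr]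
  obtain ⟨M, hM⟩ := (isCompact_Icc (a := Ri) (b := Re)).exists_bound_of_continuousOn
    hv.continuousOn
  obtain ⟨H, hH⟩ := exists_bound_on_strip hG Ri Re (M + 1)
  have hlim : Tendsto
      (fun n => ∫ τ in Ri..Re, radialWeight N Ri τ * G τ ((p n).eval τ)) atTop
      (nhds (∫ τ in Ri..Re, radialWeight N Ri τ * G τ (v τ))) := by
    refine tendsto_integral_weight_mul hP (q := fun n τ => G τ ((p n).eval τ)) (H := H)
      (fun n => hG.comp (continuous_id.prodMk (p n).continuous)) hRe.le
      (fun n τ hτ => hH τ hτ _ ?_) fun τ hτ => ?_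
    · have h1 := abs_add_le ((p n).eval τ - v τ) (v τ)
      rw [sub_add_cancel] at h1
      have h2 : |v τ| ≤ M := hM τ hτ
      linarith [hp1 n τ hτ]
    · have h1 : Tendsto (fun n => (p n).eval τ) atTop (nhds (v τ)) := by
        rw [tendsto_iff_dist_tendsto_zero]
        exact squeeze_zero (fun _ => dist_nonneg) (fun n => (hp n τ hτ).le)
          tendsto_one_div_add_atTop_nhds_zero_nat
      exact (hG.tendsto (τ, v τ)).comp (tendsto_const_nhds.prodMk_nhds h1)
  have hle : (σ + 1) * ∫ τ in Ri..Re, radialWeight N Ri τ ≤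
      ∫ τ in Ri..Re, radialWeight N Ri τ * G τ (v τ) := by
    refine ge_of_tendsto' hlim fun n => ?_
    have h1 := (hcoer (fun r => (p n).eval r) (p n).continuous.continuousOn
      (fun r _ => (p n).differentiable r) (hpd n)).le
    rw [hIcc fun r => G r ((p n).eval r)] at h1
    have h2 := hIcc fun _ => 1
    simp only [mul_one] at h2
    rwa [h2] at h1
  have hpos : 0 < ∫ τ in Ri..Re, radialWeight N Ri τ :=
    intervalIntegral.intervalIntegral_pos_of_pos_on (hP.intervalIntegrable _ _)
      (fun τ _ => radialWeight_pos hRi τ) hRe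
  have hGv : Continuous fun τ => G τ (v τ) := hG.comp (continuous_id.prodMk hv)
  have heq : ∫ τ in Ri..Re, radialWeight N Ri τ * (σ - G τ (v τ)) =
      σ * (∫ τ in Ri..Re, radialWeight N Ri τ) -
        ∫ τ in Ri..Re, radialWeight N Ri τ * G τ (v τ) := by
    rw [← intervalIntegral.integral_const_mul, ← intervalIntegral.integral_sub
      ((continuous_const.fun_mul hP).intervalIntegrable _ _)
      ((hP.fun_mul hGv).intervalIntegrable _ _)]
    exact intervalIntegral.integral_congr fun τ _ => by ring
  rw [heq]
  linarith

end Radial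

/-- Ambrosetti–Prodi alternative for radially symmetric solutions of the parameter-dependent
Neumann problem on an annulus, under hypotheses `(G₁)`–`(G₄)`. -/
theorem statement18
    (N : ℕ) (hN : 2 ≤ N) (Ri Re : ℝ) (hRi : 0 < Ri) (hRe : Ri < Re)
    (A φ : ℝ → ℝ)
    (hAcont : ContinuousOn A (Ioi 0)) (hApos : ∀ ξ ∈ Ioi (0:ℝ), 0 < A ξ)
    (hφdef : ∀ ξ : ℝ, ξ ≠ 0 → φ ξ = A |ξ| * ξ) (hφ0 : φ 0 = 0)
    (hφmono : StrictMono φ) (hφcont : Continuous φ)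
    (hφsurj : Function.Surjective φ)
    (G : ℝ → ℝ → ℝ) (hG : Continuous fun p : ℝ × ℝ => G p.1 p.2)
    (hG1 : ∃ C₀ : ℝ, 0 < C₀ ∧ ∀ r ∈ Icc Ri Re, ∀ u : ℝ, -C₀ ≤ G r u)
    (hG2 : ∃ u₀ g₀ : ℝ, ∀ r ∈ Icc Ri Re, G r u₀ ≤ g₀)
    (hG3 : ∀ σ : ℝ, ∃ d : ℝ, 0 < d ∧ ∀ v : ℝ → ℝ, ContinuousOn v (Icc Ri Re) →
      (∀ r ∈ Ioo Ri Re, DifferentiableAt ℝ v r) →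
      (∀ r ∈ Icc Ri Re, v r ≤ -d) →
      σ * (∫ r in Icc Ri Re, r ^ (N - 1)) <
        ∫ r in Icc Ri Re, r ^ (N - 1) * G r (v r))
    (hG4 : ∀ σ : ℝ, ∃ d : ℝ, 0 < d ∧ ∀ v : ℝ → ℝ, ContinuousOn v (Icc Ri Re) →
      (∀ r ∈ Ioo Ri Re, DifferentiableAt ℝ v r) →
      (∀ r ∈ Icc Ri Re, d ≤ v r) →
      σ * (∫ r in Icc Ri Re, r ^ (N - 1)) <
        ∫ r in Icc Ri Re, r ^ (N - 1) * G r (v r)) :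
    ∃ s₀ : ℝ,
      (∀ s : ℝ, s < s₀ → ¬∃ v : ℝ → ℝ, IsRadialSol N Ri Re φ G s v) ∧
      (∃ v : ℝ → ℝ, IsRadialSol N Ri Re φ G s₀ v) ∧
      (∀ s : ℝ, s₀ < s → ∃ v₁ v₂ : ℝ → ℝ, IsRadialSol N Ri Re φ G s v₁ ∧
        IsRadialSol N Ri Re φ G s v₂ ∧ ∃ r ∈ Icc Ri Re, v₁ r ≠ v₂ r) := by
  have hG' : Continuous (Function.uncurry G) := hG
  set e : ℝ ≃o ℝ := hφmono.orderIsoOfSurjective φ hφsurj with he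
  have hψφ : ∀ x, e.symm (φ x) = x := e.symm_apply_apply
  have hφψ : ∀ y, φ (e.symm y) = y := e.apply_symm_apply
  have hψ0 : e.symm 0 = 0 := by rw [← hφ0, hψφ, hφ0]
  have hψ : Continuous e.symm := e.symm.continuous
  obtain ⟨C₀, -, hC⟩ := hG1
  obtain ⟨u₀, g₀, hu₀⟩ := hG2
  have hneg : ∀ σ, ∃ d, 0 < d ∧ NegativeBeyond (radialWeight N Ri) Ri Re G σ d := by
    intro σ
    obtain ⟨d₁, hd₁, h₁⟩ := exists_negative_beyond (N := N) hRi hRe hG' (κ := -1) (by simp)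
      (fun σ => (hG3 σ).imp fun d h => ⟨h.1, fun v hv hv' hvd =>
        h.2 v hv hv' fun r hr => by linarith [hvd r hr]⟩) σ
    obtain ⟨d₂, -, h₂⟩ := exists_negative_beyond (N := N) hRi hRe hG' (κ := 1) (by simp)
      (fun σ => (hG4 σ).imp fun d h => ⟨h.1, fun v hv hv' hvd =>
        h.2 v hv hv' fun r hr => by linarith [hvd r hr]⟩) σ
    refine ⟨max d₁ d₂, lt_max_of_lt_left hd₁, fun v hv hvd => ?_⟩
    rcases hvd with hvd | hvd
    · exact h₁ v hv fun r hr => by linarith [hvd r hr, le_max_left d₁ d₂]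
    · exact h₂ v hv fun r hr => by linarith [hvd r hr, le_max_right d₁ d₂]
  obtain ⟨s₀, hlt, ⟨v, hv⟩, hgt⟩ := exists_neumannSol_threshold continuous_radialWeight
    (radialWeight_pos hRi) hψ e.symm.strictMono hψ0 hRe hG' hC hu₀ hneg
  refine ⟨s₀, fun s hs ⟨v, hv⟩ => hlt s hs (hv.exists_isNeumannSol hRi hRe hφ0 hψφ),
    ⟨v, hv.isRadialSol hRi hφ0 hψ hψ0 hφψ hG'⟩, fun s hs => ?_⟩
  obtain ⟨v₁, v₂, hv₁, hv₂, hne⟩ := hgt s hs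
  exact ⟨v₁, v₂, hv₁.isRadialSol hRi hφ0 hψ hψ0 hφψ hG',
    hv₂.isRadialSol hRi hφ0 hψ hψ0 hφψ hG', hne⟩
end
end
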